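/- Let d2, d3 be integers with 3 ≤ d2 ≤ d3. There exists a tame automorphism F of ℂ³ with multidegree mdeg F = (3, d2, d3) if and only if 3 divides d2 or d3 ∈ 3ℕ + d2ℕ (i.e., d3 = 3a + b·d2 for some natural numbers a, b). -/

import Mathlib

open MvPolynomial

/-- The multidegree of a polynomial automorphism of `ℂⁿ`: the sequence of total degrees of the
images of the variables. -/
noncomputable def polyMdeg {n : ℕ} (F : MvPolynomial (Fin n) ℂ ≃ₐ[ℂ] MvPolynomial (Fin n) ℂ) :
    Fin n → ℕ := fun i => (F (X i)).totalDegree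

/-- An automorphism is affine (linear) if it maps each variable to a polynomial of degree ≤ 1. -/
def IsAffineAut {n : ℕ} (F : MvPolynomial (Fin n) ℂ ≃ₐ[ℂ] MvPolynomial (Fin n) ℂ) : Prop :=
  ∀ i, (F (X i)).totalDegree ≤ 1

/-- An automorphism is elementary (triangular) if it sends one variable `xᵢ` to `xᵢ + p`, where
`p` is a polynomial in the other variables, and fixes all other variables. -/
def IsElementaryAut {n : ℕ} (F : MvPolynomial (Fin n) ℂ ≃ₐ[ℂ] MvPolynomial (Fin n) ℂ) : Prop :=
  ∃ (i : Fin n) (p : MvPolynomial (Fin n) ℂ), degreeOf i p = 0 ∧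
    F (X i) = X i + p ∧ ∀ j, j ≠ i → F (X j) = X j

/-- A tame automorphism is a composition of affine and elementary automorphisms, i.e. an element
of the subgroup generated by these. -/
def IsTameAut {n : ℕ} (F : MvPolynomial (Fin n) ℂ ≃ₐ[ℂ] MvPolynomial (Fin n) ℂ) : Prop :=
  F ∈ Subgroup.closure {G : MvPolynomial (Fin n) ℂ ≃ₐ[ℂ] MvPolynomial (Fin n) ℂ |
    IsAffineAut G ∨ IsElementaryAut G}



/-! Part 1 -/
set_option linter.unusedSectionVars false

abbrev PR := MvPolynomial (Fin 3) ℂ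

/-- Admissible weights. -/
class GoodW (w : Fin 3 → ℝ) : Prop where
  one_le : ∀ i, 1 ≤ w i
  lt_two : ∀ i, w i < 2
  indep : ∀ α : Fin 3 → ℤ, ∑ i, w i * (α i : ℝ) = 0 → α = 0

noncomputable def wt (w : Fin 3 → ℝ) (α : Fin 3 →₀ ℕ) : ℝ := ∑ i, w i * (α i : ℝ)

noncomputable def deg (w : Fin 3 → ℝ) (p : PR) : ℝ :=
  if h : p.support.Nonempty then p.support.sup' h (wt w) else 0

lemma wt_add (w : Fin 3 → ℝ) (α β) : wt w (α + β) = wt w α + wt w β := by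
  simp [wt, mul_add, Finset.sum_add_distrib]

lemma wt_zero (w : Fin 3 → ℝ) : wt w 0 = 0 := by simp [wt]

section
variable (w : Fin 3 → ℝ) [hw : GoodW w]

lemma wt_inj {α β : Fin 3 →₀ ℕ} (h : wt w α = wt w β) : α = β := by
  have := hw.indep (fun i => (α i : ℤ) - β i) (by
    simp only [wt] at h
    push_cast
    simp only [mul_sub, Finset.sum_sub_distrib]
    linarith)
  ext i
  have h2 := congrFun this i
  simp at h2
  omega

lemma wt_nonneg (α : Fin 3 →₀ ℕ) : 0 ≤ wt w α :=
  Finset.sum_nonneg fun i _ => mul_nonneg (by linarith [hw.one_le i]) (Nat.cast_nonneg _)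

lemma wt_ge_one {α : Fin 3 →₀ ℕ} (h : α ≠ 0) : 1 ≤ wt w α := by
  obtain ⟨i, hi⟩ := Finsupp.ne_iff.mp h
  have h1 : (1:ℝ) ≤ (α i : ℝ) := by
    have : 1 ≤ α i := Nat.one_le_iff_ne_zero.mpr (by simpa using hi)
    exact_mod_cast this
  have h2 : w i * (α i : ℝ) ≤ wt w α :=
    Finset.single_le_sum (f := fun i => w i * (α i : ℝ))
      (fun j _ => mul_nonneg (by linarith [hw.one_le j]) (Nat.cast_nonneg _)) (Finset.mem_univ i)
  nlinarith [hw.one_le i]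

lemma deg_zero' : deg w 0 = 0 := by simp [deg]

lemma wt_le_deg {p : PR} {α} (h : coeff α p ≠ 0) : wt w α ≤ deg w p := by
  have h1 : α ∈ p.support := mem_support_iff.mpr h
  have h2 : p.support.Nonempty := ⟨α, h1⟩
  rw [deg, dif_pos h2]
  exact Finset.le_sup' (wt w) h1

lemma exists_deg {p : PR} (h : p ≠ 0) : ∃ α, coeff α p ≠ 0 ∧ wt w α = deg w p := by
  have h2 : p.support.Nonempty := by
    rwa [Finset.nonempty_iff_ne_empty, ne_eq, MvPolynomial.support_eq_empty]
  rw [deg, dif_pos h2]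
  obtain ⟨α, h3, h4⟩ := Finset.exists_mem_eq_sup' h2 (wt w)
  exact ⟨α, mem_support_iff.mp h3, h4.symm⟩

lemma deg_nonneg (p : PR) : 0 ≤ deg w p := by
  by_cases h : p = 0
  · subst h; rw [deg_zero']
  · obtain ⟨α, h1, h2⟩ := exists_deg w h
    rw [← h2]; exact wt_nonneg w α

lemma deg_le {p : PR} {d : ℝ} (hd : 0 ≤ d) (h : ∀ α, coeff α p ≠ 0 → wt w α ≤ d) :
    deg w p ≤ d := by
  by_cases h0 : p = 0
  · subst h0; rwa [deg_zero']
  · obtain ⟨α, h1, h2⟩ := exists_deg w h0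
    rw [← h2]; exact h α h1

lemma deg_lt {p : PR} {d : ℝ} (hd : 0 < d) (h : ∀ α, coeff α p ≠ 0 → wt w α < d) :
    deg w p < d := by
  by_cases h0 : p = 0
  · subst h0; rwa [deg_zero']
  · obtain ⟨α, h1, h2⟩ := exists_deg w h0
    rw [← h2]; exact h α h1

lemma deg_add_le (p q : PR) : deg w (p + q) ≤ max (deg w p) (deg w q) := by
  refine deg_le w (le_max_of_le_left (deg_nonneg w p)) fun α h => ?_
  by_cases h1 : coeff α p = 0
  · refine le_max_of_le_right (wt_le_deg w ?_)
    intro h2; apply h; simp [h1, h2]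
  · exact le_max_of_le_left (wt_le_deg w h1)

lemma deg_C' (c : ℂ) : deg w (C c) = 0 := by
  refine le_antisymm (deg_le w le_rfl fun α h => ?_) (deg_nonneg w _)
  rw [coeff_C] at h
  have : α = 0 := by
    by_contra h2; exact h (if_neg (fun h3 => h2 h3.symm))
  rw [this, wt_zero]

lemma deg_smul' {c : ℂ} (hc : c ≠ 0) (p : PR) : deg w (c • p) = deg w p := by
  apply le_antisymm <;> refine deg_le w (deg_nonneg w _) fun α h => wt_le_deg w ?_
  · intro h2; apply h; simp [h2]
  · rw [coeff_smul, smul_eq_mul]; exact mul_ne_zero hc h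

lemma deg_smul_le (c : ℂ) (p : PR) : deg w (c • p) ≤ deg w p := by
  by_cases hc : c = 0
  · subst hc; simp [deg_zero', deg_nonneg]
  · rw [deg_smul' w hc]

lemma deg_neg' (p : PR) : deg w (-p) = deg w p := by
  have := deg_smul' w (c := -1) (by norm_num) p
  simpa using this

lemma deg_sub_le (p q : PR) : deg w (p - q) ≤ max (deg w p) (deg w q) := by
  rw [sub_eq_add_neg, ← deg_neg' w q]; exact deg_add_le w _ _

lemma deg_add_eq {p q : PR} (h : deg w q < deg w p) : deg w (p + q) = deg w p := by
  apply le_antisymm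
  · have := deg_add_le w p q
    rwa [max_eq_left h.le] at this
  · have h1 := deg_sub_le w (p + q) q
    rw [add_sub_cancel_right] at h1
    rcases le_max_iff.mp h1 with h2 | h2
    · exact h2
    · linarith

lemma deg_add_C (p : PR) (c : ℂ) : deg w (p + C c) = deg w p := by
  apply le_antisymm
  · have := deg_add_le w p (C c)
    rwa [deg_C', max_eq_left (deg_nonneg w p)] at this
  · have := deg_sub_le w (p + C c) (C c)
    rwa [deg_C', add_sub_cancel_right, max_eq_left (deg_nonneg w _)] at this

lemma coeff_mul_lead {p q : PR} {α β} (h1 : wt w α = deg w p) (h2 : wt w β = deg w q) :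
    coeff (α + β) (p * q) = coeff α p * coeff β q := by
  rw [coeff_mul]
  refine Finset.sum_eq_single (α, β) ?_ ?_
  · rintro ⟨x, y⟩ hxy hne
    rw [Finset.HasAntidiagonal.mem_antidiagonal] at hxy
    simp only at hxy
    by_contra hc
    have hx := wt_le_deg w (left_ne_zero_of_mul hc)
    have hy := wt_le_deg w (right_ne_zero_of_mul hc)
    have hs : wt w x + wt w y = wt w α + wt w β := by rw [← wt_add, ← wt_add, hxy]
    have e1 : x = α := wt_inj w (by linarith)
    have e2 : y = β := wt_inj w (by linarith)
    exact hne (by rw [e1, e2])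
  · intro h; exact (h (Finset.HasAntidiagonal.mem_antidiagonal.mpr rfl)).elim

lemma deg_mul_le (p q : PR) : deg w (p * q) ≤ deg w p + deg w q := by
  refine deg_le w (add_nonneg (deg_nonneg w _) (deg_nonneg w _)) fun α h => ?_
  rw [coeff_mul] at h
  obtain ⟨⟨x, y⟩, h1, h2⟩ := Finset.exists_ne_zero_of_sum_ne_zero h
  rw [Finset.HasAntidiagonal.mem_antidiagonal] at h1
  rw [← h1, wt_add]
  exact add_le_add (wt_le_deg w (left_ne_zero_of_mul h2)) (wt_le_deg w (right_ne_zero_of_mul h2))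

lemma deg_mul' {p q : PR} (hp : p ≠ 0) (hq : q ≠ 0) : deg w (p * q) = deg w p + deg w q := by
  apply le_antisymm (deg_mul_le w p q)
  obtain ⟨α, h1, h2⟩ := exists_deg w hp
  obtain ⟨β, h3, h4⟩ := exists_deg w hq
  rw [← h2, ← h4, ← wt_add]
  apply wt_le_deg
  rw [coeff_mul_lead w h2 h4]
  exact mul_ne_zero h1 h3

lemma deg_pow' {p : PR} (hp : p ≠ 0) (n : ℕ) : deg w (p ^ n) = n * deg w p := by
  induction n with
  | zero => simpa using deg_C' w 1
  | succ n ih => rw [pow_succ, deg_mul' w (pow_ne_zero n hp) hp, ih]; push_cast; ring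

lemma ne_zero_of_deg {p : PR} (h : 0 < deg w p) : p ≠ 0 := by
  rintro rfl; simp [deg] at h

/-- equal degrees: leading terms are proportional -/
lemma exists_lead {p q : PR} (h : deg w p = deg w q) (hp : 0 < deg w p) :
    ∃ c : ℂ, c ≠ 0 ∧ deg w (p + c • q) < deg w p := by
  obtain ⟨α, h1, h2⟩ := exists_deg w (ne_zero_of_deg w hp)
  obtain ⟨β, h3, h4⟩ := exists_deg w (ne_zero_of_deg w (h ▸ hp))
  have e : α = β := wt_inj w (by rw [h2, h4, h])
  subst e
  refine ⟨-(coeff α p / coeff α q), neg_ne_zero.mpr (div_ne_zero h1 h3), ?_⟩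
  refine deg_lt w hp fun γ hγ => ?_
  have hle : wt w γ ≤ deg w p := by
    have := deg_add_le w p (-(coeff α p / coeff α q) • q)
    rw [deg_smul' w (neg_ne_zero.mpr (div_ne_zero h1 h3)), ← h, max_self] at this
    exact (wt_le_deg w hγ).trans this
  refine lt_of_le_of_ne hle fun he => hγ ?_
  have : γ = α := wt_inj w (by rw [he, h2])
  subst this
  simp
  field_simp
  ring

lemma eq_C_of_deg {p : PR} (h : deg w p = 0) : ∃ c, p = C c := by
  refine ⟨coeff 0 p, ?_⟩
  ext α
  rw [coeff_C]
  split_ifs with h1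
  · rw [h1]
  · by_contra h2
    have := wt_le_deg w h2
    have := wt_ge_one w (α := α) (fun h => h1 h.symm)
    linarith

lemma deg_ge_one {p : PR} (h : 0 < deg w p) : 1 ≤ deg w p := by
  obtain ⟨α, h1, h2⟩ := exists_deg w (ne_zero_of_deg w h)
  rw [← h2] at h ⊢
  apply wt_ge_one
  rintro rfl
  rw [wt_zero] at h; exact lt_irrefl _ h

lemma deg_pos_of_coeff {p : PR} (h : p ≠ 0) (h0 : coeff 0 p = 0) : 0 < deg w p := by
  rcases (deg_nonneg w p).lt_or_eq with h1 | h1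
  · exact h1
  · obtain ⟨c, rfl⟩ := eq_C_of_deg w h1.symm
    simp at h0; subst h0; simp at h

lemma deg_sum_lt {ι : Type*} (s : Finset ι) (f : ι → PR) {d : ℝ} (hd : 0 < d)
    (h : ∀ i ∈ s, deg w (f i) < d) : deg w (∑ i ∈ s, f i) < d := by
  classical
  induction s using Finset.induction_on with
  | empty => simpa [deg_zero'] using hd
  | insert a s ha ih =>
    rw [Finset.sum_insert ha]
    refine (deg_add_le w _ _).trans_lt (max_lt (h a (by simp)) (ih fun i hi => h i (by simp [hi])))

lemma deg_sum_le {ι : Type*} (s : Finset ι) (f : ι → PR) {d : ℝ} (hd : 0 ≤ d)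
    (h : ∀ i ∈ s, deg w (f i) ≤ d) : deg w (∑ i ∈ s, f i) ≤ d := by
  classical
  induction s using Finset.induction_on with
  | empty => simpa [deg_zero'] using hd
  | insert a s ha ih =>
    rw [Finset.sum_insert ha]
    refine (deg_add_le w _ _).trans (max_le (h a (by simp)) (ih fun i hi => h i (by simp [hi])))

/-- well-foundedness of the values. -/
def wtS (w : Fin 3 → ℝ) : Set ℝ := Set.range (wt w)

lemma wtS_wf : (wtS w).IsWF := by
  have h1 : (Set.univ : Set (Fin 3 →₀ ℕ)).IsPWO := Set.isPWO_of_wellQuasiOrderedLE _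
  have h2 := h1.image_of_monotone (f := wt w) (by
    intro α β h
    exact Finset.sum_le_sum fun i _ => mul_le_mul_of_nonneg_left (by exact_mod_cast h i)
      (by linarith [hw.one_le i]))
  rw [Set.image_univ] at h2
  exact h2.isWF

lemma deg_mem (p : PR) : deg w p ∈ wtS w := by
  by_cases h : p = 0
  · subst h; exact ⟨0, by rw [deg_zero', wt_zero]⟩
  · obtain ⟨α, _, h2⟩ := exists_deg w h
    exact ⟨α, h2⟩

lemma wtS_add {x y : ℝ} (hx : x ∈ wtS w) (hy : y ∈ wtS w) : x + y ∈ wtS w := by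
  obtain ⟨a, rfl⟩ := hx
  obtain ⟨b, rfl⟩ := hy
  exact ⟨a + b, wt_add w a b⟩

/-- induction on the degree of a polynomial -/
lemma deg_wf : WellFounded (fun p q : PR => deg w p < deg w q) := by
  have h := (wtS_wf w)
  rw [Set.IsWF, Set.wellFoundedOn_iff] at h
  refine Subrelation.wf (r := InvImage _ (deg w)) ?_ (InvImage.wf (deg w) h)
  intro p q hpq
  exact ⟨hpq, deg_mem w p, deg_mem w q⟩

end


/-! Part 2 -/
set_option linter.unusedSectionVars false

/-- Euler-type derivations `x_i ∂_i`. -/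
noncomputable def E (i : Fin 3) : Derivation ℂ PR PR := (X i : PR) • pderiv i

lemma coeff_E (i : Fin 3) (α : Fin 3 →₀ ℕ) (f : PR) :
    coeff α (E i f) = (α i : ℂ) * coeff α f := by
  induction f using MvPolynomial.induction_on' with
  | monomial β c =>
    simp only [E, Derivation.smul_apply, smul_eq_mul, pderiv_monomial, coeff_monomial]
    by_cases h : β i = 0
    · simp only [h, Nat.cast_zero, mul_zero, monomial_zero, coeff_zero]
      split_ifs with h2
      · subst h2; simp [h]
      · simp
    · rw [X, monomial_mul, coeff_monomial]
      have : Finsupp.single i 1 + (β - Finsupp.single i 1) = β := by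
        ext j
        by_cases hj : i = j
        · subst hj; simp; omega
        · simp [Finsupp.single_apply, hj]
      rw [this]
      split_ifs with h2
      · subst h2; ring
      · simp
  | add p q hp hq => simp [hp, hq, mul_add]

/-- weighted Euler derivation -/
noncomputable def Eu (w : Fin 3 → ℝ) (f : PR) : PR :=
  C (w 0 : ℂ) * E 0 f + C (w 1 : ℂ) * E 1 f + C (w 2 : ℂ) * E 2 f

/-- cross product of gradients -/
noncomputable def cr (f g : PR) : Fin 3 → PR :=
  ![E 1 f * E 2 g - E 2 f * E 1 g, E 2 f * E 0 g - E 0 f * E 2 g, E 0 f * E 1 g - E 1 f * E 0 g]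

noncomputable def dt (a b c : PR) : PR :=
  E 0 a * (E 1 b * E 2 c - E 2 b * E 1 c) + E 1 a * (E 2 b * E 0 c - E 0 b * E 2 c)
    + E 2 a * (E 0 b * E 1 c - E 1 b * E 0 c)

noncomputable def vd (w : Fin 3 → ℝ) (v : Fin 3 → PR) : ℝ :=
  max (deg w (v 0)) (max (deg w (v 1)) (deg w (v 2)))

noncomputable def Dl (w : Fin 3 → ℝ) (f g : PR) : ℝ := vd w (cr f g)

def K3 (a b c : PR) : Prop := dt a b c ≠ 0

lemma cr0 (f g : PR) : cr f g 0 = E 1 f * E 2 g - E 2 f * E 1 g := rfl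
lemma cr1 (f g : PR) : cr f g 1 = E 2 f * E 0 g - E 0 f * E 2 g := rfl
lemma cr2 (f g : PR) : cr f g 2 = E 0 f * E 1 g - E 1 f * E 0 g := rfl

lemma cr_ext {v u : Fin 3 → PR} (h0 : v 0 = u 0) (h1 : v 1 = u 1) (h2 : v 2 = u 2) : v = u := by
  ext1 i; fin_cases i <;> assumption

lemma cr_swap (f g : PR) : cr g f = -cr f g := by
  apply cr_ext <;> simp only [cr0, cr1, cr2, Pi.neg_apply] <;> ring

lemma cr_self (f : PR) : cr f f = 0 := by
  apply cr_ext <;> simp only [cr0, cr1, cr2, Pi.zero_apply] <;> ring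

lemma cr_add (f g h : PR) : cr f (g + h) = cr f g + cr f h := by
  apply cr_ext <;> simp only [cr0, cr1, cr2, Pi.add_apply, map_add] <;> ring

lemma cr_smul (f g : PR) (c : ℂ) : cr f (c • g) = c • cr f g := by
  apply cr_ext <;> simp only [cr0, cr1, cr2, Pi.smul_apply, Derivation.map_smul] <;> simp only [smul_eq_C_mul] <;> ring

lemma E_C (i : Fin 3) (c : ℂ) : E i (C c) = 0 := by
  have := (E i).map_algebraMap c
  simpa using this

lemma cr_C (f : PR) (c : ℂ) : cr f (C c) = 0 := by
  apply cr_ext <;> simp only [cr0, cr1, cr2, Pi.zero_apply, E_C] <;> ring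

lemma cr_mul (f g h : PR) : cr f (g * h) = g • cr f h + h • cr f g := by
  apply cr_ext <;> simp only [cr0, cr1, cr2, Pi.add_apply, Pi.smul_apply, Derivation.leibniz, smul_eq_mul] <;> ring

lemma dt_rot (a b c : PR) : dt b c a = dt a b c := by simp only [dt]; ring
lemma dt_swap (a b c : PR) : dt b a c = - dt a b c := by simp only [dt]; ring

lemma K3.rot {a b c : PR} (h : K3 a b c) : K3 b c a := by rwa [K3, dt_rot]
lemma K3.swap {a b c : PR} (h : K3 a b c) : K3 b a c := by
  rw [K3, dt_swap]; exact neg_ne_zero.mpr h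
lemma K3.swap23 {a b c : PR} (h : K3 a b c) : K3 a c b := h.swap.rot

lemma dt_eq (a b c : PR) : dt a b c = E 0 c * cr a b 0 + E 1 c * cr a b 1 + E 2 c * cr a b 2 := by
  simp only [dt, cr0, cr1, cr2]; ring

lemma K3.cr12 {a b c : PR} (h : K3 a b c) : cr a b ≠ 0 := by
  intro h2; apply h; rw [dt_eq, h2]; simp

section
variable (w : Fin 3 → ℝ) [hw : GoodW w]

lemma deg_E_le (i : Fin 3) (f : PR) : deg w (E i f) ≤ deg w f := by
  refine deg_le w (deg_nonneg w f) fun α h => wt_le_deg w fun h2 => h ?_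
  rw [coeff_E, h2, mul_zero]

lemma coeff_Eu (α : Fin 3 →₀ ℕ) (f : PR) : coeff α (Eu w f) = (wt w α : ℂ) * coeff α f := by
  simp only [Eu, coeff_add, coeff_C_mul, coeff_E, wt, Fin.sum_univ_three]
  push_cast; ring

lemma deg_Eu (f : PR) : deg w (Eu w f) = deg w f := by
  apply le_antisymm
  · refine deg_le w (deg_nonneg w f) fun α h => wt_le_deg w fun h2 => h ?_
    rw [coeff_Eu, h2, mul_zero]
  · refine deg_le w (deg_nonneg w _) fun α h => ?_
    by_cases h0 : wt w α = 0
    · rw [h0]; exact deg_nonneg w _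
    · apply wt_le_deg; rw [coeff_Eu]
      exact mul_ne_zero (by exact_mod_cast h0) h

lemma vd_nonneg (v : Fin 3 → PR) : 0 ≤ vd w v := le_max_of_le_left (deg_nonneg w _)

lemma le_vd (v : Fin 3 → PR) (i : Fin 3) : deg w (v i) ≤ vd w v := by
  fin_cases i
  · exact le_max_left _ _
  · exact le_max_of_le_right (le_max_left _ _)
  · exact le_max_of_le_right (le_max_right _ _)

lemma vd_le {v : Fin 3 → PR} {d : ℝ} (h : ∀ i, deg w (v i) ≤ d) : vd w v ≤ d :=
  max_le (h 0) (max_le (h 1) (h 2))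

lemma exists_vd (v : Fin 3 → PR) : ∃ i, deg w (v i) = vd w v := by
  rcases max_choice (deg w (v 0)) (max (deg w (v 1)) (deg w (v 2))) with h | h
  · exact ⟨0, h.symm⟩
  · rcases max_choice (deg w (v 1)) (deg w (v 2)) with h' | h'
    · exact ⟨1, by rw [vd, h, h']⟩
    · exact ⟨2, by rw [vd, h, h']⟩

lemma vd_add_le (u v : Fin 3 → PR) : vd w (u + v) ≤ max (vd w u) (vd w v) :=
  vd_le w fun i => (deg_add_le w _ _).trans (max_le_max (le_vd w u i) (le_vd w v i))

lemma vd_neg (v : Fin 3 → PR) : vd w (-v) = vd w v := by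
  simp [vd, deg_neg']

lemma vd_smul_le (s : PR) (v : Fin 3 → PR) : vd w (s • v) ≤ deg w s + vd w v :=
  vd_le w fun i => (deg_mul_le w _ _).trans (add_le_add le_rfl (le_vd w v i))

lemma vd_smul {s : PR} (hs : s ≠ 0) {v : Fin 3 → PR} (hv : v ≠ 0) :
    vd w (s • v) = deg w s + vd w v := by
  apply le_antisymm (vd_smul_le w s v)
  -- choose a nonzero component of maximal degree
  obtain ⟨i, hi⟩ := exists_vd w v
  by_cases h0 : v i = 0
  · rw [h0, deg_zero'] at hi
    obtain ⟨j, hj⟩ := Function.ne_iff.mp hv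
    have h1 := le_vd w (s • v) j
    rw [Pi.smul_apply, smul_eq_mul, deg_mul' w hs (by simpa using hj)] at h1
    linarith [deg_nonneg w (v j)]
  · have h1 := le_vd w (s • v) i
    rw [Pi.smul_apply, smul_eq_mul, deg_mul' w hs h0, hi] at h1
    exact h1

lemma vd_csmul {c : ℂ} (hc : c ≠ 0) (v : Fin 3 → PR) : vd w (c • v) = vd w v := by
  simp [vd, deg_smul' w hc]

lemma Dl_nonneg (f g : PR) : 0 ≤ Dl w f g := vd_nonneg w _

lemma Dl_comm (f g : PR) : Dl w f g = Dl w g f := by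
  rw [Dl, cr_swap, vd_neg]; rfl

lemma Dl_le (f g : PR) : Dl w f g ≤ deg w f + deg w g := by
  refine vd_le w fun i => ?_
  have key : ∀ i j k l : Fin 3, deg w (E i f * E j g - E k f * E l g) ≤ deg w f + deg w g :=
    fun i j k l => (deg_sub_le w _ _).trans (max_le
      ((deg_mul_le w _ _).trans (add_le_add (deg_E_le w _ _) (deg_E_le w _ _)))
      ((deg_mul_le w _ _).trans (add_le_add (deg_E_le w _ _) (deg_E_le w _ _))))
  fin_cases i <;> apply key

lemma Dl_add_le (f g h : PR) : Dl w f (g + h) ≤ max (Dl w f g) (Dl w f h) := by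
  rw [Dl, cr_add]; exact vd_add_le w _ _

lemma Dl_smul (f g : PR) {c : ℂ} (hc : c ≠ 0) : Dl w f (c • g) = Dl w f g := by
  rw [Dl, cr_smul, vd_csmul w hc]; rfl

lemma Dl_smul_le (f g : PR) (c : ℂ) : Dl w f (c • g) ≤ Dl w f g := by
  by_cases hc : c = 0
  · subst hc
    have : cr f ((0:ℂ) • g) = 0 := by rw [cr_smul, zero_smul]
    rw [Dl, this]; simp [vd, deg_zero', Dl_nonneg]
  · rw [Dl_smul w f g hc]

lemma Dl_add_eq {f g h : PR} (h1 : Dl w f h < Dl w f g) : Dl w f (g + h) = Dl w f g := by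
  apply le_antisymm
  · exact (Dl_add_le w f g h).trans (max_le le_rfl h1.le)
  · have h2 := Dl_add_le w f (g + h) ((-1:ℂ) • h)
    rw [Dl_smul w _ _ (by norm_num)] at h2
    rw [show g + h + (-1:ℂ) • h = g by simp] at h2
    rcases le_max_iff.mp h2 with h3 | h3
    · exact h3
    · linarith

lemma Dl_self (f : PR) : Dl w f f = 0 := by simp [Dl, cr_self, vd, deg_zero']
lemma Dl_zero_of {f g : PR} (h : cr f g = 0) : Dl w f g = 0 := by simp [Dl, h, vd, deg_zero']
lemma Dl_C (f : PR) (c : ℂ) : Dl w f (C c) = 0 := Dl_zero_of w (cr_C f c)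

lemma coeff_E0 (i : Fin 3) (f : PR) : coeff 0 (E i f) = 0 := by simp [coeff_E]

lemma constE (i j : Fin 3) (f g : PR) : coeff 0 (E i f * E j g) = 0 := by
  have h := coeff_E0 i f
  rw [← constantCoeff_eq] at h ⊢
  rw [map_mul, h, zero_mul]

lemma Dl_pos {f g : PR} (h : cr f g ≠ 0) : 1 ≤ Dl w f g := by
  obtain ⟨i, hi⟩ := Function.ne_iff.mp h
  refine (deg_ge_one w ?_).trans (le_vd w (cr f g) i)
  refine deg_pos_of_coeff w hi ?_
  fin_cases i <;> simp [cr, constE]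

lemma dt_pos {a b c : PR} (h : K3 a b c) : 1 ≤ deg w (dt a b c) := by
  refine deg_ge_one w (deg_pos_of_coeff w h ?_)
  have h0 := coeff_E0 0 a
  have h1 := coeff_E0 1 a
  have h2 := coeff_E0 2 a
  rw [← constantCoeff_eq] at *
  simp [dt, h0, h1, h2]

lemma dt_le (a b c : PR) : deg w (dt a b c) ≤ deg w c + Dl w a b := by
  rw [dt_eq]
  have key : ∀ i, deg w (E i c * cr a b i) ≤ deg w c + Dl w a b := fun i =>
    (deg_mul_le w _ _).trans (add_le_add (deg_E_le w _ _) (le_vd w _ _))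
  exact (deg_add_le w _ _).trans (max_le ((deg_add_le w _ _).trans (max_le (key 0) (key 1))) (key 2))

lemma K3.pos {a b c : PR} (h : K3 a b c) : 1 ≤ deg w a := by
  apply deg_ge_one
  rcases (deg_nonneg w a).lt_or_eq with h1 | h1
  · exact h1
  · obtain ⟨x, rfl⟩ := eq_C_of_deg w h1.symm
    exfalso; apply h; simp [dt, E_C]

lemma D1id (f g h : PR) (i : Fin 3) :
    Eu w f * cr g h i = C (w i : ℂ) * dt f g h - Eu w g * cr h f i - Eu w h * cr f g i := by
  fin_cases i <;> simp [Eu, cr, dt] <;> ring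

/-- maximum attained twice -/
lemma D1 {f g h : PR} (hK : K3 f g h) :
    deg w f + Dl w g h ≤ max (deg w g + Dl w f h) (deg w h + Dl w f g) := by
  have h1 : deg w (Eu w f) + vd w (cr g h) = vd w (Eu w f • cr g h) := by
    rw [vd_smul w _ hK.rot.cr12]
    apply ne_zero_of_deg w
    rw [deg_Eu]; linarith [hK.pos w]
  rw [deg_Eu] at h1
  rw [Dl, h1]
  refine vd_le w fun i => ?_
  rw [Pi.smul_apply, smul_eq_mul, D1id]
  refine (deg_sub_le w _ _).trans (max_le ((deg_sub_le w _ _).trans (max_le ?_ ?_)) ?_)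
  · refine le_max_of_le_right ?_
    rw [← smul_eq_C_mul]
    exact (deg_smul_le w _ _).trans (dt_le w f g h)
  · refine le_max_of_le_left ?_
    rw [Dl_comm w f h]
    exact (deg_mul_le w _ _).trans (add_le_add (deg_Eu w g).le (le_vd w _ _))
  · refine le_max_of_le_right ?_
    exact (deg_mul_le w _ _).trans (add_le_add (deg_Eu w h).le (le_vd w _ _))

lemma exists_E (f : PR) : ∃ i, deg w (E i f) = deg w f := by
  by_contra hc
  push Not at hc
  have h0 := lt_of_le_of_ne (deg_E_le w 0 f) (hc 0)
  have h1 := lt_of_le_of_ne (deg_E_le w 1 f) (hc 1)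
  have h2 := lt_of_le_of_ne (deg_E_le w 2 f) (hc 2)
  have h3 : deg w (Eu w f) < deg w f := by
    simp only [Eu, ← smul_eq_C_mul]
    refine (deg_add_le w _ _).trans_lt (max_lt ((deg_add_le w _ _).trans_lt (max_lt ?_ ?_)) ?_)
    · exact (deg_smul_le w _ _).trans_lt h0
    · exact (deg_smul_le w _ _).trans_lt h1
    · exact (deg_smul_le w _ _).trans_lt h2
  rw [deg_Eu] at h3
  exact lt_irrefl _ h3

lemma D2id (f g h : PR) (i : Fin 3) : ∃ j k, dt f g h * E i f =
    cr f g j * cr f h k - cr f g k * cr f h j := by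
  fin_cases i
  · exact ⟨1, 2, by simp [cr, dt]; ring⟩
  · exact ⟨2, 0, by simp [cr, dt]; ring⟩
  · exact ⟨0, 1, by simp [cr, dt]; ring⟩

lemma D2 {f g h : PR} (hK : K3 f g h) : deg w f < Dl w f g + Dl w f h := by
  obtain ⟨i, hi⟩ := exists_E w f
  obtain ⟨j, k, e⟩ := D2id f g h i
  have hf : 0 < deg w f := by linarith [hK.pos w]
  have hE : E i f ≠ 0 := ne_zero_of_deg w (by rw [hi]; exact hf)
  have h1 := deg_mul' w hK hE
  rw [e, hi] at h1
  have h2 := deg_sub_le w (cr f g j * cr f h k) (cr f g k * cr f h j)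
  rw [h1] at h2
  have h3 := h2.trans (max_le
    ((deg_mul_le w _ _).trans (add_le_add (le_vd w _ j) (le_vd w _ k)))
    ((deg_mul_le w _ _).trans (add_le_add (le_vd w _ k) (le_vd w _ j))))
  have h4 := dt_pos w hK
  unfold Dl
  linarith

end


/-! Part 3 -/
set_option linter.unusedSectionVars false

abbrev QR := MvPolynomial (Fin 2) ℂ

noncomputable def ev (f g : PR) : QR →ₐ[ℂ] PR := aeval ![f, g]

noncomputable def DD : Derivation ℂ QR QR := (X 1 : QR) • pderiv 1

lemma coeff_DD (α : Fin 2 →₀ ℕ) (P : QR) :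
    coeff α (DD P) = (α 1 : ℂ) * coeff α P := by
  induction P using MvPolynomial.induction_on' with
  | monomial β c =>
    simp only [DD, Derivation.smul_apply, smul_eq_mul, pderiv_monomial, coeff_monomial]
    by_cases h : β 1 = 0
    · simp only [h, Nat.cast_zero, mul_zero, monomial_zero, coeff_zero]
      split_ifs with h2
      · subst h2; simp [h]
      · simp
    · rw [X, monomial_mul, coeff_monomial]
      have : Finsupp.single 1 1 + (β - Finsupp.single 1 1) = β := by
        ext j
        by_cases hj : 1 = j
        · subst hj; simp; omega
        · simp [hj]
      rw [this]
      split_ifs with h2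
      · subst h2; ring
      · simp
  | add p q hp hq => simp [hp, hq, mul_add]

/-- `(D - j) P` -/
noncomputable def DJ (j : ℕ) (P : QR) : QR := DD P - (j : ℂ) • P

lemma coeff_DJ (j : ℕ) (α : Fin 2 →₀ ℕ) (P : QR) :
    coeff α (DJ j P) = ((α 1 : ℂ) - j) * coeff α P := by
  rw [DJ, coeff_sub, coeff_DD, coeff_smul, smul_eq_mul]; ring

lemma ev_X0 (f g : PR) : ev f g (X 0) = f := by simp [ev]
lemma ev_X1 (f g : PR) : ev f g (X 1) = g := by simp [ev]
lemma DD_X0 : DD (X 0) = 0 := by simp [DD]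
lemma DD_X1 : DD (X 1) = X 1 := by simp [DD]

lemma ev_DD (f g : PR) (P : QR) : g • cr f (ev f g P) = ev f g (DD P) • cr f g := by
  induction P using MvPolynomial.induction_on with
  | C a =>
    have h1 : ev f g (C a) = C a := (ev f g).commutes a
    have h2 : DD (C a) = 0 := DD.map_algebraMap a
    rw [h1, h2, cr_C]; simp
  | add p q hp hq => rw [map_add, map_add, map_add, cr_add, smul_add, hp, hq, add_smul]
  | mul_X p n hp =>
    rw [map_mul, cr_mul, Derivation.leibniz, smul_add, smul_comm g _ (cr f (ev f g p)), hp]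
    fin_cases n
    · simp only [Fin.zero_eta, ev_X0, DD_X0, cr_self, smul_zero, mul_zero, zero_add, smul_eq_mul, map_mul, mul_smul]
    · simp only [Fin.mk_one, ev_X1, DD_X1, smul_eq_mul, map_mul, mul_smul, map_add, add_smul]
      rw [smul_comm g]

noncomputable def wt2 (a b : ℝ) (α : Fin 2 →₀ ℕ) : ℝ := α 0 * a + α 1 * b

lemma ev_eq_sum (f g : PR) (P : QR) :
    ev f g P = ∑ α ∈ P.support, (coeff α P) • (f ^ α 0 * g ^ α 1) := by
  rw [ev, aeval_eq_eval₂Hom, coe_eval₂Hom, eval₂_eq']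
  refine Finset.sum_congr rfl fun α _ => ?_
  rw [Fin.prod_univ_two]
  simp [smul_eq_C_mul]

/-- the algebra generated by two elements -/
noncomputable def A2 (f g : PR) : Subalgebra ℂ PR := Algebra.adjoin ℂ {f, g}

lemma mem_A2 {f g r : PR} : r ∈ A2 f g ↔ ∃ P, r = ev f g P := by
  have : A2 f g = (ev f g).range := by
    rw [A2, ev, ← Algebra.adjoin_range_eq_range_aeval]
    congr 1
    ext x; simp [eq_comm, or_comm]
  rw [this, AlgHom.mem_range]
  simp [eq_comm]

section
variable (w : Fin 3 → ℝ) [hw : GoodW w]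

lemma deg_mono {f g : PR} (hf : f ≠ 0) (hg : g ≠ 0) (i j : ℕ) :
    deg w (f ^ i * g ^ j) = i * deg w f + j * deg w g := by
  rw [deg_mul' w (pow_ne_zero _ hf) (pow_ne_zero _ hg), deg_pow' w hf, deg_pow' w hg]

lemma ev_deg_le {f g : PR} (hf : f ≠ 0) (hg : g ≠ 0) (P : QR) {v : ℝ} (hv : 0 ≤ v)
    (h : ∀ α, coeff α P ≠ 0 → wt2 (deg w f) (deg w g) α ≤ v) : deg w (ev f g P) ≤ v := by
  rw [ev_eq_sum]
  refine deg_sum_le w _ _ hv fun α hα => (deg_smul_le w _ _).trans ?_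
  rw [deg_mono w hf hg]
  exact h α (mem_support_iff.mp hα)

lemma deg_DD {f g : PR} (hc : cr f g ≠ 0) (hg : 0 < deg w g) (P : QR) :
    deg w (ev f g (DD P)) ≤ deg w g + Dl w f (ev f g P) - Dl w f g ∨ deg w (ev f g (DD P)) = 0 := by
  by_cases h0 : ev f g (DD P) = 0
  · right; rw [h0, deg_zero']
  · left
    have h1 := vd_smul w h0 hc
    rw [← ev_DD] at h1
    have h2 := vd_smul_le w g (cr f (ev f g P))
    rw [h1] at h2
    unfold Dl
    linarith

lemma deg_DJ {f g : PR} (hc : cr f g ≠ 0) (hg : 0 < deg w g) (P : QR) (j : ℕ) :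
    deg w (ev f g (DJ j P)) ≤ deg w (ev f g P) + (deg w f + deg w g - Dl w f g) := by
  have h1 := Dl_le w f g
  have h3 := deg_nonneg w (ev f g P)
  rw [DJ, map_sub, map_smul]
  refine (deg_sub_le w _ _).trans (max_le ?_ ?_)
  · rcases deg_DD w hc hg P with h | h
    · have h2 := Dl_le w f (ev f g P)
      linarith
    · linarith
  · refine (deg_smul_le w _ _).trans ?_
    linarith

noncomputable def JJ (a b : ℝ) (P : QR) (v : ℝ) : Finset (Fin 2 →₀ ℕ) := by
  classical exact P.support.filter fun α => wt2 a b α = v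

lemma mem_JJ {a b v : ℝ} {P : QR} {α} : α ∈ JJ a b P v ↔ coeff α P ≠ 0 ∧ wt2 a b α = v := by
  simp [JJ]

lemma wt2_inj {a b : ℝ} (ha : 0 < a) {α β : Fin 2 →₀ ℕ} (h : wt2 a b α = wt2 a b β)
    (h1 : α 1 = β 1) : α = β := by
  simp only [wt2] at h
  rw [h1] at h
  have : (α 0 : ℝ) * a = β 0 * a := by linarith
  have := mul_right_cancel₀ ha.ne' this
  have h0 : α 0 = β 0 := by exact_mod_cast this
  ext i; fin_cases i
  · exact h0
  · exact h1

lemma JJ_DJ {a b v : ℝ} (ha : 0 < a) {P : QR} {α} (hα : α ∈ JJ a b P v) :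
    JJ a b (DJ (α 1) P) v = (JJ a b P v).erase α := by
  ext β
  rw [Finset.mem_erase, mem_JJ, mem_JJ, coeff_DJ]
  rw [mem_JJ] at hα
  constructor
  · rintro ⟨h1, h2⟩
    refine ⟨?_, right_ne_zero_of_mul h1, h2⟩
    rintro rfl
    simp at h1
  · rintro ⟨h1, h2, h3⟩
    refine ⟨mul_ne_zero ?_ h2, h3⟩
    intro h4
    apply h1
    refine wt2_inj ha (h3.trans hα.2.symm) ?_
    have := sub_eq_zero.mp h4
    exact_mod_cast this

lemma claimA {f g : PR} (hc : cr f g ≠ 0) (hf : 0 < deg w f) (hg : 0 < deg w g) (v : ℝ) (n : ℕ) :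
    ∀ P : QR, (∀ α, coeff α P ≠ 0 → wt2 (deg w f) (deg w g) α ≤ v) →
      (JJ (deg w f) (deg w g) P v).card = n + 1 →
      v ≤ deg w (ev f g P) + n * (deg w f + deg w g - Dl w f g) := by
  induction n with
  | zero =>
    intro P hP hJ
    obtain ⟨α, hα⟩ := Finset.card_eq_one.mp hJ
    have hα1 : α ∈ JJ (deg w f) (deg w g) P v := by rw [hα]; simp
    rw [mem_JJ] at hα1
    rcases le_or_gt v 0 with hv | hv
    · simp; linarith [deg_nonneg w (ev f g P)]
    rw [ev_eq_sum, ← Finset.add_sum_erase _ _ (mem_support_iff.mpr hα1.1)]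
    have hf0 := ne_zero_of_deg w hf
    have hg0 := ne_zero_of_deg w hg
    have h1 : deg w (coeff α P • (f ^ α 0 * g ^ α 1)) = v := by
      rw [deg_smul' w hα1.1, deg_mono w hf0 hg0]; exact hα1.2
    rw [deg_add_eq w, h1]
    · simp
    · rw [h1]
      refine deg_sum_lt w _ _ hv fun β hβ => (deg_smul_le w _ _).trans_lt ?_
      rw [Finset.mem_erase, mem_support_iff] at hβ
      rw [deg_mono w hf0 hg0]
      refine lt_of_le_of_ne (hP β hβ.2) fun h => hβ.1 ?_
      have : β ∈ JJ (deg w f) (deg w g) P v := mem_JJ.mpr ⟨hβ.2, h⟩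
      rw [hα] at this; simpa using this
  | succ n ih =>
    intro P hP hJ
    obtain ⟨α, hα⟩ : (JJ (deg w f) (deg w g) P v).Nonempty := by
      rw [← Finset.card_pos]; omega
    have h1 := ih (DJ (α 1) P) (fun β hβ => hP β (by
      rw [coeff_DJ] at hβ; exact right_ne_zero_of_mul hβ)) (by
      rw [JJ_DJ hf hα, Finset.card_erase_of_mem hα, hJ]; rfl)
    have h2 := deg_DJ w hc hg P (α 1)
    push_cast
    linarith

def Noncan (f g r : PR) : Prop :=
  r ∈ Submodule.span ℂ {m : PR | ∃ i j : ℕ, m = f ^ i * g ^ j ∧ i * deg w f + j * deg w g ≤ deg w r}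
    ∧ (0 < deg w r → ∃ i j : ℕ, deg w r = i * deg w f + j * deg w g)

/-- existence of coprime `p, q` -/
lemma exists_pq {a b : ℝ} (ha : 0 < a) (hb : 0 < b) {m n : ℕ} (hm : 0 < m) (hn : 0 < n)
    (h : m * a = n * b) : ∃ (p q : ℕ) (ε : ℝ), 0 < p ∧ 0 < q ∧ Nat.Coprime p q ∧ 0 < ε ∧
      a = p * ε ∧ b = q * ε := by
  -- a / b = n / m
  obtain ⟨d, p, q, hd, hpq, e1, e2⟩ : ∃ d p q : ℕ, 0 < d ∧ Nat.Coprime p q ∧ n = p * d ∧ m = q * d := by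
    obtain ⟨g, p, q, h1, h2, h3, h4⟩ := Nat.exists_coprime' (m := n) (n := m) (Nat.gcd_pos_of_pos_left _ hn)
    exact ⟨g, p, q, h1, h2, h3, h4⟩
  subst e1 e2
  have hp : 0 < p := Nat.pos_of_mul_pos_right hn
  have hq : 0 < q := Nat.pos_of_mul_pos_right hm
  have hq' : (0:ℝ) < q := by exact_mod_cast hq
  have hp' : (0:ℝ) < p := by exact_mod_cast hp
  have hd' : (0:ℝ) < d := by exact_mod_cast hd
  refine ⟨p, q, b / q, hp, hq, hpq, by positivity, ?_, by field_simp⟩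
  push_cast at h
  have : (q * a : ℝ) = p * b := by
    have : (d:ℝ) * (q * a) = d * (p * b) := by linarith
    exact mul_left_cancel₀ hd'.ne' this
  field_simp; linarith

/-- The parachute lemma. -/
lemma lemmaP {f g r : PR} (hc : cr f g ≠ 0) (hf : 0 < deg w f) (hg : 0 < deg w g)
    (hr : r ∈ A2 f g) :
    Noncan w f g r ∨ ∃ (p q : ℕ) (ε : ℝ), 0 < p ∧ 0 < q ∧ Nat.Coprime p q ∧ 0 < ε ∧
      deg w f = p * ε ∧ deg w g = q * ε ∧
      (0 ≤ (p * q - p - q) * ε + Dl w f g → (p * q - p - q) * ε + Dl w f g ≤ deg w r ∧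
        (deg w r < p * q * ε → (p - 1) * q * ε + Dl w f g ≤ Dl w f r)) := by
  obtain ⟨P, rfl⟩ := mem_A2.mp hr
  set a := deg w f with ha
  set b := deg w g with hb
  by_cases hP0 : P = 0
  · subst hP0
    left
    refine ⟨by simp, by simp [deg_zero']⟩
  obtain ⟨α0, hα0, hmax⟩ := Finset.exists_max_image P.support (wt2 a b)
    (by rwa [Finset.nonempty_iff_ne_empty, ne_eq, MvPolynomial.support_eq_empty])
  rw [mem_support_iff] at hα0
  set v := wt2 a b α0 with hv
  have hv0 : 0 ≤ v := by rw [hv, wt2]; positivity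
  have hP : ∀ α, coeff α P ≠ 0 → wt2 a b α ≤ v := fun α h => hmax α (mem_support_iff.mpr h)
  have hαJ : α0 ∈ JJ a b P v := mem_JJ.mpr ⟨hα0, rfl⟩
  obtain ⟨n, hn⟩ : ∃ n, (JJ a b P v).card = n + 1 :=
    ⟨_, (Nat.succ_pred_eq_of_pos (Finset.card_pos.mpr ⟨α0, hαJ⟩)).symm⟩
  have hf0 := ne_zero_of_deg w hf
  have hg0 := ne_zero_of_deg w hg
  have hle := ev_deg_le w hf0 hg0 P hv0 hP
  have hA := claimA w hc hf hg v n P hP hn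
  rcases Nat.eq_zero_or_pos n with rfl | hn0
  · left
    have hve : v = deg w (ev f g P) := le_antisymm (by simpa using hA) hle
    refine ⟨?_, fun _ => ⟨α0 0, α0 1, by rw [← hve]; rfl⟩⟩
    nth_rewrite 2 [ev_eq_sum]
    refine Submodule.sum_mem _ fun α hα => Submodule.smul_mem _ _ (Submodule.subset_span ?_)
    exact ⟨_, _, rfl, by rw [← hve]; exact hP α (mem_support_iff.mp hα)⟩
  · right
    -- two distinct elements
    have hdist : ∀ α ∈ JJ a b P v, ∀ β ∈ JJ a b P v, α ≠ β → α 1 ≠ β 1 := by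
      intro α hα β hβ hne h1
      rw [mem_JJ] at hα hβ
      exact hne (wt2_inj hf (hα.2.trans hβ.2.symm) h1)
    obtain ⟨p, q, ε, hp, hq, hpq, hε, hap, hbq⟩ : ∃ (p q : ℕ) (ε : ℝ), 0 < p ∧ 0 < q ∧
        Nat.Coprime p q ∧ 0 < ε ∧ a = p * ε ∧ b = q * ε := by
      obtain ⟨α, hα, β, hβ, hne⟩ := Finset.one_lt_card.mp (by omega : 1 < (JJ a b P v).card)
      wlog hlt : α 1 < β 1 generalizing α β with H
      · have := hdist α hα β hβ hne
        exact this.lt_or_gt.elim (fun h => absurd h hlt) (fun h => H β hβ α hα hne.symm h)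
      rw [mem_JJ] at hα hβ
      have e := hα.2.trans hβ.2.symm
      simp only [wt2] at e
      have hlt' : (α 1 : ℝ) < β 1 := by exact_mod_cast hlt
      have h0 : β 0 < α 0 := by
        have : (β 0 : ℝ) < α 0 := by
          by_contra hcon
          push Not at hcon
          nlinarith
        exact_mod_cast this
      refine exists_pq hf hg (m := α 0 - β 0) (n := β 1 - α 1) (by omega) (by omega) ?_
      rw [Nat.cast_sub h0.le, Nat.cast_sub hlt.le]
      linarith
    refine ⟨p, q, ε, hp, hq, hpq, hε, hap, hbq, fun hnn => ?_⟩
    have hdvd : ∀ α ∈ JJ a b P v, ∀ β ∈ JJ a b P v, (p:ℤ) ∣ (α 1 : ℤ) - β 1 := by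
      intro α hα β hβ
      rw [mem_JJ] at hα hβ
      have e := hα.2.trans hβ.2.symm
      simp only [wt2] at e
      rw [hap, hbq] at e
      have e2 : ((β 0 : ℝ) - α 0) * p = (α 1 - β 1) * q := by
        have : (((β 0 : ℝ) - α 0) * p) * ε = ((α 1 - β 1) * q) * ε := by linarith
        exact mul_right_cancel₀ hε.ne' this
      have e3 : ((β 0 : ℤ) - α 0) * p = (α 1 - β 1) * q := by exact_mod_cast e2
      have : (p:ℤ) ∣ (α 1 - β 1) * q := ⟨β 0 - α 0, by rw [← e3]; ring⟩
      exact (Nat.isCoprime_iff_coprime.mpr hpq).dvd_of_dvd_mul_right this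
    have hbig : ∃ α ∈ JJ a b P v, n * p ≤ α 1 := by
      by_contra hcon
      push Not at hcon
      have hinj : Set.InjOn (fun α : Fin 2 →₀ ℕ => α 1 / p) (JJ a b P v) := by
        intro α hα β hβ h
        by_contra hne
        apply hdist α hα β hβ hne
        have h1 := hdvd α hα β hβ
        have h2 : α 1 % p = β 1 % p := by
          have : (β 1 : ℤ) ≡ α 1 [ZMOD p] := Int.modEq_iff_dvd.mpr h1
          exact ((Int.natCast_modEq_iff.mp this).symm)
        simp only at h
        rw [← Nat.div_add_mod (α 1) p, ← Nat.div_add_mod (β 1) p, h, h2]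
      have := Finset.card_le_card_of_injOn (t := Finset.range n) _ (by
        intro α hα
        simp only [Finset.coe_range, Set.mem_Iio]
        rw [Nat.div_lt_iff_lt_mul hp]
        exact hcon α hα) hinj
      rw [hn, Finset.card_range] at this
      omega
    have hvn : n * (p * q * ε) ≤ v := by
      obtain ⟨α, hα, h1⟩ := hbig
      rw [mem_JJ] at hα
      rw [← hα.2, wt2, hbq]
      have h2 : (n * p : ℝ) ≤ α 1 := by exact_mod_cast h1
      have h3 : (n * p : ℝ) * (q * ε) ≤ α 1 * (q * ε) := mul_le_mul_of_nonneg_right h2 (by positivity)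
      have h4 : 0 ≤ (α 0 : ℝ) * a := by positivity
      linarith
    have hn1 : (1:ℝ) ≤ n := by exact_mod_cast hn0
    constructor
    · have : v ≤ deg w (ev f g P) + n * (p * ε + q * ε - Dl w f g) := by rw [← hap, ← hbq]; exact hA
      nlinarith
    · intro hlt
      -- use DJ
      have h1 := claimA w hc hf hg v (n-1) (DJ (α0 1) P) (fun β hβ => hP β (by
        rw [coeff_DJ] at hβ; exact right_ne_zero_of_mul hβ)) (by
        rw [JJ_DJ hf hαJ, Finset.card_erase_of_mem hαJ, hn]; omega)
      rw [Nat.cast_sub hn0, ← ha, ← hb, hap, hbq] at h1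
      push_cast at h1
      have h2 : p * q * ε ≤ deg w (ev f g (DJ (α0 1) P)) := by nlinarith
      have hpq0 : (0:ℝ) < p * q * ε := by positivity
      have h3 : p * q * ε ≤ deg w (ev f g (DD P)) := by
        by_contra hcon
        push Not at hcon
        rw [DJ, map_sub, map_smul] at h2
        have h4 := deg_sub_le w (ev f g (DD P)) ((α0 1 : ℂ) • ev f g P)
        have h5 := deg_smul_le w (α0 1 : ℂ) (ev f g P)
        rcases le_max_iff.mp h4 with h6 | h6 <;> linarith
      rcases deg_DD w hc hg P with h | h
      · rw [← hb, hbq] at h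
        nlinarith
      · linarith
end


/-! Part 4 -/
set_option linter.unusedSectionVars false
set_option linter.unusedVariables false

noncomputable def Sp (a b c : PR) : Submodule ℂ PR := Submodule.span ℂ {1, a, b, c}

lemma mem_Sp {a b c x : PR} :
    x ∈ Sp a b c ↔ ∃ k0 k1 k2 k3 : ℂ, x = k0 • 1 + k1 • a + k2 • b + k3 • c := by
  rw [Sp, Submodule.mem_span_insert]
  constructor
  · rintro ⟨k0, z, hz, rfl⟩
    rw [Submodule.mem_span_insert] at hz
    obtain ⟨k1, z, hz, rfl⟩ := hz
    rw [Submodule.mem_span_pair] at hz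
    obtain ⟨k2, k3, rfl⟩ := hz
    exact ⟨k0, k1, k2, k3, by module⟩
  · rintro ⟨k0, k1, k2, k3, rfl⟩
    refine ⟨k0, k1 • a + (k2 • b + k3 • c), ?_, by module⟩
    rw [Submodule.mem_span_insert]
    refine ⟨k1, k2 • b + k3 • c, ?_, rfl⟩
    rw [Submodule.mem_span_pair]
    exact ⟨k2, k3, rfl⟩

lemma Sp_le {a b c a' b' c' : PR} (h1 : a ∈ Sp a' b' c') (h2 : b ∈ Sp a' b' c')
    (h3 : c ∈ Sp a' b' c') : Sp a b c ≤ Sp a' b' c' := by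
  rw [Sp, Submodule.span_le]
  rintro x (rfl | rfl | rfl | rfl)
  · exact Submodule.subset_span (by simp)
  all_goals assumption

lemma Sp1 (a b c : PR) : a ∈ Sp a b c := Submodule.subset_span (by simp)
lemma Sp2 (a b c : PR) : b ∈ Sp a b c := Submodule.subset_span (by simp)
lemma Sp3 (a b c : PR) : c ∈ Sp a b c := Submodule.subset_span (by simp)
lemma Sp0 (a b c : PR) : 1 ∈ Sp a b c := Submodule.subset_span (by simp)

lemma Sp_eq {a b c a' b' c' : PR} (h1 : a ∈ Sp a' b' c') (h2 : b ∈ Sp a' b' c')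
    (h3 : c ∈ Sp a' b' c') (h1' : a' ∈ Sp a b c) (h2' : b' ∈ Sp a b c)
    (h3' : c' ∈ Sp a b c) : Sp a b c = Sp a' b' c' :=
  le_antisymm (Sp_le h1 h2 h3) (Sp_le h1' h2' h3')

lemma Sp_213 (a b c : PR) : Sp a b c = Sp b a c :=
  Sp_eq (Sp2 _ _ _) (Sp1 _ _ _) (Sp3 _ _ _) (Sp2 _ _ _) (Sp1 _ _ _) (Sp3 _ _ _)
lemma Sp_132 (a b c : PR) : Sp a b c = Sp a c b :=
  Sp_eq (Sp1 _ _ _) (Sp3 _ _ _) (Sp2 _ _ _) (Sp1 _ _ _) (Sp3 _ _ _) (Sp2 _ _ _)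
lemma Sp_321 (a b c : PR) : Sp a b c = Sp c b a :=
  Sp_eq (Sp3 _ _ _) (Sp2 _ _ _) (Sp1 _ _ _) (Sp3 _ _ _) (Sp2 _ _ _) (Sp1 _ _ _)
lemma Sp_231 (a b c : PR) : Sp a b c = Sp b c a := by rw [Sp_213, Sp_132]
lemma Sp_312 (a b c : PR) : Sp a b c = Sp c a b := by rw [Sp_132, Sp_213]

/-- shear in the third slot -/
lemma Sp_lin (a b c : PR) {k : ℂ} (hk : k ≠ 0) (k0 k1 k2 : ℂ) :
    Sp a b (k • c + k0 • 1 + k1 • a + k2 • b) = Sp a b c := by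
  refine Sp_eq (Sp1 _ _ _) (Sp2 _ _ _) (mem_Sp.mpr ⟨k0, k1, k2, k, by module⟩)
    (Sp1 _ _ _) (Sp2 _ _ _) (mem_Sp.mpr ⟨-k⁻¹ * k0, -k⁻¹ * k1, -k⁻¹ * k2, k⁻¹, ?_⟩)
  match_scalars <;> field_simp <;> ring

lemma E_one (i : Fin 3) : E i 1 = 0 := (E i).map_one_eq_zero

lemma K3.of_mem {a b c a' b' c' : PR} (hK : K3 a b c) (h1 : a ∈ Sp a' b' c') (h2 : b ∈ Sp a' b' c')
    (h3 : c ∈ Sp a' b' c') : K3 a' b' c' := by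
  obtain ⟨k0, k1, k2, k3, rfl⟩ := mem_Sp.mp h1
  obtain ⟨l0, l1, l2, l3, rfl⟩ := mem_Sp.mp h2
  obtain ⟨m0, m1, m2, m3, rfl⟩ := mem_Sp.mp h3
  intro h0
  apply hK
  have : dt (k0 • 1 + k1 • a' + k2 • b' + k3 • c') (l0 • 1 + l1 • a' + l2 • b' + l3 • c')
      (m0 • 1 + m1 • a' + m2 • b' + m3 • c') =
      C (k1 * (l2 * m3 - l3 * m2) - k2 * (l1 * m3 - l3 * m1) + k3 * (l1 * m2 - l2 * m1)) * dt a' b' c' := by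
    simp only [dt, map_add, Derivation.map_smul, E_one, smul_zero, zero_add]
    simp only [smul_eq_C_mul, C_mul, C_sub, C_add]
    ring
  rw [this, h0, mul_zero]

lemma K3.congr {a b c a' b' c' : PR} (hK : K3 a b c) (h : Sp a b c = Sp a' b' c') : K3 a' b' c' :=
  hK.of_mem (h ▸ Sp1 a b c) (h ▸ Sp2 a b c) (h ▸ Sp3 a b c)

/-! membership in the two-generated algebras -/
lemma A2l (f g : PR) : f ∈ A2 f g := Algebra.subset_adjoin (by simp)
lemma A2r (f g : PR) : g ∈ A2 f g := Algebra.subset_adjoin (by simp)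
lemma A2_comm (f g : PR) : A2 f g = A2 g f := by rw [A2, A2, Set.pair_comm]
lemma A2_le {f g f' g' : PR} (h1 : f ∈ A2 f' g') (h2 : g ∈ A2 f' g') : A2 f g ≤ A2 f' g' := by
  rw [A2, Algebra.adjoin_le_iff]
  rintro x (rfl | rfl) <;> assumption
lemma A2_lin (f g : PR) (k0 k1 k2 : ℂ) : k0 • 1 + k1 • f + k2 • g ∈ A2 f g :=
  add_mem (add_mem (Subalgebra.smul_mem _ (one_mem _) _) (Subalgebra.smul_mem _ (A2l _ _) _))
    (Subalgebra.smul_mem _ (A2r _ _) _)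

lemma dt_ev (f g : PR) (P : QR) : dt f g (ev f g P) = 0 := by
  induction P using MvPolynomial.induction_on with
  | C a =>
    have h1 : ev f g (C a) = C a := (ev f g).commutes a
    rw [h1]; simp [dt, E_C]
  | add p q hp hq =>
    rw [map_add, dt_eq]
    rw [dt_eq] at hp hq
    simp only [map_add]
    linear_combination hp + hq
  | mul_X p n hp =>
    rw [map_mul, dt_eq]
    rw [dt_eq] at hp
    have hn : E 0 (ev f g (X n)) * cr f g 0 + E 1 (ev f g (X n)) * cr f g 1
        + E 2 (ev f g (X n)) * cr f g 2 = 0 := by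
      fin_cases n
      · simp [ev_X0, cr]; ring
      · simp [ev_X1, cr]; ring
    simp only [Derivation.leibniz, smul_eq_mul]
    linear_combination (ev f g (X n)) * hp + (ev f g p) * hn

lemma K3.add {a b c r : PR} (hK : K3 a b c) (hr : r ∈ A2 a b) : K3 a b (c + r) := by
  obtain ⟨P, rfl⟩ := mem_A2.mp hr
  have : dt a b (c + ev a b P) = dt a b c + dt a b (ev a b P) := by
    simp only [dt, map_add]; ring
  rw [K3, this, dt_ev, add_zero]; exact hK

lemma K3.to {a b c c' : PR} (hK : K3 a b c) (hr : c' - c ∈ A2 a b) : K3 a b c' := by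
  have := hK.add hr
  rwa [add_sub_cancel] at this

section
variable (w : Fin 3 → ℝ) [hw : GoodW w]

/-- sorted good basis -/
def GB (a b c : PR) : Prop := K3 a b c ∧ deg w a < deg w b ∧ deg w b < deg w c

variable {w}

lemma deg_one : deg w (1 : PR) = 0 := by simpa using deg_C' w 1

lemma deg_const (k : ℂ) : deg w (k • (1 : PR)) = 0 := by
  rw [smul_eq_C_mul, mul_one, deg_C']

lemma deg_lin_le (x : PR) (k0 k1 : ℂ) : deg w (k0 • 1 + k1 • x) ≤ deg w x :=
  (deg_add_le w _ _).trans (max_le (by rw [deg_const]; exact deg_nonneg w _) (deg_smul_le w _ _))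

lemma deg_add_lt {p q : PR} {d : ℝ} (h1 : deg w p < d) (h2 : deg w q < d) : deg w (p + q) < d :=
  (deg_add_le w _ _).trans_lt (max_lt h1 h2)

lemma deg_add_le' {p q : PR} {d : ℝ} (h1 : deg w p ≤ d) (h2 : deg w q ≤ d) : deg w (p + q) ≤ d :=
  (deg_add_le w _ _).trans (max_le h1 h2)

/-- degree of `y + (smaller)` -/
lemma deg_lead {x y : PR} {k : ℂ} (hk : k ≠ 0) (h : deg w x < deg w y) :
    deg w (x + k • y) = deg w y := by
  rw [add_comm, deg_add_eq w, deg_smul' w hk]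
  rwa [deg_smul' w hk]

lemma GB.co {x1 x2 x3 : PR} (h : GB w x1 x2 x3) {v : PR} (hv : v ∈ Sp x1 x2 x3) :
    (∃ k0 k1 k2 k3 : ℂ, k3 ≠ 0 ∧ v = k0 • 1 + k1 • x1 + k2 • x2 + k3 • x3 ∧ deg w v = deg w x3) ∨
    (∃ k0 k1 k2 : ℂ, k2 ≠ 0 ∧ v = k0 • 1 + k1 • x1 + k2 • x2 ∧ deg w v = deg w x2) ∨
    (∃ k0 k1 : ℂ, k1 ≠ 0 ∧ v = k0 • 1 + k1 • x1 ∧ deg w v = deg w x1) ∨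
    (∃ k0 : ℂ, v = k0 • 1 ∧ deg w v = 0) := by
  obtain ⟨hK, h12, h23⟩ := h
  have h1 := hK.pos w
  obtain ⟨k0, k1, k2, k3, rfl⟩ := mem_Sp.mp hv
  have e1 : deg w (k0 • 1 + k1 • x1) < deg w x2 := (deg_lin_le _ _ _).trans_lt h12
  have e2 : deg w (k0 • 1 + k1 • x1 + k2 • x2) < deg w x3 :=
    deg_add_lt (e1.trans h23) ((deg_smul_le w _ _).trans_lt h23)
  by_cases hk3 : k3 = 0
  · right
    by_cases hk2 : k2 = 0
    · right
      by_cases hk1 : k1 = 0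
      · right; exact ⟨k0, by simp [*], by simp [*, deg_const]⟩
      · left; refine ⟨k0, k1, hk1, by simp [*], ?_⟩
        rw [hk3, hk2, zero_smul, add_zero, zero_smul, add_zero, deg_lead hk1]
        rw [deg_const]; linarith
    · left; refine ⟨k0, k1, k2, hk2, by simp [*], ?_⟩
      rw [hk3, zero_smul, add_zero, deg_lead hk2 e1]
  · left; exact ⟨k0, k1, k2, k3, hk3, rfl, deg_lead hk3 e2⟩

lemma GB.co1 {x1 x2 x3 : PR} (h : GB w x1 x2 x3) {v : PR} (hv : v ∈ Sp x1 x2 x3)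
    (hd : deg w v = deg w x1) : ∃ k0 k1 : ℂ, k1 ≠ 0 ∧ v = k0 • 1 + k1 • x1 := by
  have hp := h.1.pos w
  have h12 := h.2.1
  have h23 := h.2.2
  rcases h.co hv with ⟨k0, k1, k2, k3, hk, e, d⟩ | ⟨k0, k1, k2, hk, e, d⟩ | ⟨k0, k1, hk, e, d⟩ | ⟨k0, e, d⟩
  · linarith
  · linarith
  · exact ⟨k0, k1, hk, e⟩
  · linarith

lemma GB.co2 {x1 x2 x3 : PR} (h : GB w x1 x2 x3) {v : PR} (hv : v ∈ Sp x1 x2 x3)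
    (hd : deg w v = deg w x2) : ∃ k0 k1 k2 : ℂ, k2 ≠ 0 ∧ v = k0 • 1 + k1 • x1 + k2 • x2 := by
  have hp := h.1.pos w
  have h12 := h.2.1
  have h23 := h.2.2
  rcases h.co hv with ⟨k0, k1, k2, k3, hk, e, d⟩ | ⟨k0, k1, k2, hk, e, d⟩ | ⟨k0, k1, hk, e, d⟩ | ⟨k0, e, d⟩
  · linarith
  · exact ⟨k0, k1, k2, hk, e⟩
  · linarith
  · linarith

lemma GB.co3 {x1 x2 x3 : PR} (h : GB w x1 x2 x3) {v : PR} (hv : v ∈ Sp x1 x2 x3)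
    (hd : deg w v = deg w x3) : ∃ k0 k1 k2 k3 : ℂ, k3 ≠ 0 ∧
      v = k0 • 1 + k1 • x1 + k2 • x2 + k3 • x3 := by
  have hp := h.1.pos w
  have h12 := h.2.1
  have h23 := h.2.2
  rcases h.co hv with ⟨k0, k1, k2, k3, hk, e, d⟩ | ⟨k0, k1, k2, hk, e, d⟩ | ⟨k0, k1, hk, e, d⟩ | ⟨k0, e, d⟩
  · exact ⟨k0, k1, k2, k3, hk, e⟩
  · linarith
  · linarith
  · linarith

lemma cr_lin (y : PR) (k0 k1 l0 l1 : ℂ) : cr (k0 • 1 + k1 • y) (l0 • 1 + l1 • y) = 0 := by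
  apply cr_ext <;> simp only [cr0, cr1, cr2, map_add, Derivation.map_smul, E_one, smul_zero, zero_add,
    Pi.zero_apply] <;> simp only [smul_eq_C_mul] <;> ring

lemma GB.deg_le {x1 x2 x3 y1 y2 y3 : PR} (hx : GB w x1 x2 x3) (hy : GB w y1 y2 y3)
    (h : Sp x1 x2 x3 = Sp y1 y2 y3) :
    deg w y1 ≤ deg w x1 ∧ deg w y2 ≤ deg w x2 ∧ deg w y3 ≤ deg w x3 := by
  have hp := hx.1.pos w
  have hp' := hy.1.pos w
  have h12 := hx.2.1
  have h23 := hx.2.2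
  have g12 := hy.2.1
  have g23 := hy.2.2
  have m1 : x1 ∈ Sp y1 y2 y3 := h ▸ Sp1 _ _ _
  have m2 : x2 ∈ Sp y1 y2 y3 := h ▸ Sp2 _ _ _
  have m3 : y3 ∈ Sp x1 x2 x3 := h ▸ Sp3 _ _ _
  refine ⟨?_, ?_, ?_⟩
  · rcases hy.co m1 with ⟨k0, k1, k2, k3, hk, e, d⟩ | ⟨k0, k1, k2, hk, e, d⟩ | ⟨k0, k1, hk, e, d⟩ | ⟨k0, e, d⟩ <;> linarith
  · by_contra hcon
    push Not at hcon
    have l1 : ∃ k0 k1 : ℂ, x1 = k0 • 1 + k1 • y1 := by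
      rcases hy.co m1 with ⟨k0, k1, k2, k3, hk, e, d⟩ | ⟨k0, k1, k2, hk, e, d⟩ | ⟨k0, k1, hk, e, d⟩ | ⟨k0, e, d⟩
      · linarith
      · linarith
      · exact ⟨_, _, e⟩
      · linarith
    have l2 : ∃ k0 k1 : ℂ, x2 = k0 • 1 + k1 • y1 := by
      rcases hy.co m2 with ⟨k0, k1, k2, k3, hk, e, d⟩ | ⟨k0, k1, k2, hk, e, d⟩ | ⟨k0, k1, hk, e, d⟩ | ⟨k0, e, d⟩
      · linarith
      · linarith
      · exact ⟨_, _, e⟩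
      · linarith
    obtain ⟨k0, k1, e1⟩ := l1
    obtain ⟨l0, l1, e2⟩ := l2
    apply hx.1.cr12
    rw [e1, e2, cr_lin]
  · rcases hx.co m3 with ⟨k0, k1, k2, k3, hk, e, d⟩ | ⟨k0, k1, k2, hk, e, d⟩ | ⟨k0, k1, hk, e, d⟩ | ⟨k0, e, d⟩ <;> linarith

lemma GB.deg_eq {x1 x2 x3 y1 y2 y3 : PR} (hx : GB w x1 x2 x3) (hy : GB w y1 y2 y3)
    (h : Sp x1 x2 x3 = Sp y1 y2 y3) :
    deg w y1 = deg w x1 ∧ deg w y2 = deg w x2 ∧ deg w y3 = deg w x3 := by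
  have a := hx.deg_le hy h
  have b := hy.deg_le hx h.symm
  exact ⟨le_antisymm a.1 b.1, le_antisymm a.2.1 b.2.1, le_antisymm a.2.2 b.2.2⟩

variable (w)
noncomputable def sm (a b c : PR) : ℝ := deg w a + deg w b + deg w c
variable {w}

lemma sm_mem (a b c : PR) : sm w a b c ∈ wtS w :=
  wtS_add w (wtS_add w (deg_mem w a) (deg_mem w b)) (deg_mem w c)

lemma sort3 {a b c : PR} (hK : K3 a b c) (hab : deg w a ≠ deg w b) (hac : deg w a ≠ deg w c)
    (hbc : deg w b ≠ deg w c) : ∃ x1 x2 x3, GB w x1 x2 x3 ∧ Sp x1 x2 x3 = Sp a b c ∧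
      sm w x1 x2 x3 = sm w a b c := by
  wlog h1 : deg w a < deg w b generalizing a b
  · have := this hK.swap hab.symm hbc hac (lt_of_le_of_ne (not_lt.mp h1) hab.symm)
    obtain ⟨x1, x2, x3, h, e, s⟩ := this
    exact ⟨x1, x2, x3, h, by rw [e, Sp_213], by rw [s]; simp only [sm]; ring⟩
  rcases hbc.lt_or_gt with h2 | h2
  · exact ⟨a, b, c, ⟨hK, h1, h2⟩, rfl, rfl⟩
  rcases hac.lt_or_gt with h3 | h3
  · exact ⟨a, c, b, ⟨hK.swap23, h3, h2⟩, Sp_132 _ _ _, by simp only [sm]; ring⟩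
  · exact ⟨c, a, b, ⟨hK.rot.rot, h3, h1⟩, Sp_231 _ _ _, by simp only [sm]; ring⟩

lemma drop_eq {a b c : PR} (hK : K3 a b c) (h : deg w a = deg w b) :
    ∃ a', Sp a' b c = Sp a b c ∧ K3 a' b c ∧ deg w a' < deg w a := by
  obtain ⟨k, hk, hlt⟩ := exists_lead w h (by linarith [hK.pos w])
  have e : Sp (a + k • b) b c = Sp a b c := by
    refine Sp_eq (mem_Sp.mpr ⟨0, 1, k, 0, by module⟩) (Sp2 _ _ _) (Sp3 _ _ _)
      (mem_Sp.mpr ⟨0, 1, -k, 0, by module⟩) (Sp2 _ _ _) (Sp3 _ _ _)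
  exact ⟨a + k • b, e, hK.congr e.symm, hlt⟩

/-- every basis can be improved -/
lemma G1 {a b c : PR} (hK : K3 a b c) : ∃ x1 x2 x3, GB w x1 x2 x3 ∧ Sp x1 x2 x3 = Sp a b c ∧
      sm w x1 x2 x3 ≤ sm w a b c := by
  let S : Set ℝ := {x | ∃ a' b' c', K3 a' b' c' ∧ Sp a' b' c' = Sp a b c ∧ sm w a' b' c' = x}
  have hS : S ⊆ wtS w := by rintro x ⟨a', b', c', _, _, rfl⟩; exact sm_mem _ _ _
  have hwf : S.IsWF := (wtS_wf w).mono hS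
  have hne : S.Nonempty := ⟨_, a, b, c, hK, rfl, rfl⟩
  obtain ⟨a', b', c', hK', e, hs⟩ := hwf.min_mem hne
  have hmin : ∀ a'' b'' c'', K3 a'' b'' c'' → Sp a'' b'' c'' = Sp a b c →
      sm w a' b' c' ≤ sm w a'' b'' c'' := by
    intro a'' b'' c'' h1 h2
    rw [hs]; exact hwf.min_le hne ⟨a'', b'', c'', h1, h2, rfl⟩
  have hab : ∀ {a' b' c' : PR}, K3 a' b' c' → Sp a' b' c' = Sp a b c →
      (∀ a'' b'' c'', K3 a'' b'' c'' → Sp a'' b'' c'' = Sp a b c →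
      sm w a' b' c' ≤ sm w a'' b'' c'') → deg w a' ≠ deg w b' := by
    intro a' b' c' hK' e hmin h
    obtain ⟨a'', e', hK'', hlt⟩ := drop_eq hK' h
    have := hmin a'' b' c' hK'' (e'.trans e)
    simp only [sm] at this; linarith
  have h1 := hab hK' e hmin
  have h2 := hab hK'.swap23 (by rw [← e, Sp_132]) (fun x y z h1 h2 => by
    have := hmin x y z h1 h2; simp only [sm] at this ⊢; linarith)
  have h3 := hab hK'.rot (by rw [← e, ← Sp_231]) (fun x y z h1 h2 => by
    have := hmin x y z h1 h2; simp only [sm] at this ⊢; linarith)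
  obtain ⟨x1, x2, x3, hx, ex, sx⟩ := sort3 hK' h1 h2 h3
  exact ⟨x1, x2, x3, hx, ex.trans e, by rw [sx]; exact hmin a b c hK rfl⟩

variable (w)
def Le (V : Submodule ℂ PR) (ν : ℝ) : Prop := ∃ a b c, K3 a b c ∧ V = Sp a b c ∧ sm w a b c ≤ ν
def Lt (V : Submodule ℂ PR) (ν : ℝ) : Prop := ∃ a b c, K3 a b c ∧ V = Sp a b c ∧ sm w a b c < ν
variable {w}

lemma GB.sm_le {x1 x2 x3 a b c : PR} (hx : GB w x1 x2 x3) (hK : K3 a b c)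
    (e : Sp x1 x2 x3 = Sp a b c) : sm w x1 x2 x3 ≤ sm w a b c := by
  obtain ⟨y1, y2, y3, hy, ey, sy⟩ := G1 (w := w) hK
  have := hy.deg_eq hx (ey.trans e.symm)
  simp only [sm] at *
  linarith

/-- minimality for unsorted good bases -/
lemma sm_min {a b c a' b' c' : PR} (hK : K3 a b c) (hab : deg w a ≠ deg w b) (hac : deg w a ≠ deg w c)
    (hbc : deg w b ≠ deg w c) (hK' : K3 a' b' c') (e : Sp a b c = Sp a' b' c') :
    sm w a b c ≤ sm w a' b' c' := by
  obtain ⟨x1, x2, x3, hx, ex, sx⟩ := sort3 hK hab hac hbc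
  rw [← sx]; exact hx.sm_le hK' (ex.trans e)

def Adj (V V' : Submodule ℂ PR) : Prop :=
  ∃ a b c c', K3 a b c ∧ V = Sp a b c ∧ V' = Sp a b c' ∧ c' - c ∈ A2 a b

lemma Adj.symm {V V' : Submodule ℂ PR} (h : Adj V V') : Adj V' V := by
  obtain ⟨a, b, c, c', hK, e1, e2, hr⟩ := h
  exact ⟨a, b, c', c, hK.to hr, e2, e1, by rw [← neg_sub]; exact neg_mem hr⟩

lemma red_c {a b c : PR} (hK : K3 a b c) : ∃ c', K3 a b c' ∧ Sp a b c' = Sp a b c ∧ c' - c ∈ A2 a b ∧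
    deg w a ≠ deg w c' ∧ deg w b ≠ deg w c' := by
  let S : Set PR := {x | ∃ k1 k2 : ℂ, x = c + k1 • a + k2 • b}
  have hne : S.Nonempty := ⟨c, 0, 0, by simp⟩
  obtain ⟨k1, k2, hc'⟩ := (deg_wf w).min_mem S hne
  set c' := (deg_wf w).min S hne
  have hmin : ∀ l1 l2 : ℂ, ¬ deg w (c' + l1 • a + l2 • b) < deg w c' := fun l1 l2 =>
    (deg_wf w).not_lt_min S (x := c' + l1 • a + l2 • b) ⟨k1 + l1, k2 + l2, by rw [hc']; module⟩
  have hm : c' - c ∈ A2 a b := by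
    rw [show c' - c = (0:ℂ) • 1 + k1 • a + k2 • b by rw [hc']; module]; exact A2_lin _ _ _ _ _
  have hK' := hK.to hm
  refine ⟨c', hK', ?_, hm, ?_, ?_⟩
  · have := Sp_lin a b c (k := 1) one_ne_zero 0 k1 k2
    rw [← this, hc']; congr 1; module
  · intro h
    obtain ⟨k, hk, hlt⟩ := exists_lead w h.symm (by linarith [hK'.rot.rot.pos w])
    exact hmin k 0 (by simpa using hlt)
  · intro h
    obtain ⟨k, hk, hlt⟩ := exists_lead w h.symm (by linarith [hK'.rot.rot.pos w])
    exact hmin 0 k (by simpa using hlt)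

variable (w) in
/-- normal form of an adjacency -/
lemma Adj.nf {V V' : Submodule ℂ PR} (h : Adj V V') :
    ∃ a b c c', K3 a b c ∧ V = Sp a b c ∧ V' = Sp a b c' ∧ c' - c ∈ A2 a b ∧
      deg w a < deg w b ∧ deg w a ≠ deg w c ∧ deg w b ≠ deg w c ∧
      deg w a ≠ deg w c' ∧ deg w b ≠ deg w c' := by
  obtain ⟨a, b, c, c', hK, e1, e2, hr⟩ := h
  obtain ⟨a1, b1, hab, p1, p2, p3, p4⟩ : ∃ a1 b1, deg w a1 < deg w b1 ∧ (∀ c, Sp a1 b1 c = Sp a b c) ∧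
      A2 a1 b1 = A2 a b ∧ K3 a1 b1 c ∧ True := by
    rcases lt_trichotomy (deg w a) (deg w b) with h | h | h
    · exact ⟨a, b, h, fun _ => rfl, rfl, hK, trivial⟩
    · obtain ⟨k, hk, hlt⟩ := exists_lead w h (by linarith [hK.pos w])
      have e : ∀ c, Sp (a + k • b) b c = Sp a b c := fun c =>
        Sp_eq (mem_Sp.mpr ⟨0, 1, k, 0, by module⟩) (Sp2 _ _ _) (Sp3 _ _ _)
          (mem_Sp.mpr ⟨0, 1, -k, 0, by module⟩) (Sp2 _ _ _) (Sp3 _ _ _)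
      refine ⟨a + k • b, b, by rw [← h]; exact hlt, e, ?_, hK.congr (e c).symm, trivial⟩
      apply le_antisymm
      · exact A2_le (add_mem (A2l _ _) (Subalgebra.smul_mem _ (A2r _ _) _)) (A2r _ _)
      · refine A2_le ?_ (A2r _ _)
        have := A2_lin (a + k • b) b 0 1 (-k)
        rwa [show (0:ℂ) • 1 + (1:ℂ) • (a + k • b) + (-k) • b = a by module] at this
    · exact ⟨b, a, h, fun c => Sp_213 _ _ _, A2_comm _ _, hK.swap, trivial⟩
  rw [← p2] at hr
  obtain ⟨c1, q1, q2, q3, q4, q5⟩ := red_c (w := w) p3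
  obtain ⟨c2, r1, r2, r3, r4, r5⟩ := red_c (w := w) (p3.to hr)
  refine ⟨a1, b1, c1, c2, q1, by rw [q2, e1, p1], by rw [r2, e2, p1], ?_, hab, q4, q5, r4, r5⟩
  rw [show c2 - c1 = (c2 - c') + (c' - c) - (c1 - c) by ring]
  exact sub_mem (add_mem r3 hr) q3

/-- position of a one-step move relative to a fixed sorted basis -/
lemma GB.pos {x1 x2 x3 a b c c' : PR} (hx : GB w x1 x2 x3) (hK : K3 a b c) (hab : deg w a < deg w b)
    (hac : deg w a ≠ deg w c) (hbc : deg w b ≠ deg w c) (e : Sp a b c = Sp x1 x2 x3)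
    (hr : c' - c ∈ A2 a b) :
    (∃ r ∈ A2 x1 x2, Sp a b c' = Sp x1 x2 (x3 + r) ∧ deg w (x3 + r) = deg w c' ∧ deg w c = deg w x3) ∨
    (∃ β : ℂ, ∃ r ∈ A2 x1 (x3 + β • x2), Sp a b c' = Sp x1 (x3 + β • x2) (x2 + r) ∧
      deg w (x2 + r) = deg w c' ∧ deg w c = deg w x2) ∨
    (∃ α β : ℂ, ∃ r ∈ A2 (x2 + α • x1) (x3 + β • x1),
      Sp a b c' = Sp (x2 + α • x1) (x3 + β • x1) (x1 + r) ∧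
      deg w (x1 + r) = deg w c' ∧ deg w c = deg w x1) := by
  have ma : a ∈ Sp x1 x2 x3 := e ▸ Sp1 a b c
  have mb : b ∈ Sp x1 x2 x3 := e ▸ Sp2 a b c
  have mc : c ∈ Sp x1 x2 x3 := e ▸ Sp3 a b c
  rcases hbc.lt_or_gt with h2 | h2
  · left
    obtain ⟨d1, d2, d3⟩ := hx.deg_eq (y1 := a) (y2 := b) (y3 := c) ⟨hK, hab, h2⟩ e.symm
    obtain ⟨k0, k1, hk1, rfl⟩ := hx.co1 ma d1
    obtain ⟨l0, l1, l2, hl2, rfl⟩ := hx.co2 mb d2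
    obtain ⟨m0, m1, m2, m3, hm3, rfl⟩ := hx.co3 mc d3
    obtain ⟨s, rfl⟩ : ∃ s, c' = (m0 • 1 + m1 • x1 + m2 • x2 + m3 • x3) + s := ⟨_, (add_sub_cancel _ _).symm⟩
    rw [add_sub_cancel_left] at hr
    have hA : s ∈ A2 x1 x2 := by
      refine A2_le ?_ ?_ hr
      · have := A2_lin x1 x2 k0 k1 0; simpa using this
      · exact A2_lin _ _ _ _ _
    refine ⟨(m3⁻¹ * m0) • 1 + (m3⁻¹ * m1) • x1 + (m3⁻¹ * m2) • x2 + m3⁻¹ • s,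
      add_mem (A2_lin _ _ _ _ _) (Subalgebra.smul_mem _ hA _), ?_, ?_, d3⟩
    · refine Sp_eq (mem_Sp.mpr ⟨k0, k1, 0, 0, by module⟩) (mem_Sp.mpr ⟨l0, l1, l2, 0, by module⟩)
        (mem_Sp.mpr ⟨0, 0, 0, m3, ?_⟩) (mem_Sp.mpr ⟨-k1⁻¹ * k0, k1⁻¹, 0, 0, ?_⟩)
        (mem_Sp.mpr ⟨-l2⁻¹ * l0 + l2⁻¹ * l1 * k1⁻¹ * k0, - l2⁻¹ * l1 * k1⁻¹, l2⁻¹, 0, ?_⟩)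
        (mem_Sp.mpr ⟨0, 0, 0, m3⁻¹, ?_⟩) <;> match_scalars <;> field_simp <;> ring
    · rw [← deg_smul' w (inv_ne_zero hm3) (m0 • 1 + m1 • x1 + m2 • x2 + m3 • x3 + s)]
      congr 1; match_scalars <;> field_simp
  rcases hac.lt_or_gt with h3 | h3
  · right; left
    obtain ⟨d1, d2, d3⟩ := hx.deg_eq (y1 := a) (y2 := c) (y3 := b) ⟨hK.swap23, h3, h2⟩
      (by rw [← e, Sp_132])
    obtain ⟨k0, k1, hk1, rfl⟩ := hx.co1 ma d1
    obtain ⟨l0, l1, l2, l3, hl3, rfl⟩ := hx.co3 mb d3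
    obtain ⟨m0, m1, m2, hm2, rfl⟩ := hx.co2 mc d2
    obtain ⟨s, rfl⟩ : ∃ s, c' = (m0 • 1 + m1 • x1 + m2 • x2) + s := ⟨_, (add_sub_cancel _ _).symm⟩
    rw [add_sub_cancel_left] at hr
    have hA : s ∈ A2 x1 (x3 + (l3⁻¹ * l2) • x2) := by
      refine A2_le ?_ ?_ hr
      · have := A2_lin x1 (x3 + (l3⁻¹ * l2) • x2) k0 k1 0; simpa using this
      · have := A2_lin x1 (x3 + (l3⁻¹ * l2) • x2) l0 l1 l3
        convert this using 1
        match_scalars <;> field_simp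
    refine ⟨l3⁻¹ * l2, (m2⁻¹ * m0) • 1 + (m2⁻¹ * m1) • x1 + m2⁻¹ • s,
      add_mem ?_ (Subalgebra.smul_mem _ hA _), ?_, ?_, d2⟩
    · have := A2_lin x1 (x3 + (l3⁻¹ * l2) • x2) (m2⁻¹ * m0) (m2⁻¹ * m1) 0; simpa using this
    · refine Sp_eq (mem_Sp.mpr ⟨k0, k1, 0, 0, by module⟩) (mem_Sp.mpr ⟨l0, l1, l3, 0, ?_⟩)
        (mem_Sp.mpr ⟨0, 0, 0, m2, ?_⟩) (mem_Sp.mpr ⟨-k1⁻¹ * k0, k1⁻¹, 0, 0, ?_⟩)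
        (mem_Sp.mpr ⟨-l3⁻¹ * l0 + l3⁻¹ * l1 * k1⁻¹ * k0, - l3⁻¹ * l1 * k1⁻¹, l3⁻¹, 0, ?_⟩)
        (mem_Sp.mpr ⟨0, 0, 0, m2⁻¹, ?_⟩) <;> match_scalars <;> field_simp <;> ring
    · rw [← deg_smul' w (inv_ne_zero hm2) (m0 • 1 + m1 • x1 + m2 • x2 + s)]
      congr 1; match_scalars <;> field_simp
  · right; right
    obtain ⟨d1, d2, d3⟩ := hx.deg_eq (y1 := c) (y2 := a) (y3 := b) ⟨hK.rot.rot, h3, hab⟩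
      (by rw [← e, Sp_312])
    obtain ⟨k0, k1, k2, hk2, rfl⟩ := hx.co2 ma d2
    obtain ⟨l0, l1, l2, l3, hl3, rfl⟩ := hx.co3 mb d3
    obtain ⟨m0, m1, hm1, rfl⟩ := hx.co1 mc d1
    obtain ⟨s, rfl⟩ : ∃ s, c' = (m0 • 1 + m1 • x1) + s := ⟨_, (add_sub_cancel _ _).symm⟩
    rw [add_sub_cancel_left] at hr
    set y2 := x2 + (k2⁻¹ * k1) • x1 with hy2
    set y3 := x3 + (l3⁻¹ * (l1 - l2 * k2⁻¹ * k1)) • x1 with hy3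
    have ea : k0 • 1 + k1 • x1 + k2 • x2 = k0 • 1 + k2 • y2 := by
      rw [hy2]; match_scalars <;> field_simp
    have eb : l0 • 1 + l1 • x1 + l2 • x2 + l3 • x3 = l0 • 1 + l2 • y2 + l3 • y3 := by
      rw [hy2, hy3]; match_scalars <;> field_simp
      ring
    rw [ea, eb] at hr ⊢
    have hA : s ∈ A2 y2 y3 := by
      refine A2_le ?_ (A2_lin _ _ _ _ _) hr
      have := A2_lin y2 y3 k0 k2 0; simpa using this
    refine ⟨k2⁻¹ * k1, l3⁻¹ * (l1 - l2 * k2⁻¹ * k1), (m1⁻¹ * m0) • 1 + m1⁻¹ • s,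
      add_mem (Subalgebra.smul_mem _ (one_mem _) _) (Subalgebra.smul_mem _ hA _), ?_, ?_, d1⟩
    · rw [← hy2, ← hy3]
      refine Sp_eq (mem_Sp.mpr ⟨k0, k2, 0, 0, by module⟩) (mem_Sp.mpr ⟨l0, l2, l3, 0, by module⟩)
        (mem_Sp.mpr ⟨0, 0, 0, m1, ?_⟩) (mem_Sp.mpr ⟨-k2⁻¹ * k0, k2⁻¹, 0, 0, ?_⟩)
        (mem_Sp.mpr ⟨-l3⁻¹ * l0 + l3⁻¹ * l2 * k2⁻¹ * k0, - l3⁻¹ * l2 * k2⁻¹, l3⁻¹, 0, ?_⟩)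
        (mem_Sp.mpr ⟨0, 0, 0, m1⁻¹, ?_⟩) <;> match_scalars <;> field_simp <;> ring
    · rw [← deg_smul' w (inv_ne_zero hm1) (m0 • 1 + m1 • x1 + s)]
      congr 1; match_scalars <;> field_simp

end


/-! Part 5 -/
set_option linter.unusedSectionVars false
set_option linter.unusedVariables false

noncomputable def A1 (f : PR) : Subalgebra ℂ PR := Algebra.adjoin ℂ {f}

lemma A1_mem (f : PR) : f ∈ A1 f := Algebra.subset_adjoin (by simp)
lemma A1_le {f g h : PR} (hf : f ∈ A2 g h) : A1 f ≤ A2 g h := by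
  rw [A1, Algebra.adjoin_le_iff]; rintro x rfl; exact hf
lemma A1_l {f r : PR} (g : PR) (h : r ∈ A1 f) : r ∈ A2 f g := A1_le (A2l f g) h
lemma A1_r {f r : PR} (g : PR) (h : r ∈ A1 f) : r ∈ A2 g f := A1_le (A2r g f) h

lemma cop_uniq {p q a b : ℕ} (h1 : Nat.Coprime p q) (h2 : Nat.Coprime a b) (h : p * b = q * a) :
    p = a ∧ q = b := by
  constructor
  · apply Nat.dvd_antisymm
    · exact h1.dvd_of_dvd_mul_left (h ▸ Dvd.intro _ rfl)
    · exact h2.dvd_of_dvd_mul_right (h ▸ Dvd.intro_left _ rfl)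
  · apply Nat.dvd_antisymm
    · exact h1.symm.dvd_of_dvd_mul_left (h ▸ Dvd.intro _ rfl)
    · exact h2.symm.dvd_of_dvd_mul_right (h ▸ Dvd.intro_left _ rfl)

section
variable {w : Fin 3 → ℝ} [hw : GoodW w]

lemma cr_pos {f g : PR} (hc : cr f g ≠ 0) : 1 ≤ deg w f ∧ 1 ≤ deg w g := by
  have key : ∀ f g : PR, cr f g ≠ 0 → 1 ≤ deg w g := by
    intro f g hc
    apply deg_ge_one
    rcases (deg_nonneg w g).lt_or_eq with h1 | h1
    · exact h1
    · obtain ⟨x, rfl⟩ := eq_C_of_deg w h1.symm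
      exact absurd (cr_C f x) hc
  refine ⟨key g f ?_, key f g hc⟩
  rw [cr_swap]; exact neg_ne_zero.mpr hc

lemma Noncan.symm {f g r : PR} (h : Noncan w f g r) : Noncan w g f r := by
  obtain ⟨h1, h2⟩ := h
  refine ⟨?_, fun hr => ?_⟩
  · refine Submodule.span_mono ?_ h1
    rintro m ⟨i, j, rfl, hle⟩
    exact ⟨j, i, mul_comm _ _, by linarith⟩
  · obtain ⟨i, j, e⟩ := h2 hr
    exact ⟨j, i, by linarith⟩

lemma Noncan.mem {f g r : PR} (h : Noncan w f g r) (M : Submodule ℂ PR)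
    (hM : ∀ i j : ℕ, i * deg w f + j * deg w g ≤ deg w r → f ^ i * g ^ j ∈ M) : r ∈ M := by
  refine (Submodule.span_le (p := M)).mpr ?_ h.1
  rintro m ⟨i, j, rfl, hle⟩
  exact hM i j hle

lemma Noncan.A1 {f g r : PR} (h : Noncan w f g r) (hd : deg w r < deg w g) : r ∈ A1 f := by
  refine h.mem (Subalgebra.toSubmodule (_root_.A1 f)) fun i j hle => ?_
  have hf := deg_nonneg w f
  have hg := deg_nonneg w g
  have : j = 0 := by
    by_contra hj
    have : (1:ℝ) ≤ j := by exact_mod_cast Nat.one_le_iff_ne_zero.mpr hj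
    nlinarith [Nat.cast_nonneg (α := ℝ) i]
  subst this
  rw [pow_zero, mul_one]
  exact pow_mem (A1_mem f) i

lemma Noncan.A1' {f g r : PR} (h : Noncan w f g r) (hd : deg w r < deg w f) : r ∈ _root_.A1 g :=
  h.symm.A1 hd

lemma Noncan.const {f g r : PR} (h : Noncan w f g r) (hf : deg w r < deg w f)
    (hg : deg w r < deg w g) : ∃ k : ℂ, r = k • 1 := by
  have : r ∈ Submodule.span ℂ {(1 : PR)} := by
    refine h.mem _ fun i j hle => ?_
    have hf' := deg_nonneg w f
    have hg' := deg_nonneg w g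
    have hi : i = 0 := by
      by_contra hj
      have : (1:ℝ) ≤ i := by exact_mod_cast Nat.one_le_iff_ne_zero.mpr hj
      nlinarith [Nat.cast_nonneg (α := ℝ) j]
    have hj : j = 0 := by
      by_contra hj
      have : (1:ℝ) ≤ j := by exact_mod_cast Nat.one_le_iff_ne_zero.mpr hj
      nlinarith [Nat.cast_nonneg (α := ℝ) i]
    subst hi hj
    simp only [pow_zero, mul_one]; exact Submodule.subset_span rfl
  obtain ⟨k, hk⟩ := Submodule.mem_span_singleton.mp this
  exact ⟨k, hk.symm⟩

/-- `r ∈ k[f] + k g` -/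
lemma Noncan.split {f g r : PR} (h : Noncan w f g r) (h1 : deg w r < 2 * deg w g)
    (h2 : deg w r < deg w f + deg w g) : ∃ k : ℂ, r - k • g ∈ _root_.A1 f := by
  have : r ∈ Subalgebra.toSubmodule (_root_.A1 f) ⊔ Submodule.span ℂ {g} := by
    refine h.mem _ fun i j hle => ?_
    have hf' := deg_nonneg w f
    have hg' := deg_nonneg w g
    rcases Nat.lt_or_ge j 1 with hj | hj
    · have : j = 0 := by omega
      subst this
      rw [pow_zero, mul_one]
      exact Submodule.mem_sup_left (pow_mem (A1_mem f) i : f ^ i ∈ _root_.A1 f)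
    · have hj' : (1:ℝ) ≤ j := by exact_mod_cast hj
      have hi : i = 0 := by
        by_contra hi
        have : (1:ℝ) ≤ i := by exact_mod_cast Nat.one_le_iff_ne_zero.mpr hi
        nlinarith
      have hj2 : j = 1 := by
        by_contra hj2
        have : (2:ℝ) ≤ j := by exact_mod_cast (by omega : 2 ≤ j)
        nlinarith [Nat.cast_nonneg (α := ℝ) i]
      subst hi hj2
      rw [pow_zero, one_mul, pow_one]
      exact Submodule.mem_sup_right (Submodule.mem_span_singleton_self g)
  obtain ⟨y, hy, z, hz, e⟩ := Submodule.mem_sup.mp this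
  obtain ⟨k, rfl⟩ := Submodule.mem_span_singleton.mp hz
  exact ⟨k, by rw [← e, add_sub_cancel_right]; exact hy⟩

/-- `r = k0 + k1 f + k2 g + k3 g^2` -/
lemma Noncan.sq {f g r : PR} (h : Noncan w f g r) (h1 : deg w r < 3 * deg w g)
    (h2 : deg w r < deg w f + deg w g) (h3 : deg w r < 2 * deg w f) :
    ∃ k0 k1 k2 k3 : ℂ, r = k0 • 1 + k1 • f + k2 • g + k3 • g ^ 2 := by
  have : r ∈ Sp f g (g ^ 2) := by
    refine h.mem _ fun i j hle => ?_
    have hf' := deg_nonneg w f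
    have hg' := deg_nonneg w g
    have hi : i < 2 := by
      by_contra hi
      have : (2:ℝ) ≤ i := by exact_mod_cast (by omega : 2 ≤ i)
      nlinarith [Nat.cast_nonneg (α := ℝ) j]
    have hj : j < 3 := by
      by_contra hj
      have : (3:ℝ) ≤ j := by exact_mod_cast (by omega : 3 ≤ j)
      nlinarith [Nat.cast_nonneg (α := ℝ) i]
    have hij : i = 0 ∨ j = 0 := by
      by_contra hij
      push Not at hij
      have a1 : (1:ℝ) ≤ j := by exact_mod_cast Nat.one_le_iff_ne_zero.mpr hij.2
      have a2 : (1:ℝ) ≤ i := by exact_mod_cast Nat.one_le_iff_ne_zero.mpr hij.1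
      nlinarith
    have hb : (i = 0 ∧ j = 0) ∨ (i = 1 ∧ j = 0) ∨ (i = 0 ∧ j = 1) ∨ (i = 0 ∧ j = 2) := by omega
    rcases hb with ⟨rfl, rfl⟩ | ⟨rfl, rfl⟩ | ⟨rfl, rfl⟩ | ⟨rfl, rfl⟩
    · simpa using Sp0 f g (g ^ 2)
    · simpa using Sp1 f g (g ^ 2)
    · simpa using Sp2 f g (g ^ 2)
    · simpa using Sp3 f g (g ^ 2)
  exact mem_Sp.mp this

lemma lemP4 {f g r : PR} (hc : cr f g ≠ 0) (hr : r ∈ A2 f g) :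
    Noncan w f g r ∨ (∃ k : ℕ, 0 < k ∧ deg w g = k * deg w f) ∨
    (∃ k : ℕ, 0 < k ∧ deg w f = k * deg w g) ∨
    ∃ (p q : ℕ) (ε : ℝ), 2 ≤ p ∧ 2 ≤ q ∧ Nat.Coprime p q ∧ 0 < ε ∧
      deg w f = p * ε ∧ deg w g = q * ε ∧
      (p * q - p - q) * ε + Dl w f g ≤ deg w r ∧
      (deg w r < p * q * ε → (p - 1) * q * ε + Dl w f g ≤ Dl w f r) := by
  obtain ⟨hf, hg⟩ := cr_pos (w := w) hc
  rcases lemmaP w hc (by linarith) (by linarith) hr with h | ⟨p, q, ε, hp, hq, hpq, hε, e1, e2, h⟩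
  · exact Or.inl h
  right
  rcases Nat.lt_or_ge p 2 with h1 | h1
  · left
    have : p = 1 := by omega
    subst this
    exact ⟨q, hq, by rw [e1, e2]; simp⟩
  rcases Nat.lt_or_ge q 2 with h2 | h2
  · right; left
    have : q = 1 := by omega
    subst this
    exact ⟨p, hp, by rw [e1, e2]; simp⟩
  right; right
  have h3 : (2:ℝ) ≤ p := by exact_mod_cast h1
  have h4 : (2:ℝ) ≤ q := by exact_mod_cast h2
  have h5 : (0:ℝ) ≤ p * q - p - q := by nlinarith
  have h6 := Dl_nonneg w f g
  obtain ⟨a, b⟩ := h (by positivity)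
  exact ⟨p, q, ε, h1, h2, hpq, hε, e1, e2, a, b⟩

lemma lemPD {f g r : PR} (hc : cr f g ≠ 0) (hr : r ∈ A2 f g) :
    Noncan w f g r ∨ (Dl w f g ≤ deg w r + deg w f ∧ Dl w f g ≤ deg w r + deg w g) := by
  obtain ⟨hf, hg⟩ := cr_pos (w := w) hc
  rcases lemmaP w hc (by linarith) (by linarith) hr with h | ⟨p, q, ε, hp, hq, hpq, hε, e1, e2, h⟩
  · exact Or.inl h
  right
  have hp' : (1:ℝ) ≤ p := by exact_mod_cast hp
  have hq' : (1:ℝ) ≤ q := by exact_mod_cast hq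
  have h0 := deg_nonneg w r
  have a1 : 0 ≤ ((p:ℝ) - 1) * (q * ε) := mul_nonneg (by linarith) (by positivity)
  have a2 : 0 ≤ ((q:ℝ) - 1) * (p * ε) := mul_nonneg (by linarith) (by positivity)
  rcases le_or_gt 0 ((p * q - p - q) * ε + Dl w f g) with h1 | h1
  · have h2 := (h h1).1
    constructor <;> nlinarith
  · constructor <;> nlinarith

variable (w) in
/-- Reducible triples (as linear spaces). -/
inductive Red : Submodule ℂ PR → Prop
  | base : Red (Sp (X 0) (X 1) (X 2))
  | el (a b c r : PR) : K3 a b c → deg w a ≠ deg w b → deg w a ≠ deg w c → deg w b ≠ deg w c →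
      r ∈ A2 a b → deg w (c + r) < deg w c → Red (Sp a b (c + r)) → Red (Sp a b c)
  | kr (f g h r : PR) (c : ℂ) (δ : ℝ) : K3 f g h → deg w f = 2 * δ → deg w g = 3 * δ →
      deg w h ≤ 3 / 2 * δ → r ∈ A2 f g → deg w (h + r) < deg w h →
      deg w (h + r) < δ + Dl w f g → c ≠ 0 → Red (Sp f g (h + r)) → Red (Sp f (g + c • h ^ 2) h)

variable (w) in
structure KD (f g h r : PR) (c : ℂ) (δ : ℝ) : Prop where
  K : K3 f g h
  df : deg w f = 2 * δ
  dg : deg w g = 3 * δ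
  dh : deg w h ≤ 3 / 2 * δ
  hr : r ∈ A2 f g
  lt : deg w (h + r) < deg w h
  lt' : deg w (h + r) < δ + Dl w f g
  hc : c ≠ 0
  red : Red w (Sp f g (h + r))

variable (w) in
def IHyp (ν : ℝ) : Prop := ∀ U V', Red w U → Adj U V' → Lt w U ν → Lt w V' ν → Red w V'

lemma up {ν : ℝ} (IH : IHyp w ν) {a b c c' : PR} (hK : K3 a b c) (hr : c' - c ∈ A2 a b)
    (hR : Red w (Sp a b c)) (hs : sm w a b c < ν) : Red w (Sp a b c') := by
  have hadj : Adj (Sp a b c) (Sp a b c') := ⟨a, b, c, c', hK, rfl, rfl, hr⟩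
  by_cases hL : Lt w (Sp a b c') ν
  · exact IH _ _ hR hadj ⟨a, b, c, hK, rfl, hs⟩ hL
  obtain ⟨a1, b1, c1, c2, h1, e1, e2, hr1, h2, h3, h4, h5, h6⟩ := hadj.nf w
  rw [e2]
  have hK2 := h1.to hr1
  have s1 : ν ≤ sm w a1 b1 c2 := by
    by_contra hcon
    push Not at hcon
    exact hL ⟨a1, b1, c2, hK2, e2, hcon⟩
  have s2 := sm_min h1 h2.ne h3 h4 hK e1.symm
  have hlt : deg w c1 < deg w c2 := by simp only [sm] at *; linarith
  refine Red.el a1 b1 c2 (c1 - c2) hK2 h2.ne h5 h6 (by rw [← neg_sub]; exact neg_mem hr1)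
    (by rw [add_sub_cancel]; exact hlt) ?_
  rw [add_sub_cancel, ← e1]; exact hR

/-- possible shapes of a reduction relative to a fixed sorted basis -/
lemma inv {x1 x2 x3 : PR} (hx : GB w x1 x2 x3) (hR : Red w (Sp x1 x2 x3)) :
    Sp x1 x2 x3 = Sp (X 0) (X 1) (X 2) ∨
    (∃ r ∈ A2 x1 x2, deg w (x3 + r) < deg w x3 ∧ Red w (Sp x1 x2 (x3 + r))) ∨
    (∃ β : ℂ, ∃ r ∈ A2 x1 (x3 + β • x2), deg w (x2 + r) < deg w x2 ∧
      Red w (Sp x1 (x3 + β • x2) (x2 + r))) ∨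
    (∃ α β : ℂ, ∃ r ∈ A2 (x2 + α • x1) (x3 + β • x1), deg w (x1 + r) < deg w x1 ∧
      Red w (Sp (x2 + α • x1) (x3 + β • x1) (x1 + r))) ∨
    (∃ f g h r c δ, KD w f g h r c δ ∧ Sp x1 x2 x3 = Sp f (g + c • h ^ 2) h) := by
  generalize hV : Sp x1 x2 x3 = V at hR
  cases hR with
  | base => exact Or.inl rfl
  | el a b c r hK hab hac hbc hr hlt hR =>
    right
    wlog h1 : deg w a < deg w b generalizing a b
    · rw [Sp_213 a b c]
      exact this b a hK.swap hab.symm hbc hac (by rwa [A2_comm])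
        (by rw [Sp_213]; exact hR) (hV.trans (Sp_213 _ _ _)) (lt_of_le_of_ne (not_lt.mp h1) hab.symm)
    have := hx.pos (c' := c + r) hK h1 hac hbc hV.symm (by rwa [add_sub_cancel_left])
    rcases this with ⟨s, hs, e, d, d'⟩ | ⟨β, s, hs, e, d, d'⟩ | ⟨α, β, s, hs, e, d, d'⟩
    · left; exact ⟨s, hs, by rw [d, ← d']; exact hlt, e ▸ hR⟩
    · right; left; exact ⟨β, s, hs, by rw [d, ← d']; exact hlt, e ▸ hR⟩
    · right; right; left; exact ⟨α, β, s, hs, by rw [d, ← d']; exact hlt, e ▸ hR⟩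
  | kr f g h r c δ h1 h2 h3 h4 h5 h6 h7 h8 h9 =>
    right; right; right; right
    exact ⟨f, g, h, r, c, δ, ⟨h1, h2, h3, h4, h5, h6, h7, h8, h9⟩, rfl⟩

lemma deg_of_lt {h r : PR} (hlt : deg w (h + r) < deg w h) : deg w r = deg w h := by
  have := deg_add_eq w (p := -h) (q := h + r) (by rwa [deg_neg'])
  rw [deg_neg'] at this
  rw [← this]; congr 1; ring

lemma cr_sq (f h : PR) (c : ℂ) : cr f (c • h ^ 2) = (C (2 * c) * h) • cr f h := by
  rw [cr_smul, pow_two, cr_mul]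
  apply cr_ext <;> simp only [Pi.smul_apply, Pi.add_apply, smul_eq_mul, smul_eq_C_mul, C_mul] <;>
    (have : (C 2 : PR) = 2 := map_ofNat C 2) <;> rw [this] <;> ring

lemma Dl_sq {f h : PR} {c : ℂ} (hc : c ≠ 0) (hcr : cr f h ≠ 0) :
    Dl w f (c • h ^ 2) = deg w h + Dl w f h := by
  have hh : h ≠ 0 := by
    rintro rfl
    apply hcr; have := cr_C f 0; simpa using this
  rw [Dl, cr_sq, vd_smul w _ hcr]
  · rw [← smul_eq_C_mul, deg_smul' w (mul_ne_zero two_ne_zero hc)]; rfl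
  · exact mul_ne_zero (by simp [hc]) hh

lemma deg_le_cases {a b c : ℝ} (h1 : a ≤ max b c) (h2 : c < a) : a ≤ b := by
  rcases le_max_iff.mp h1 with h | h
  · exact h
  · linarith

/-- (2,3)-cancellation data -/
lemma canc23 {f g h r : PR} {δ : ℝ} (hc : cr f g ≠ 0) (df : deg w f = 2 * δ) (dg : deg w g = 3 * δ)
    (hr : r ∈ A2 f g) (hpos : 0 < deg w r) (hlt : deg w r < 2 * δ) :
    δ + Dl w f g ≤ deg w r ∧ 3 * δ + Dl w f g ≤ Dl w f r := by
  have hδ : 0 < δ := by linarith [(cr_pos (w := w) hc).1]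
  rcases lemP4 (w := w) hc hr with h | ⟨k, hk, h⟩ | ⟨k, hk, h⟩ | ⟨p, q, ε, hp, hq, hpq, hε, e1, e2, h1, h2⟩
  · exfalso
    obtain ⟨k, rfl⟩ := h.const (by linarith) (by linarith)
    rw [deg_const] at hpos; exact lt_irrefl _ hpos
  · exfalso
    rw [df, dg] at h
    have : (3:ℝ) = k * 2 := by
      have : (3:ℝ) * δ = (k * 2) * δ := by linarith
      exact mul_right_cancel₀ hδ.ne' this
    have : 3 = k * 2 := by exact_mod_cast this
    omega
  · exfalso
    rw [df, dg] at h
    have : (2:ℝ) = k * 3 := by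
      have : (2:ℝ) * δ = (k * 3) * δ := by linarith
      exact mul_right_cancel₀ hδ.ne' this
    have : 2 = k * 3 := by exact_mod_cast this
    omega
  · have e : (p * 3 : ℝ) = q * 2 := by
      have : (p * 3 : ℝ) * ε = q * 2 * ε := by linarith
      exact mul_right_cancel₀ hε.ne' this
    have e' : p * 3 = q * 2 := by exact_mod_cast e
    obtain ⟨rfl, rfl⟩ := cop_uniq hpq (by norm_num : Nat.Coprime 2 3) e'
    have : ε = δ := by push_cast at e1; linarith
    subst this
    push_cast at h1 h2
    have := h2 (by linarith)
    constructor <;> linarith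

structure KC (w : Fin 3 → ℝ) (f g h g' : PR) (δ : ℝ) : Prop where
  gb : GB w h f g'
  dpos : 0 < δ
  Dpos : 1 ≤ Dl w f g
  hge : δ + Dl w f g ≤ deg w h
  gle : deg w g' ≤ 3 * δ
  geq : deg w h < 3 / 2 * δ → deg w g' = 3 * δ
  T : 3 * δ + Dl w f g ≤ Dl w h f
  D13 : Dl w h g' = δ + Dl w h f
  D23 : Dl w f g' = deg w h + Dl w h f

lemma KD.conseq {f g h r : PR} {c : ℂ} {δ : ℝ} (d : KD w f g h r c δ) :
    KC w f g h (g + c • h ^ 2) δ := by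
  obtain ⟨hK, df, dg, dh, hr, lt, lt', hc, -⟩ := d
  have hp := hK.pos w
  have hhp := hK.rot.rot.pos w
  have hδ : 0 < δ := by linarith
  have hD := Dl_pos w hK.cr12
  have dr := deg_of_lt lt
  obtain ⟨c1, c2⟩ := canc23 (h := h) hK.cr12 df dg hr (by linarith) (by linarith)
  have hfr : Dl w f (h + r) < Dl w f r := by
    have := Dl_le w f (h + r); linarith
  have hT : Dl w f h = Dl w f r := by
    have e : h = (-1:ℂ) • r + (h + r) := by module
    rw [e, Dl_add_eq w, Dl_smul w _ _ (by norm_num)]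
    rwa [Dl_smul w _ _ (by norm_num)]
  have hgh : Dl w g h = δ + Dl w f h := by
    have a1 := D1 w hK
    have a2 := D1 w hK.swap
    rw [Dl_comm w g f] at a2
    apply le_antisymm
    · have := deg_le_cases (c := deg w h + Dl w f g) a1
      by_contra hcon
      push Not at hcon
      have := this (by linarith)
      linarith
    · have := deg_le_cases (c := deg w h + Dl w f g) a2 (by linarith)
      linarith
  have hfh0 : cr f h ≠ 0 := hK.swap23.cr12
  have hsq : Dl w f (c • h ^ 2) = deg w h + Dl w f h := Dl_sq hc hfh0
  have hfg' : Dl w f (g + c • h ^ 2) = deg w h + Dl w f h := by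
    rw [add_comm, Dl_add_eq w, hsq]; rw [hsq]; linarith
  have hhg' : Dl w h (g + c • h ^ 2) = δ + Dl w f h := by
    have : cr h (g + c • h ^ 2) = cr h g := by
      rw [cr_add, cr_sq, cr_self, smul_zero, add_zero]
    rw [Dl, this, ← hgh, Dl_comm]; rfl
  have hh0 : h ≠ 0 := ne_zero_of_deg w (by linarith)
  have dsq : deg w (c • h ^ 2) = 2 * deg w h := by rw [deg_smul' w hc, deg_pow' w hh0]; norm_num
  have hg'le : deg w (g + c • h ^ 2) ≤ 3 * δ := deg_add_le' (by linarith) (by linarith)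
  have hg'ge := Dl_le w f (g + c • h ^ 2)
  refine ⟨⟨?_, by linarith, by linarith⟩, hδ, hD, by linarith, hg'le, ?_, ?_, ?_, ?_⟩
  · have : c • h ^ 2 ∈ A2 f h := Subalgebra.smul_mem _ (pow_mem (A2r _ _) 2) _
    exact (hK.swap23.add this).swap
  · intro h1
    rw [deg_add_eq w, dg]; linarith
  · rw [Dl_comm w h f]; linarith
  · rw [hhg', Dl_comm w h f]
  · rw [hfg', Dl_comm w h f]

end


/-! Part 6 -/
set_option linter.unusedSectionVars false
set_option linter.unusedVariables false

section
variable {w : Fin 3 → ℝ} [hw : GoodW w]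

lemma cr_wedge (x1 x2 x3 : PR) (k0 k1 k2 k3 l0 l1 l2 l3 : ℂ) :
    cr (k0 • 1 + k1 • x1 + k2 • x2 + k3 • x3) (l0 • 1 + l1 • x1 + l2 • x2 + l3 • x3) =
      (k1 * l2 - k2 * l1) • cr x1 x2 + (k1 * l3 - k3 * l1) • cr x1 x3
        + (k2 * l3 - k3 * l2) • cr x2 x3 := by
  apply cr_ext <;> simp only [Pi.add_apply, Pi.smul_apply, cr0, cr1, cr2, map_add,
    Derivation.map_smul, E_one, smul_zero, zero_add] <;>
    simp only [smul_eq_C_mul, C_mul, C_sub] <;> ring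

lemma vd_lt_add {u v : Fin 3 → PR} (h : vd w v < vd w u) : vd w (u + v) = vd w u := by
  apply le_antisymm
  · exact (vd_add_le w u v).trans (max_le le_rfl h.le)
  · have := vd_add_le w (u + v) (-v)
    rw [add_neg_cancel_right, vd_neg] at this
    rcases le_max_iff.mp this with h1 | h1
    · exact h1
    · linarith

lemma vd_csmul_le (c : ℂ) (v : Fin 3 → PR) : vd w (c • v) ≤ vd w v := by
  by_cases hc : c = 0
  · subst hc
    rw [zero_smul]; have := vd_nonneg w v
    simpa [vd, deg_zero'] using this
  · rw [vd_csmul w hc]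

lemma vd3 {u v z : Fin 3 → PR} (a b : ℂ) {c : ℂ} (hc : c ≠ 0) (h1 : vd w u < vd w z)
    (h2 : vd w v < vd w z) : vd w (a • u + b • v + c • z) = vd w z := by
  rw [add_comm, vd_lt_add, vd_csmul w hc]
  rw [vd_csmul w hc]
  refine (vd_add_le w _ _).trans_lt (max_lt ?_ ?_)
  · exact (vd_csmul_le a u).trans_lt h1
  · exact (vd_csmul_le b v).trans_lt h2

/-- plane wedge -/
lemma cr_plane (a b c : PR) (α β : ℂ) :
    cr (a + α • c) (b + β • c) = β • cr a c + (-α) • cr b c + (1:ℂ) • cr a b := by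
  apply cr_ext <;> simp only [Pi.add_apply, Pi.smul_apply, cr0, cr1, cr2, map_add,
    Derivation.map_smul] <;>
    simp only [smul_eq_C_mul, C_neg, C_1] <;> ring

lemma Dl_plane {a b c : PR} (α β : ℂ) (h1 : Dl w a c < Dl w a b) (h2 : Dl w b c < Dl w a b) :
    Dl w (a + α • c) (b + β • c) = Dl w a b := by
  rw [Dl, cr_plane, vd3 _ _ one_ne_zero h1 h2]; rfl

/-- as soon as `α ≠ 0` or `β ≠ 0`, lower bound -/
lemma Dl_plane_ge {a b c : PR} {α β : ℂ} (hne : α ≠ 0 ∨ β ≠ 0) (h1 : Dl w a b < Dl w a c)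
    (h2 : Dl w a c < Dl w b c) : Dl w a c ≤ Dl w (a + α • c) (b + β • c) := by
  by_cases hα : α = 0
  · subst hα
    have hβ : β ≠ 0 := by simpa using hne
    rw [Dl, Dl, cr_plane, neg_zero, zero_smul, add_zero, vd_lt_add, vd_csmul w hβ]
    · rw [vd_csmul w hβ, one_smul]; exact h1
  · rw [Dl.eq_def w (a + α • c), cr_plane]
    have : vd w (β • cr a c + (-α) • cr b c + (1:ℂ) • cr a b) = Dl w b c := by
      rw [add_right_comm, vd3 _ _ (neg_ne_zero.mpr hα) h2 (h1.trans h2)]; rfl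
    rw [this]; exact h2.le

lemma Sp_base : K3 (X 0) (X 1) (X 2) := by
  have e : dt (X 0) (X 1) (X 2) = X 0 * X 1 * X 2 := by
    simp only [dt, E, Derivation.smul_apply, pderiv_X, smul_eq_mul]
    simp [mul_assoc]
  rw [K3, e]
  simp [X_ne_zero]

lemma deg_X (i : Fin 3) : deg w (X i : PR) = w i := by
  apply le_antisymm
  · apply deg_le w
    · linarith [hw.one_le i]
    · intro α hα
      rw [coeff_X] at hα
      split_ifs at hα with h
      · subst h
        simp only [wt, Finsupp.single_apply]
        fin_cases i <;> simp [Fin.sum_univ_three]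
      · simp at hα
  · have := wt_le_deg w (p := (X i : PR)) (α := Finsupp.single i 1) (by simp)
    refine le_trans ?_ this
    simp only [wt, Finsupp.single_apply]
    fin_cases i <;> simp [Fin.sum_univ_three]


lemma deg_base {v : PR} (hv : v ∈ Sp (X 0) (X 1) (X 2)) (h : 0 < deg w v) : ∃ i, deg w v = w i := by
  obtain ⟨α, h1, h2⟩ := exists_deg w (ne_zero_of_deg w h)
  obtain ⟨k0, k1, k2, k3, rfl⟩ := mem_Sp.mp hv
  have h0 : α ≠ 0 := by
    rintro rfl
    rw [wt_zero] at h2; linarith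
  have key : ∃ i : Fin 3, α = Finsupp.single i 1 := by
    by_contra hcon
    push Not at hcon
    apply h1
    simp [coeff_X, coeff_one, (hcon 0).symm, (hcon 1).symm, (hcon 2).symm, h0.symm]
  obtain ⟨i, rfl⟩ := key
  refine ⟨i, h2.symm.trans ?_⟩
  simp only [wt, Finsupp.single_apply]
  fin_cases i <;> simp

lemma base_irr {a b c : PR} (hK : K3 a b c) (hab : deg w a ≠ deg w b)
    (e : Sp a b c = Sp (X 0) (X 1) (X 2)) {m n : ℕ} (hm : 0 < m)
    (h : m * deg w a = n * deg w b) : False := by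
  obtain ⟨i, hi⟩ := deg_base (w := w) (v := a) (e ▸ Sp1 a b c) (by linarith [hK.pos w])
  obtain ⟨j, hj⟩ := deg_base (w := w) (v := b) (e ▸ Sp2 a b c) (by linarith [hK.rot.pos w])
  have hij : i ≠ j := by rintro rfl; exact hab (hi.trans hj.symm)
  have := hw.indep (fun l => (if l = i then (m:ℤ) else 0) - (if l = j then (n:ℤ) else 0)) (by
    push_cast
    simp only [mul_sub, Finset.sum_sub_distrib]
    simp
    rw [hi, hj] at h; linarith)
  have h2 := congrFun this i
  simp [hij] at h2
  omega

lemma base_lt {a b c : PR} (hK : K3 a b c)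
    (e : Sp a b c = Sp (X 0) (X 1) (X 2)) : deg w a < 2 := by
  obtain ⟨i, hi⟩ := deg_base (w := w) (v := a) (e ▸ Sp1 a b c) (by linarith [hK.pos w])
  rw [hi]; exact hw.lt_two i

variable (w) in
/-- a reduction replacing `c` -/
def Miss (a b c : PR) : Prop := ∃ (α β : ℂ) (r : PR), (α ≠ 0 → deg w c < deg w a) ∧
  (β ≠ 0 → deg w c < deg w b) ∧ r ∈ A2 (a + α • c) (b + β • c) ∧ deg w (c + r) < deg w c ∧
  Red w (Sp (a + α • c) (b + β • c) (c + r))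

lemma Miss.symm {a b c : PR} (h : Miss w a b c) : Miss w b a c := by
  obtain ⟨α, β, r, h1, h2, h3, h4, h5⟩ := h
  exact ⟨β, α, r, h2, h1, by rwa [A2_comm], h4, by rwa [Sp_213]⟩

lemma inv_un {a b c : PR} (hK : K3 a b c) (hab : deg w a ≠ deg w b) (hac : deg w a ≠ deg w c)
    (hbc : deg w b ≠ deg w c) (hR : Red w (Sp a b c)) :
    Sp a b c = Sp (X 0) (X 1) (X 2) ∨ Miss w a b c ∨ Miss w a c b ∨ Miss w b c a ∨
    (∃ f g h r k δ, KD w f g h r k δ ∧ Sp a b c = Sp f (g + k • h ^ 2) h) := by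
  wlog h1 : deg w a < deg w b generalizing a b
  · have := this hK.swap hab.symm hbc hac (by rwa [Sp_213]) (lt_of_le_of_ne (not_lt.mp h1) hab.symm)
    rw [Sp_213 b a c] at this
    rcases this with h | h | h | h | h
    · exact Or.inl h
    · exact Or.inr (Or.inl h.symm)
    · exact Or.inr (Or.inr (Or.inr (Or.inl h)))
    · exact Or.inr (Or.inr (Or.inl h))
    · exact Or.inr (Or.inr (Or.inr (Or.inr h)))
  wlog h2 : deg w b < deg w c generalizing a b c
  · have h2' := lt_of_le_of_ne (not_lt.mp h2) hbc.symm
    rcases hac.lt_or_gt with h3 | h3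
    · have := this hK.swap23 hac hab hbc.symm (by rwa [Sp_132]) h3 h2'
      rw [Sp_132 a c b] at this
      rcases this with h | h | h | h | h
      · exact Or.inl h
      · exact Or.inr (Or.inr (Or.inl h))
      · exact Or.inr (Or.inl h)
      · exact Or.inr (Or.inr (Or.inr (Or.inl h.symm)))
      · exact Or.inr (Or.inr (Or.inr (Or.inr h)))
    · have := this hK.rot.rot hac.symm hbc.symm hab (by rw [Sp_231]; exact hR) h3 h1
      rw [Sp_231 c a b] at this
      rcases this with h | h | h | h | h
      · exact Or.inl h
      · exact Or.inr (Or.inr (Or.inl h.symm))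
      · exact Or.inr (Or.inr (Or.inr (Or.inl h.symm)))
      · exact Or.inr (Or.inl h)
      · exact Or.inr (Or.inr (Or.inr (Or.inr h)))
  rcases inv (w := w) ⟨hK, h1, h2⟩ hR with h | ⟨r, hr, h3, h4⟩ | ⟨β, r, hr, h3, h4⟩ |
    ⟨α, β, r, hr, h3, h4⟩ | h
  · exact Or.inl h
  · exact Or.inr (Or.inl ⟨0, 0, r, by simp, by simp, by simpa using hr, h3, by simpa using h4⟩)
  · exact Or.inr (Or.inr (Or.inl ⟨0, β, r, by simp, fun _ => h2, by simpa using hr, h3, by simpa using h4⟩))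
  · exact Or.inr (Or.inr (Or.inr (Or.inl ⟨α, β, r, fun _ => h1, fun _ => h1.trans h2, hr, h3, h4⟩)))
  · exact Or.inr (Or.inr (Or.inr (Or.inr h)))

/-- weak form of the degree estimate -/
lemma lemPE {f g r : PR} (hc : cr f g ≠ 0) (hr : r ∈ A2 f g) :
    Noncan w f g r ∨ (∃ k : ℕ, 0 < k ∧ deg w g = k * deg w f) ∨
    (∃ k : ℕ, 0 < k ∧ deg w f = k * deg w g) ∨
    (Dl w f g + deg w g ≤ deg w r + deg w f ∧ Dl w f g + deg w f ≤ deg w r + deg w g) := by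
  rcases lemP4 (w := w) hc hr with h | h | h | ⟨p, q, ε, hp, hq, hpq, hε, e1, e2, h1, h2⟩
  · exact Or.inl h
  · exact Or.inr (Or.inl h)
  · exact Or.inr (Or.inr (Or.inl h))
  · right; right; right
    have h3 : (2:ℝ) ≤ p := by exact_mod_cast hp
    have h4 : (2:ℝ) ≤ q := by exact_mod_cast hq
    have a1 : 0 ≤ ((p:ℝ) - 2) * (q * ε) := mul_nonneg (by linarith) (by positivity)
    have a2 : 0 ≤ ((q:ℝ) - 2) * (p * ε) := mul_nonneg (by linarith) (by positivity)
    constructor <;> nlinarith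

/-- In a K-space, every sorted basis has the same wedge degrees. -/
lemma KC.transfer {f g h g' y1 y2 y3 : PR} {δ : ℝ} (k : KC w f g h g' δ) (hy : GB w y1 y2 y3)
    (e : Sp y1 y2 y3 = Sp h f g') : Dl w y1 y2 = Dl w h f ∧ Dl w y1 y3 = Dl w h g' ∧
      Dl w y2 y3 = Dl w f g' ∧ deg w y1 = deg w h ∧ deg w y2 = deg w f ∧ deg w y3 = deg w g' := by
  obtain ⟨d1, d2, d3⟩ := k.gb.deg_eq hy e.symm
  obtain ⟨k0, k1, hk1, e1⟩ := k.gb.co1 (e ▸ Sp1 y1 y2 y3) d1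
  obtain ⟨l0, l1, l2, hl2, e2⟩ := k.gb.co2 (e ▸ Sp2 y1 y2 y3) d2
  obtain ⟨m0, m1, m2, m3, hm3, e3⟩ := k.gb.co3 (e ▸ Sp3 y1 y2 y3) d3
  have e1' : y1 = k0 • 1 + k1 • h + (0:ℂ) • f + (0:ℂ) • g' := by rw [e1]; module
  have e2' : y2 = l0 • 1 + l1 • h + l2 • f + (0:ℂ) • g' := by rw [e2]; module
  have hD := k.D13
  have hD' := k.D23
  have i1 : Dl w h f < Dl w h g' := by linarith [k.dpos]
  have i2 : Dl w h g' < Dl w f g' := by linarith [k.dpos, k.hge, k.Dpos]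
  refine ⟨?_, ?_, ?_, d1, d2, d3⟩
  · rw [Dl, e1', e2', cr_wedge]
    have : (k1 * l2 - 0 * l1) • cr h f + (k1 * 0 - 0 * l1) • cr h g' + ((0:ℂ) * 0 - 0 * l2) • cr f g'
      = (k1 * l2) • cr h f := by module
    rw [this, vd_csmul w (mul_ne_zero hk1 hl2)]; rfl
  · rw [Dl, e1', e3, cr_wedge]
    have : (k1 * m2 - 0 * m1) • cr h f + (k1 * m3 - 0 * m1) • cr h g' + ((0:ℂ) * m3 - 0 * m2) • cr f g'
      = (k1 * m3) • cr h g' + (k1 * m2) • cr h f := by module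
    rw [this, vd_lt_add, vd_csmul w (mul_ne_zero hk1 hm3)]; rfl
    rw [vd_csmul w (mul_ne_zero hk1 hm3)]
    exact (vd_csmul_le _ _).trans_lt i1
  · rw [Dl, e2', e3, cr_wedge, vd3 _ _ _ (i1.trans i2) i2]; rfl
    simpa using ⟨hl2, hm3⟩

end


/-! Part 7 -/
set_option linter.unusedSectionVars false
set_option linter.unusedVariables false

section
variable {w : Fin 3 → ℝ} [hw : GoodW w]

lemma Dl_add_smul {f g h : PR} (β : ℂ) (h1 : Dl w f h < Dl w f g) :
    Dl w f (g + β • h) = Dl w f g :=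
  Dl_add_eq w ((Dl_smul_le w _ _ _).trans_lt h1)

lemma canc_pq {f g r : PR} {p0 q0 : ℕ} {ε0 : ℝ} (hc : cr f g ≠ 0) (hr : r ∈ A2 f g)
    (hp : 2 ≤ p0) (hq : 2 ≤ q0) (hcop : Nat.Coprime p0 q0) (df : deg w f = p0 * ε0)
    (dg : deg w g = q0 * ε0) : Noncan w f g r ∨
      ((p0 * q0 - p0 - q0) * ε0 + Dl w f g ≤ deg w r ∧
      (deg w r < p0 * q0 * ε0 → (p0 - 1) * q0 * ε0 + Dl w f g ≤ Dl w f r)) := by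
  have hfp := (cr_pos (w := w) hc).1
  have hp' : (0:ℝ) < p0 := by exact_mod_cast (by omega : 0 < p0)
  have hε0 : 0 < ε0 := by
    by_contra hcon
    push Not at hcon
    have : (p0:ℝ) * ε0 ≤ 0 := mul_nonpos_of_nonneg_of_nonpos hp'.le hcon
    linarith
  have bad : ∀ k p q : ℕ, 2 ≤ p → Nat.Coprime p q → q * ε0 = k * (p * ε0) → False := by
    intro k p q h2 hcop h
    have h3 : (q:ℝ) = k * p := by
      have : (q:ℝ) * ε0 = (k * p) * ε0 := by linarith
      exact mul_right_cancel₀ hε0.ne' this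
    have h4 : q = k * p := by exact_mod_cast h3
    rw [h4] at hcop
    have : p ∣ 1 := by
      rw [← hcop]; exact Nat.dvd_gcd dvd_rfl (Dvd.intro_left _ rfl)
    have := Nat.le_of_dvd one_pos this
    omega
  rcases lemP4 (w := w) hc hr with h | ⟨k, hk, h⟩ | ⟨k, hk, h⟩ | ⟨p, q, ε, hp1, hq1, hpq, hε, e1, e2, h1, h2⟩
  · exact Or.inl h
  · exact (bad k p0 q0 hp hcop (by rw [← df, ← dg]; exact h)).elim
  · exact (bad k q0 p0 hq hcop.symm (by rw [← df, ← dg]; exact h)).elim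
  · right
    have e : (p * q0 : ℝ) = q * p0 := by
      have : (p * q0 : ℝ) * (ε * ε0) = q * p0 * (ε * ε0) := by
        calc (p * q0 : ℝ) * (ε * ε0) = (p * ε) * (q0 * ε0) := by ring
          _ = (p0 * ε0) * (q * ε) := by rw [← e1, ← dg, ← df, ← e2]
          _ = _ := by ring
      exact mul_right_cancel₀ (mul_pos hε hε0).ne' this
    have e' : p * q0 = q * p0 := by exact_mod_cast e
    obtain ⟨rfl, rfl⟩ := cop_uniq hpq hcop e'
    have : ε = ε0 := mul_left_cancel₀ hp'.ne' (e1.symm.trans df)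
    subst this
    exact ⟨h1, h2⟩

lemma min_red {a b c c0 : PR} (h1 : c0 - c ∈ A2 a b) (h2 : Red w (Sp a b c0)) :
    ∃ c1, c1 - c ∈ A2 a b ∧ Red w (Sp a b c1) ∧ deg w c1 ≤ deg w c0 ∧
      ∀ c2, c2 - c ∈ A2 a b → Red w (Sp a b c2) → deg w c1 ≤ deg w c2 := by
  let S : Set PR := {x | x - c ∈ A2 a b ∧ Red w (Sp a b x)}
  have hne : S.Nonempty := ⟨c0, h1, h2⟩
  refine ⟨(deg_wf w).min S hne, ((deg_wf w).min_mem S hne).1, ((deg_wf w).min_mem S hne).2, ?_, ?_⟩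
  · exact not_lt.mp ((deg_wf w).not_lt_min S (x := c0) ⟨h1, h2⟩)
  · intro c2 h3 h4
    exact not_lt.mp ((deg_wf w).not_lt_min S (x := c2) ⟨h3, h4⟩)

lemma sub_add_mem {a b c c1 r : PR} (h1 : c1 - c ∈ A2 a b) (h2 : r ∈ A2 a b) : c1 + r - c ∈ A2 a b := by
  have : c1 + r - c = (c1 - c) + r := by ring
  rw [this]; exact add_mem h1 h2

/-- nat solutions helper -/
lemma nat4 (k : ℕ) : k = 0 ∨ k = 1 ∨ k = 2 ∨ k = 3 ∨ (4:ℝ) ≤ k := by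
  rcases Nat.lt_or_ge k 4 with h | h
  · have : k = 0 ∨ k = 1 ∨ k = 2 ∨ k = 3 := by omega
    rcases this with h | h | h | h <;> simp [h]
  · exact Or.inr (Or.inr (Or.inr (Or.inr (by exact_mod_cast h))))

/-- scale out δ from a natural relation -/
lemma nat_scale {δ : ℝ} (hδ : 0 < δ) {x y : ℕ} (h : (x:ℝ) * δ = y * δ) : x = y := by
  have := mul_right_cancel₀ hδ.ne' h
  exact_mod_cast this

lemma EX2 {f b a r : PR} {δ : ℝ} (hK : K3 f b a) (df : deg w f = 6 * δ) (db : deg w b = 4 * δ)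
    (da : deg w a = 9 * δ) (hD : Dl w f a ≤ δ) (hr : r ∈ A2 f b) (hlt : deg w (a + r) < deg w a)
    (hR : Red w (Sp f b (a + r))) : False := by
  have hδ : 0 < δ := by linarith [hK.pos w]
  obtain ⟨a1, m1, R1, l1, mn⟩ := min_red (c := a) (by simpa using hr) hR
  have l1' : deg w a1 < 9 * δ := by linarith
  obtain ⟨s, rfl⟩ : ∃ s, a1 = a + s := ⟨a1 - a, by ring⟩
  rw [add_sub_cancel_left] at m1
  have ds : deg w s = 9 * δ := by rw [deg_of_lt (h := a) (by linarith), da]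
  have hD2 := D2 w hK
  obtain ⟨c1, c2⟩ : (2 * δ + Dl w f b ≤ 9 * δ) ∧ 8 * δ + Dl w f b ≤ Dl w f s := by
    rcases canc_pq (p0 := 3) (q0 := 2) (ε0 := 2 * δ) hK.cr12 m1 (by norm_num) (by norm_num) (by norm_num)
      (by push_cast; linarith) (by push_cast; linarith) with h | ⟨h1, h2⟩
    · exfalso
      obtain ⟨i, j, hij⟩ := h.2 (by linarith)
      rw [ds, df, db] at hij
      have := nat_scale hδ (x := 9) (y := i * 6 + j * 4) (by push_cast; linarith)
      omega
    · push_cast at h1 h2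
      rw [ds] at h1 h2
      have := h2 (by linarith)
      constructor <;> linarith
  have hY : Dl w f (a + s) = Dl w f s := by
    rw [add_comm, Dl_add_eq w]; linarith
  have hKs := hK.add m1
  have hle := Dl_le w f (a + s)
  set x := a + s with hx
  clear_value x
  -- Δ(b, x)
  have hbx : Dl w b x + 2 * δ = Dl w f x := by
    have a1 := D1 w hKs
    have a2 := D1 w hKs.swap
    rw [Dl_comm w b f] at a2
    apply le_antisymm
    · by_contra hcon
      push Not at hcon
      have := deg_le_cases (c := deg w x + Dl w f b) a1 (by linarith)
      linarith
    · have := deg_le_cases (c := deg w x + Dl w f b) a2 (by linarith)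
      linarith
  have d1 : deg w f ≠ deg w b := by intro h; linarith
  have d2 : deg w f ≠ deg w x := by intro h; linarith
  have d3 : deg w b ≠ deg w x := by intro h; linarith
  rcases inv_un hKs d1 d2 d3 R1 with h | ⟨α, β, q, h1, h2, h3, h4, h5⟩ | ⟨α, β, q, h1, h2, h3, h4, h5⟩ |
    ⟨α, β, q, h1, h2, h3, h4, h5⟩ | ⟨f', g', h', r', k, δ', kd, e⟩
  · exact base_irr hKs d1 h (m := 2) (n := 3) (by norm_num) (by push_cast; linarith)
  · have hα : α = 0 := by
      by_contra hα; linarith [h1 hα]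
    have hβ : β = 0 := by
      by_contra hα; linarith [h2 hα]
    subst hα hβ
    simp only [zero_smul, add_zero] at h3 h5
    have := mn (x + q) (by rw [hx]; exact sub_add_mem (by simpa using m1) h3) h5
    linarith
  · -- replace b; plane f + α b, x + β b
    have hcr : cr (f + α • b) (x + β • b) ≠ 0 := by
      have h6 : Dl w (f + α • b) (x + β • b) = Dl w f x := by
        apply Dl_plane
        · linarith
        · rw [Dl_comm w x b]; linarith
      intro h0
      rw [Dl_zero_of w h0] at h6
      linarith [Dl_nonneg w f b]
    have h6 : Dl w (f + α • b) (x + β • b) = Dl w f x := by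
      apply Dl_plane
      · linarith
      · rw [Dl_comm w x b]; linarith
    have dq := deg_of_lt h4
    have dF : deg w (f + α • b) = deg w f := deg_add_eq w ((deg_smul_le w _ _).trans_lt (by linarith))
    have dX : deg w (x + β • b) = deg w x := deg_add_eq w ((deg_smul_le w _ _).trans_lt (by linarith))
    rcases lemPD (w := w) hcr h3 with h | ⟨h, h'⟩
    · obtain ⟨k, rfl⟩ := h.const (by linarith) (by linarith)
      rw [deg_const] at dq; linarith
    · linarith
  · -- replace f; plane b + α f, x + β f
    have hα : α = 0 := by
      by_contra hα; linarith [h1 hα]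
    subst hα
    rw [zero_smul, add_zero] at h3 h5
    have h6 : Dl w b (x + β • f) = Dl w b x := by
      apply Dl_add_smul
      rw [Dl_comm w b f]; linarith
    have hcr : cr b (x + β • f) ≠ 0 := by
      intro h0
      rw [Dl_zero_of w h0] at h6
      linarith [Dl_nonneg w f b]
    have dq := deg_of_lt h4
    have dX : deg w (x + β • f) = deg w x := deg_add_eq w ((deg_smul_le w _ _).trans_lt (by linarith))
    rcases lemPD (w := w) hcr h3 with h | ⟨h, h'⟩
    · obtain ⟨i, j, hij⟩ := h.2 (by linarith)
      rw [dq, dX, df, db] at hij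
      have : j = 0 := by
        by_contra hj
        have : (1:ℝ) ≤ j := by exact_mod_cast Nat.one_le_iff_ne_zero.mpr hj
        nlinarith [Nat.cast_nonneg (α := ℝ) i]
      subst this
      have := nat_scale hδ (x := 6) (y := i * 4) (by push_cast at *; linarith)
      omega
    · linarith
  · have kc := kd.conseq
    have e' : Sp b f x = Sp h' f' (g' + k • h' ^ 2) := by
      rw [Sp_213, e, Sp_312]
    obtain ⟨-, -, -, q1, q2, q3⟩ := kc.transfer (y1 := b) (y2 := f) (y3 := x)
      ⟨hKs.swap, by linarith, by linarith⟩ e'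
    have := kd.df
    have := kc.geq (by linarith)
    linarith

lemma Miss.top {a b c : PR} (h : Miss w a b c) (h1 : deg w a < deg w c) (h2 : deg w b < deg w c) :
    ∃ r ∈ A2 a b, deg w (c + r) < deg w c ∧ Red w (Sp a b (c + r)) := by
  obtain ⟨α, β, r, h3, h4, h5, h6, h7⟩ := h
  have hα : α = 0 := by
    by_contra hα; linarith [h3 hα]
  have hβ : β = 0 := by
    by_contra hα; linarith [h4 hα]
  subst hα hβ
  simp only [zero_smul, add_zero] at h5 h7
  exact ⟨r, h5, h6, h7⟩

lemma Miss.mid {a b c : PR} (h : Miss w a b c) (h1 : deg w a < deg w c) (h2 : deg w c < deg w b) :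
    ∃ (β : ℂ), ∃ r ∈ A2 a (b + β • c), deg w (c + r) < deg w c ∧ Red w (Sp a (b + β • c) (c + r))
      ∧ deg w r = deg w c ∧ deg w (b + β • c) = deg w b := by
  obtain ⟨α, β, r, h3, h4, h5, h6, h7⟩ := h
  have hα : α = 0 := by
    by_contra hα; linarith [h3 hα]
  subst hα
  simp only [zero_smul, add_zero] at h5 h7
  exact ⟨β, r, h5, h6, h7, deg_of_lt h6, deg_add_eq w ((deg_smul_le w _ _).trans_lt h2)⟩

lemma Miss.bot {a b c : PR} (h : Miss w a b c) (h1 : deg w c < deg w a) (h2 : deg w c < deg w b) :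
    ∃ (α β : ℂ), ∃ r ∈ A2 (a + α • c) (b + β • c), deg w (c + r) < deg w c ∧
      Red w (Sp (a + α • c) (b + β • c) (c + r))
      ∧ deg w r = deg w c ∧ deg w (a + α • c) = deg w a ∧ deg w (b + β • c) = deg w b := by
  obtain ⟨α, β, r, h3, h4, h5, h6, h7⟩ := h
  exact ⟨α, β, r, h5, h6, h7, deg_of_lt h6, deg_add_eq w ((deg_smul_le w _ _).trans_lt h1),
    deg_add_eq w ((deg_smul_le w _ _).trans_lt h2)⟩

lemma K3.sp {a b c a' b' c' : PR} (hK : K3 a b c) (h : Sp a' b' c' = Sp a b c) : K3 a' b' c' :=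
  hK.congr h.symm

lemma Sp_plane (a b c : PR) (α β : ℂ) : Sp (a + α • c) (b + β • c) c = Sp a b c :=
  Sp_eq (mem_Sp.mpr ⟨0, 1, 0, α, by module⟩) (mem_Sp.mpr ⟨0, 0, 1, β, by module⟩) (Sp3 _ _ _)
    (mem_Sp.mpr ⟨0, 1, 0, -α, by module⟩) (mem_Sp.mpr ⟨0, 0, 1, -β, by module⟩) (Sp3 _ _ _)

lemma K3.plane {a b c : PR} (hK : K3 a b c) (α β : ℂ) : K3 (a + α • c) (b + β • c) c :=
  hK.sp (Sp_plane a b c α β)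

lemma Sp_line (a b c : PR) (β : ℂ) : Sp a (b + β • c) c = Sp a b c := by
  simpa using Sp_plane a b c 0 β

lemma K3.line {a b c : PR} (hK : K3 a b c) (β : ℂ) : K3 a (b + β • c) c := hK.sp (Sp_line a b c β)

lemma num_a {δ x : ℝ} (h1 : δ < x) (h2 : x < 3 / 2 * δ) (i j : ℕ) : 3 * δ ≠ i * (2 * δ) + j * x := by
  intro h
  have hj0 := Nat.cast_nonneg (α := ℝ) j
  have hδ : 0 < δ := by linarith
  rcases nat4 i with rfl | rfl | rfl | rfl | hi
  · rcases nat4 j with rfl | rfl | rfl | rfl | hj <;> push_cast at * <;> nlinarith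
  · rcases nat4 j with rfl | rfl | rfl | rfl | hj <;> push_cast at * <;> nlinarith
  · push_cast at *; nlinarith
  · push_cast at *; nlinarith
  · nlinarith

lemma num_b {δ x : ℝ} (h1 : δ < x) (h2 : x < 3 / 2 * δ) (k : ℕ) : 2 * δ ≠ k * x := by
  intro h
  rcases nat4 k with rfl | rfl | rfl | rfl | hi <;> push_cast at * <;> nlinarith

lemma num_c {δ x : ℝ} (h1 : δ < x) (h2 : x < 3 / 2 * δ) (k : ℕ) : x ≠ k * (2 * δ) := by
  intro h
  rcases nat4 k with rfl | rfl | rfl | rfl | hi <;> push_cast at * <;> nlinarith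

lemma num_d {δ x : ℝ} (h1 : δ < x) (h2 : x < 3 / 2 * δ) (i j : ℕ) : 2 * δ ≠ i * x + j * (3 * δ) := by
  intro h
  have hi0 := Nat.cast_nonneg (α := ℝ) i
  rcases nat4 j with rfl | rfl | rfl | rfl | hj
  · exact num_b h1 h2 i (by push_cast at h; linarith)
  all_goals push_cast at *; nlinarith

lemma num_e {δ x : ℝ} (h1 : δ < x) (h2 : x < 3 / 2 * δ) (k : ℕ) : 3 * δ ≠ k * x := by
  intro h
  exact num_a h1 h2 0 k (by push_cast; linarith)

lemma SU6 {f g h : PR} {δ : ℝ} (hK : K3 f g h) (df : deg w f = 2 * δ) (dg : deg w g = 3 * δ)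
    (h1 : δ + Dl w f g ≤ deg w h) (h2 : deg w h < 3 / 2 * δ)
    (mn : ∀ r ∈ A2 f g, Red w (Sp f g (h + r)) → deg w h ≤ deg w (h + r))
    (hR : Red w (Sp f g h)) : False := by
  have hδ : 0 < δ := by linarith [hK.pos w]
  have hD := Dl_pos w hK.cr12
  have hT := D2 w hK
  have hgh : Dl w g h = δ + Dl w f h := by
    have a1 := D1 w hK
    have a2 := D1 w hK.swap
    rw [Dl_comm w g f] at a2
    apply le_antisymm
    · by_contra hcon
      push Not at hcon
      have := deg_le_cases (c := deg w h + Dl w f g) a1 (by linarith)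
      linarith
    · have := deg_le_cases (c := deg w h + Dl w f g) a2 (by linarith)
      linarith
  have d1 : deg w f ≠ deg w g := by intro h; linarith
  have d2 : deg w f ≠ deg w h := by intro h; linarith
  have d3 : deg w g ≠ deg w h := by intro h; linarith
  have hlow : δ < deg w h := by linarith
  rcases inv_un hK d1 d2 d3 hR with e | m | m | m | ⟨f', g', h', r', k, δ', kd, e⟩
  · exact base_irr hK d1 e (m := 3) (n := 2) (by norm_num) (by push_cast; linarith)
  · -- replace h
    obtain ⟨α, β, r, hr, hlt, hR', dr, dF, dG⟩ := m.bot (by linarith) (by linarith)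
    by_cases hz : α ≠ 0 ∨ β ≠ 0
    · have hge := Dl_plane_ge (w := w) (a := f) (b := g) (c := h) hz (by linarith) (by linarith)
      have hcr := (hK.plane α β).cr12
      rcases canc_pq (p0 := 2) (q0 := 3) (ε0 := δ) hcr hr (by norm_num) (by norm_num) (by norm_num)
        (by push_cast; linarith) (by push_cast; linarith) with h | ⟨h1, h2⟩
      · obtain ⟨k, rfl⟩ := h.const (by linarith) (by linarith)
        rw [deg_const] at dr; linarith
      · push_cast at h1
        linarith
    · push Not at hz
      obtain ⟨rfl, rfl⟩ := hz
      simp only [zero_smul, add_zero] at hr hR'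
      linarith [mn r hr hR']
  · -- replace g
    obtain ⟨r, hr, hlt, hR'⟩ := m.top (by linarith) (by linarith)
    have dr := deg_of_lt hlt
    rcases lemP4 (w := w) hK.swap23.cr12 hr with hn | ⟨k, hk, e⟩ | ⟨k, hk, e⟩ |
      ⟨p, q, ε, hp, hq, hpq, hε, e1, e2, h3, h4⟩
    · obtain ⟨i, j, hij⟩ := hn.2 (by linarith)
      rw [dr, dg, df] at hij
      exact num_a hlow h2 i j hij
    · rw [df] at e
      exact num_c hlow h2 k e
    · rw [df] at e
      exact num_b hlow h2 k e
    · -- f = p ε, h = q ε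
      have q2 : q = 2 := by
        by_contra hq2
        have : (3:ℝ) ≤ q := by exact_mod_cast (by omega : 3 ≤ q)
        have : 0 ≤ ((q:ℝ) - 3) * (p * ε) := mul_nonneg (by linarith) (by positivity)
        nlinarith
      subst q2
      have p3 : p = 3 := by
        have a1 : (p:ℝ) < 4 := by
          by_contra hcon
          push Not at hcon
          push_cast at *
          nlinarith
        have : p < 4 := by exact_mod_cast a1
        have : p ≠ 2 := by rintro rfl; norm_num at hpq
        omega
      subst p3
      push_cast at *
      exact EX2 (f := f) (b := h) (a := g) (r := r) (δ := δ / 3) hK.swap23 (by linarith) (by linarith)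
        (by linarith) (by linarith) hr hlt hR'
  · -- replace f
    obtain ⟨β, r, hr, hlt, hR', dr, dG⟩ := m.symm.mid (by linarith) (by linarith)
    have h6 : Dl w h (g + β • f) = Dl w g h := by
      rw [Dl_add_smul, Dl_comm w h g]
      rw [Dl_comm w h f, Dl_comm w h g]; linarith
    have hcr : cr h (g + β • f) ≠ 0 := by
      intro h0
      rw [Dl_zero_of w h0] at h6
      linarith [Dl_nonneg w f h]
    rcases lemPE (w := w) hcr hr with hn | ⟨k, hk, e⟩ | ⟨k, hk, e⟩ | ⟨h3, h4⟩
    · obtain ⟨i, j, hij⟩ := hn.2 (by linarith)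
      rw [dr, dG, df, dg] at hij
      exact num_d hlow h2 i j hij
    · rw [dG, dg] at e
      exact num_e hlow h2 k e
    · rw [dG, dg] at e
      have : (1:ℝ) ≤ k := by exact_mod_cast hk
      nlinarith
    · linarith
  · have kc := kd.conseq
    have e' : Sp h f g = Sp h' f' (g' + k • h' ^ 2) := by
      rw [Sp_231, e, Sp_312]
    obtain ⟨-, -, q0, q1, q2, q3⟩ := kc.transfer (y1 := h) (y2 := f) (y3 := g)
      ⟨hK.rot.rot, by linarith, by linarith⟩ e'
    have := kc.T
    have := kc.D23
    have := kc.dpos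
    have := kd.df
    have := Dl_pos w kd.K.cr12
    linarith
end


/-! Part 8 -/
set_option linter.unusedSectionVars false
set_option linter.unusedVariables false

section
variable {w : Fin 3 → ℝ} [hw : GoodW w]

lemma EX1 {f a b r : PR} {δ : ℝ} (hK : K3 f a b) (df : deg w f = 6 * δ) (da : deg w a = 9 * δ)
    (db : deg w b = 4 * δ) (hD : Dl w f b ≤ 7 * δ) (hr : r ∈ A2 f a) (hlt : deg w (b + r) < deg w b)
    (hR : Red w (Sp f a (b + r))) : False := by
  have hδ : 0 < δ := by linarith [hK.pos w]
  obtain ⟨b1, m1, R1, l1, mn⟩ := min_red (c := b) (by simpa using hr) hR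
  obtain ⟨s, rfl⟩ : ∃ s, b1 = b + s := ⟨b1 - b, by ring⟩
  rw [add_sub_cancel_left] at m1
  have ds : deg w s = 4 * δ := by rw [deg_of_lt (h := b) (by linarith), db]
  obtain ⟨c1, c2⟩ := canc23 (h := b) (δ := 3 * δ) hK.cr12 (by linarith) (by linarith) m1 (by linarith)
    (by linarith)
  have hD0 := Dl_nonneg w f a
  have hY : Dl w f (b + s) = Dl w f s := by
    rw [add_comm, Dl_add_eq w]; linarith
  have hle := Dl_le w f (b + s)
  refine SU6 (δ := 3 * δ) (hK.add m1) (by linarith) (by linarith) (by linarith) (by linarith) ?_ R1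
  intro q hq hRq
  exact mn _ (sub_add_mem (by simpa using m1) hq) hRq

lemma KF {f g h r : PR} {δ : ℝ} {c : ℂ} (hK : K3 f g h) (df : deg w f = 2 * δ) (dg : deg w g = 3 * δ)
    (dh : deg w h ≤ 3 / 2 * δ) (hr : r ∈ A2 f g) (hlt : deg w (h + r) < deg w h)
    (hR : Red w (Sp f g (h + r))) (hc : c ≠ 0) : Red w (Sp f (g + c • h ^ 2) h) := by
  obtain ⟨h1, m1, R1, l1, mn⟩ := min_red (c := h) (by simpa using hr) hR
  obtain ⟨s, rfl⟩ : ∃ s, h1 = h + s := ⟨h1 - h, by ring⟩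
  rw [add_sub_cancel_left] at m1
  rcases lt_or_ge (deg w (h + s)) (δ + Dl w f g) with h2 | h2
  · exact Red.kr f g h s c δ hK df dg dh m1 (by linarith) h2 hc R1
  · refine (SU6 (δ := δ) (hK.add m1) df dg h2 (by linarith) ?_ R1).elim
    intro q hq hRq
    exact mn _ (sub_add_mem (by simpa using m1) hq) hRq

lemma vd_sum_le {u v : Fin 3 → PR} {d : ℝ} (h1 : vd w u ≤ d) (h2 : vd w v ≤ d) : vd w (u + v) ≤ d :=
  (vd_add_le w u v).trans (max_le h1 h2)

lemma cr_exp (f g h : PR) (b0 b1 b2 C0 C1 C2 C3 c3 : ℂ) :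
    cr (b0 • 1 + b1 • h + b2 • f) (C0 • 1 + C1 • h + C2 • f + c3 • g + C3 • h ^ 2) =
      (b2 * C3) • cr f ((1:ℂ) • h ^ 2) + ((b1 * c3) • cr h g + ((b2 * C1 - b1 * C2) • cr f h
        + (b2 * c3) • cr f g)) := by
  apply cr_ext <;> simp only [Pi.add_apply, Pi.smul_apply, cr0, cr1, cr2, map_add, pow_two,
    Derivation.map_smul, E_one, smul_zero, zero_add, Derivation.leibniz, smul_eq_mul, one_smul] <;>
    simp only [smul_eq_C_mul, C_mul, C_sub] <;> ring

lemma KBfin {f g h : PR} {δ : ℝ} (hδ : 0 < δ) {a0 a1 b0 b1 b2 C0 C1 C2 C3 c3 : ℂ} {r : PR} (ha1 : a1 ≠ 0)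
    (hb2 : b2 ≠ 0) (hc3 : c3 ≠ 0) (hK : K3 f g h) (dh : deg w h = 3 * δ) (hT : 3 * δ < Dl w f h)
    (hhg : Dl w h g = Dl w f h + 2 * δ) (hfg : Dl w f g ≤ δ)
    (hD : Dl w (b0 • 1 + b1 • h + b2 • f) (C0 • 1 + C1 • h + C2 • f + c3 • g + C3 • h ^ 2) ≤ δ)
    (hr : r ∈ A2 (b0 • 1 + b1 • h + b2 • f) (C0 • 1 + C1 • h + C2 • f + c3 • g + C3 • h ^ 2))
    (hlt : deg w ((a0 • 1 + a1 • h) + r) < deg w h)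
    (hR : Red w (Sp (b0 • 1 + b1 • h + b2 • f) (C0 • 1 + C1 • h + C2 • f + c3 • g + C3 • h ^ 2)
      ((a0 • 1 + a1 • h) + r))) :
    ∃ s ∈ A2 f g, deg w (h + s) < deg w h ∧ Red w (Sp f g (h + s)) := by
  have hD' := hD
  rw [Dl, cr_exp] at hD'
  have hsq : vd w (cr f ((1:ℂ) • h ^ 2)) = deg w h + Dl w f h := Dl_sq one_ne_zero hK.swap23.cr12
  have v1 : ∀ k : ℂ, vd w (k • cr f g) ≤ δ := fun k => (vd_csmul_le _ _).trans hfg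
  have v2 : ∀ k : ℂ, vd w (k • cr f h) ≤ Dl w f h := fun k => (vd_csmul_le _ _)
  have v3 : ∀ k : ℂ, vd w (k • cr h g) ≤ Dl w h g := fun k => (vd_csmul_le _ _)
  have hC3 : C3 = 0 := by
    by_contra h0
    rw [vd_lt_add, vd_csmul w (mul_ne_zero hb2 h0), hsq] at hD'
    · linarith
    · rw [vd_csmul w (mul_ne_zero hb2 h0), hsq]
      refine lt_of_le_of_lt (b := Dl w h g) ?_ (by linarith)
      refine vd_sum_le (v3 _) (vd_sum_le ((v2 _).trans (by linarith)) ((v1 _).trans (by linarith)))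
  subst hC3
  rw [mul_zero, zero_smul, zero_add] at hD'
  have hb1 : b1 = 0 := by
    by_contra h0
    rw [vd_lt_add, vd_csmul w (mul_ne_zero h0 hc3)] at hD'
    · change Dl w h g ≤ _ at hD'; linarith
    · rw [vd_csmul w (mul_ne_zero h0 hc3)]
      change _ < Dl w h g
      refine lt_of_le_of_lt (b := Dl w f h) ?_ (by linarith)
      refine (vd_sum_le ((v2 _)) ((v1 _).trans (by linarith)))
  subst hb1
  rw [zero_mul, zero_mul, zero_smul, zero_add, sub_zero] at hD'
  have hC1 : C1 = 0 := by
    by_contra h0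
    rw [vd_lt_add, vd_csmul w (mul_ne_zero hb2 h0)] at hD'
    · change Dl w f h ≤ _ at hD'; linarith
    · rw [vd_csmul w (mul_ne_zero hb2 h0)]
      exact (v1 _).trans_lt (by change _ < Dl w f h; linarith)
  subst hC1
  have e1 : b0 • (1:PR) + (0:ℂ) • h + b2 • f = b0 • 1 + b2 • f := by module
  have e2 : C0 • (1:PR) + (0:ℂ) • h + C2 • f + c3 • g + (0:ℂ) • h ^ 2 = C0 • 1 + C2 • f + c3 • g := by
    module
  rw [e1, e2] at hr hR
  have hr' : r ∈ A2 f g := by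
    refine A2_le ?_ (A2_lin f g C0 C2 c3) hr
    have := A2_lin f g b0 b2 0
    rwa [zero_smul, add_zero] at this
  refine ⟨a1⁻¹ • (a0 • 1 + r), Subalgebra.smul_mem _ (add_mem (Subalgebra.smul_mem _ (one_mem _) _) hr') _, ?_, ?_⟩
  · have : h + a1⁻¹ • (a0 • 1 + r) = a1⁻¹ • ((a0 • 1 + a1 • h) + r) := by
      match_scalars <;> field_simp
    rw [this, deg_smul' w (inv_ne_zero ha1)]; exact hlt
  · convert hR using 1
    refine Sp_eq (mem_Sp.mpr ⟨-b2⁻¹ * b0, b2⁻¹, 0, 0, ?_⟩)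
      (mem_Sp.mpr ⟨c3⁻¹ * (C2 * b2⁻¹ * b0 - C0), - c3⁻¹ * C2 * b2⁻¹, c3⁻¹, 0, ?_⟩)
      (mem_Sp.mpr ⟨0, 0, 0, a1⁻¹, ?_⟩)
      (mem_Sp.mpr ⟨b0, b2, 0, 0, ?_⟩)
      (mem_Sp.mpr ⟨C0, C2, c3, 0, ?_⟩)
      (mem_Sp.mpr ⟨0, 0, 0, a1, ?_⟩) <;> match_scalars <;> field_simp <;> ring


lemma num_f {δ x : ℝ} (h1 : 2 * δ < x) (h3 : x ≠ 3 * δ) (hδ : 0 < δ) (i j : ℕ) :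
    3 * δ ≠ i * (4 * δ) + j * x := by
  intro h
  have hj0 := Nat.cast_nonneg (α := ℝ) j
  have hi : i = 0 := by
    by_contra hi
    have : (1:ℝ) ≤ i := by exact_mod_cast Nat.one_le_iff_ne_zero.mpr hi
    nlinarith
  subst hi
  rcases nat4 j with rfl | rfl | rfl | rfl | hj
  · push_cast at h; linarith
  · exact h3 (by push_cast at h; linarith)
  all_goals (push_cast at h; nlinarith)

lemma num_g {δ x : ℝ} (h1 : 2 * δ < x) (h3 : x ≠ 4 * δ) (hδ : 0 < δ) (i j : ℕ) :
    4 * δ ≠ i * (3 * δ) + j * x := by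
  intro h
  have hj0 := Nat.cast_nonneg (α := ℝ) j
  have hi0 := Nat.cast_nonneg (α := ℝ) i
  rcases nat4 j with rfl | rfl | rfl | rfl | hj
  · have := nat_scale hδ (x := 4) (y := i * 3) (by push_cast at *; linarith)
    omega
  · have hi : i = 0 := by
      by_contra hi
      have : (1:ℝ) ≤ i := by exact_mod_cast Nat.one_le_iff_ne_zero.mpr hi
      push_cast at h; nlinarith
    subst hi
    exact h3 (by push_cast at h; linarith)
  all_goals (push_cast at h; nlinarith)

lemma num_h {δ x : ℝ} (h1 : 2 * δ < x) (h3 : x ≠ 3 * δ) (h4 : x < 4 * δ) (hδ : 0 < δ) (i j : ℕ) :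
    x ≠ i * (4 * δ) + j * (3 * δ) := by
  intro h
  have hj0 := Nat.cast_nonneg (α := ℝ) j
  have hi : i = 0 := by
    by_contra hi
    have : (1:ℝ) ≤ i := by exact_mod_cast Nat.one_le_iff_ne_zero.mpr hi
    nlinarith
  subst hi
  rcases nat4 j with rfl | rfl | rfl | rfl | hj
  · push_cast at h; linarith
  · exact h3 (by push_cast at h; linarith)
  all_goals (push_cast at h; nlinarith)

set_option maxHeartbeats 2000000 in
lemma KB {f g h q : PR} {δ : ℝ} (hK : K3 f g h) (df : deg w f = 4 * δ) (dg : deg w g = 6 * δ)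
    (dh : deg w h = 3 * δ) (hD : Dl w f g ≤ δ) (hq : q ∈ A2 f h) (hlt : deg w (g + q) < deg w g)
    (hR : Red w (Sp f h (g + q))) :
    ∃ s ∈ A2 f g, deg w (h + s) < deg w h ∧ Red w (Sp f g (h + s)) := by
  have hδ : 0 < δ := by linarith [hK.pos w]
  obtain ⟨g1, m1, R1, l1, mn⟩ := min_red (c := g) (by simpa using hq) hR
  obtain ⟨s, rfl⟩ : ∃ s, g1 = g + s := ⟨g1 - g, by ring⟩
  rw [add_sub_cancel_left] at m1
  have ds : deg w s = 6 * δ := by rw [deg_of_lt (h := g) (by linarith), dg]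
  have hT := D2 w hK
  have hD0 := Dl_nonneg w f g
  have hn : Noncan w f h s := by
    rcases canc_pq (p0 := 4) (q0 := 3) (ε0 := δ) hK.swap23.cr12 m1 (by norm_num) (by norm_num) (by norm_num)
      (by push_cast; linarith) (by push_cast; linarith) with h | ⟨h1, h2⟩
    · exact h
    · push_cast at h1; linarith
  obtain ⟨k0, k1, k2, k3, es⟩ := hn.sq (by linarith) (by linarith) (by linarith)
  have hk3 : k3 ≠ 0 := by
    rintro rfl
    have : deg w s ≤ 4 * δ := by
      rw [es]
      refine deg_add_le' (deg_add_le' (deg_add_le' ?_ ?_) ?_) ?_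
      · rw [deg_const]; linarith
      · exact (deg_smul_le w _ _).trans (by linarith)
      · exact (deg_smul_le w _ _).trans (by linarith)
      · rw [zero_smul, deg_zero']; linarith
    linarith
  have hgh : Dl w h g = Dl w f h + 2 * δ := by
    have a1 := D1 w hK.swap23
    have a2 := D1 w hK.swap
    rw [Dl_comm w g f, Dl_comm w g h] at a2
    apply le_antisymm
    · have := a1
      by_contra hcon
      push Not at hcon
      have := deg_le_cases (c := deg w g + Dl w f h) a1 (by linarith)
      linarith
    · have := deg_le_cases (c := deg w h + Dl w f g) a2 (by linarith)
      linarith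
  have hfs : Dl w f (g + s) = 3 * δ + Dl w f h := by
    have : g + s = k3 • h ^ 2 + (k2 • h + (g + (k0 • 1 + k1 • f))) := by rw [es]; module
    have z0 : Dl w f (k0 • 1 + k1 • f) = 0 := by
      apply Dl_zero_of
      have := cr_lin f 0 1 k0 k1
      simpa using this
    have z1 : Dl w f (g + (k0 • 1 + k1 • f)) ≤ δ :=
      (Dl_add_le w _ _ _).trans (max_le hD (by linarith))
    have z2 : Dl w f (k2 • h + (g + (k0 • 1 + k1 • f))) ≤ Dl w f h :=
      (Dl_add_le w _ _ _).trans (max_le (Dl_smul_le w _ _ _) (by linarith))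
    have z3 := Dl_sq (w := w) hk3 hK.swap23.cr12
    rw [this, Dl_add_eq w, z3, dh]
    rw [z3]; linarith
  have hhs : Dl w h (g + s) = Dl w f h + 2 * δ := by
    have : cr h (g + s) = cr h (g + k1 • f) := by
      rw [es]
      simp only [cr_add, cr_smul, cr_self, smul_zero, add_zero, pow_two, cr_mul]
      have : cr h (1:PR) = 0 := by simpa using cr_C h 1
      simp [this]
    have h2 : Dl w h (g + s) = Dl w h (g + k1 • f) := by rw [Dl, this]; rfl
    rw [h2, Dl_add_smul, hgh]
    rw [hgh, Dl_comm w h f]; linarith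
  have hKx : K3 f h (g + s) := hK.swap23.add m1
  have hle := Dl_le w f (g + s)
  have ne1 : deg w (g + s) ≠ 3 * δ := by
    intro h0
    obtain ⟨c, hc, hlt'⟩ := exists_lead w (p := g + s) (q := h) (by linarith) (by linarith)
    have := mn (g + s + c • h) (sub_add_mem (by simpa using m1) (Subalgebra.smul_mem _ (A2r _ _) _)) (by
      have := Sp_lin f h (g + s) one_ne_zero 0 0 c
      rw [← this] at R1
      convert R1 using 2; module)
    linarith
  have ne2 : deg w (g + s) ≠ 4 * δ := by
    intro h0
    obtain ⟨c, hc, hlt'⟩ := exists_lead w (p := g + s) (q := f) (by linarith) (by linarith)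
    have := mn (g + s + c • f) (sub_add_mem (by simpa using m1) (Subalgebra.smul_mem _ (A2l _ _) _)) (by
      have := Sp_lin f h (g + s) one_ne_zero 0 c 0
      rw [← this] at R1
      convert R1 using 2; module)
    linarith
  obtain ⟨x, hx⟩ : ∃ x, x = g + s := ⟨_, rfl⟩
  rw [← hx] at R1 l1 hfs hhs hKx hle ne1 ne2 mn
  have lo : 2 * δ < deg w x := by linarith
  have d1 : deg w f ≠ deg w h := by intro h; linarith
  have d2 : deg w f ≠ deg w x := by rw [df]; exact ne2.symm
  have d3 : deg w h ≠ deg w x := by rw [dh]; exact ne1.symm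
  rcases inv_un hKx d1 d2 d3 R1 with e | m | m | m | ⟨f', g', h', r', k, δ', kd, e⟩
  · exact (base_irr hKx d1 e (m := 3) (n := 4) (by norm_num) (by push_cast; linarith)).elim
  · -- replace x
    exfalso
    obtain ⟨α, β, r, h1, h2, h3, h4, h5⟩ := m
    have dr := deg_of_lt h4
    by_cases hz : α ≠ 0 ∨ β ≠ 0
    · have hx4 : deg w x < 4 * δ := by
        rcases hz with hz | hz
        · linarith [h1 hz]
        · linarith [h2 hz]
      have hge := Dl_plane_ge (w := w) (a := h) (b := f) (c := x) (α := β) (β := α) hz.symm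
        (by rw [Dl_comm w h f]; linarith) (by linarith)
      rw [Dl_comm w (h + _)] at hge
      have hcr := (hKx.plane α β).cr12
      have dF : deg w (f + α • x) = 4 * δ := by
        rw [deg_add_eq w, df]; exact (deg_smul_le w _ _).trans_lt (by linarith)
      have dG : deg w (h + β • x) = 3 * δ := by
        by_cases hβ : β = 0
        · rw [hβ, zero_smul, add_zero, dh]
        · rw [deg_add_eq w, dh]; exact (deg_smul_le w _ _).trans_lt (h2 hβ)
      rcases canc_pq (p0 := 4) (q0 := 3) (ε0 := δ) hcr h3 (by norm_num) (by norm_num) (by norm_num)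
        (by push_cast; linarith) (by push_cast; linarith) with h | ⟨h1, h2⟩
      · obtain ⟨i, j, hij⟩ := h.2 (by linarith)
        rw [dr, dF, dG] at hij
        exact num_h lo ne1 hx4 hδ i j hij
      · push_cast at h1
        linarith
    · push Not at hz
      obtain ⟨rfl, rfl⟩ := hz
      simp only [zero_smul, add_zero] at h3 h5
      have := mn (x + r) (by rw [hx]; exact sub_add_mem (by simpa using m1) h3) h5
      linarith
  · -- replace h
    exfalso
    obtain ⟨α, β, r, h1, h2, h3, h4, h5⟩ := m
    have dr := deg_of_lt h4
    have dF : deg w (f + α • h) = 4 * δ := by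
      rw [deg_add_eq w, df]; exact (deg_smul_le w _ _).trans_lt (by linarith)
    have dG : deg w (x + β • h) = deg w x := by
      by_cases hβ : β = 0
      · rw [hβ, zero_smul, add_zero]
      · rw [deg_add_eq w]; exact (deg_smul_le w _ _).trans_lt (h2 hβ)
    have h6 : Dl w (f + α • h) (x + β • h) = Dl w f x := by
      apply Dl_plane
      · linarith
      · rw [Dl_comm w x h]; linarith
    have hcr := (hKx.swap23.plane α β).cr12
    rcases lemPE (w := w) hcr h3 with hn | ⟨k, hk, e⟩ | ⟨k, hk, e⟩ | ⟨h3, h4⟩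
    · obtain ⟨i, j, hij⟩ := hn.2 (by linarith)
      rw [dr, dG, dF, dh] at hij
      exact num_f lo ne1 hδ i j hij
    · rw [dG, dF] at e
      rcases nat4 k with rfl | rfl | rfl | rfl | hi
      · push_cast at e; linarith
      · exact ne2 (by push_cast at e; linarith)
      all_goals (push_cast at e; nlinarith)
    · rw [dG, dF] at e
      rcases nat4 k with rfl | rfl | rfl | rfl | hi
      · push_cast at e; linarith
      · exact ne2 (by push_cast at e; linarith)
      all_goals (push_cast at e; nlinarith)
    · rw [dG, dF] at h3 h4
      linarith
  · -- replace f
    exfalso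
    obtain ⟨α, β, r, h1, h2, h3, h4, h5⟩ := m
    have dr := deg_of_lt h4
    have hα : α = 0 := by
      by_contra hα; linarith [h1 hα]
    subst hα
    rw [zero_smul, add_zero] at h3 h5
    have dG : deg w (x + β • f) = deg w x := by
      by_cases hβ : β = 0
      · rw [hβ, zero_smul, add_zero]
      · rw [deg_add_eq w]; exact (deg_smul_le w _ _).trans_lt (h2 hβ)
    have h6 : Dl w h (x + β • f) = Dl w h x := by
      apply Dl_add_smul
      rw [Dl_comm w h f]; linarith
    have hcr : cr h (x + β • f) ≠ 0 := by
      intro h0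
      rw [Dl_zero_of w h0] at h6
      linarith
    rcases lemPE (w := w) hcr h3 with hn | ⟨k, hk, e⟩ | ⟨k, hk, e⟩ | ⟨h3, h4⟩
    · obtain ⟨i, j, hij⟩ := hn.2 (by linarith)
      rw [dr, dG, dh, df] at hij
      exact num_g lo ne2 hδ i j hij
    · rw [dG, dh] at e
      rcases nat4 k with rfl | rfl | rfl | rfl | hi
      · push_cast at e; linarith
      · exact ne1 (by push_cast at e; linarith)
      all_goals (push_cast at e; nlinarith)
    · rw [dG, dh] at e
      rcases nat4 k with rfl | rfl | rfl | rfl | hi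
      · push_cast at e; linarith
      · exact ne1 (by push_cast at e; linarith)
      all_goals (push_cast at e; nlinarith)
    · rw [dG, dh] at h3 h4
      linarith
  · have kc := kd.conseq
    have b1 := kc.D13
    have b2 := kc.D23
    have b3 := kc.dpos
    have b4 := kc.hge
    have b5 := kc.Dpos
    have hhf := Dl_comm w h f
    have hxf := Dl_comm w x f
    have hxh := Dl_comm w x h
    have fx : 4 * δ < deg w x := by
      by_contra hcon
      rcases ne1.lt_or_gt with c1 | c1
      · obtain ⟨t1, t2, t3, -⟩ := kc.transfer (y1 := x) (y2 := h) (y3 := f)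
          ⟨hKx.rot.rot.swap23, by linarith, by linarith⟩ (by rw [Sp_321, e, Sp_312])
        linarith
      · obtain ⟨t1, t2, t3, -⟩ := kc.transfer (y1 := h) (y2 := x) (y3 := f)
          ⟨hKx.rot, by linarith, by
            rw [df]; exact lt_of_le_of_ne (not_lt.mp hcon) ne2⟩ (by rw [Sp_312, e, Sp_312])
        linarith
    have hg : GB w h f x := ⟨hKx.swap, by linarith, by linarith⟩
    have ee : Sp h f x = Sp h' f' (g' + k • h' ^ 2) := by rw [Sp_213, e, Sp_312]
    obtain ⟨-, -, -, q1, q2, q3⟩ := kc.transfer hg ee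
    obtain ⟨a0, a1, ha1, eh⟩ := hg.co1 (v := h') (ee ▸ Sp1 _ _ _) q1.symm
    obtain ⟨l0, l1, l2, hl2, ef⟩ := hg.co2 (v := f') (ee ▸ Sp2 _ _ _) q2.symm
    obtain ⟨m0, m1', m2, m3, hm3, eg⟩ := hg.co3 (v := g' + k • h' ^ 2) (ee ▸ Sp3 _ _ _) q3.symm
    have eg' : g' = (m0 + m3 * k0 - k * a0 ^ 2) • 1 + (m1' + m3 * k2 - 2 * k * a0 * a1) • h
        + (m2 + m3 * k1) • f + m3 • g + (m3 * k3 - k * a1 ^ 2) • h ^ 2 := by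
      have : g' = m0 • 1 + m1' • h + m2 • f + m3 • x - k • h' ^ 2 := by rw [← eg]; ring
      rw [this, eh, hx, es]
      simp only [smul_eq_C_mul, C_add, C_sub, C_mul, C_pow]
      have : (C 2 : PR) = 2 := map_ofNat C 2
      rw [this]; ring
    have kdf := kd.df
    have kdr := kd.hr
    have kdl := kd.lt
    have kdR := kd.red
    rw [← q1] at kdl
    have hD' : Dl w f' g' ≤ δ := by linarith
    rw [ef, eg'] at hD' kdr
    rw [ef, eg', eh] at kdR
    rw [eh] at kdl
    exact KBfin hδ ha1 hl2 hm3 hK dh (by linarith) (by linarith) hD hD' kdr kdl kdR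
end


/-! Part 9 -/
set_option linter.unusedSectionVars false
set_option linter.unusedVariables false

section
variable {w : Fin 3 → ℝ} [hw : GoodW w]

lemma deg_of_le {g q : PR} (h : deg w (g + q) ≤ deg w g) : deg w q ≤ deg w g := by
  have e : q = (g + q) + (-g) := by ring
  rw [e]
  exact deg_add_le' h (by rw [deg_neg'])

lemma lead_pow {f g : PR} {k : ℕ} (hk : 0 < k) (hf : 1 ≤ deg w f) (h : deg w g = k * deg w f) :
    ∃ c : ℂ, c ≠ 0 ∧ deg w (g + c • f ^ k) < deg w g := by
  have h1 : (1:ℝ) ≤ k := by exact_mod_cast hk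
  refine exists_lead w ?_ ?_
  · rw [deg_pow' w (ne_zero_of_deg w (by linarith)), h]
  · rw [h]; nlinarith

lemma A1_pow (f : PR) (c : ℂ) (k : ℕ) : c • f ^ k ∈ A1 f :=
  Subalgebra.smul_mem _ (pow_mem (A1_mem f) k) c

lemma sq1 {ν : ℝ} (IH : IHyp w ν) {f g h r q : PR} (hK : K3 f g h) (hs : sm w f g h ≤ ν)
    (hr : r ∈ A1 f) (hlt : deg w (h + r) < deg w h) (hR : Red w (Sp f g (h + r)))
    (hq : q ∈ A2 f h) (hle : deg w (g + q) ≤ deg w g) : Red w (Sp f (g + q) h) := by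
  have hKr : K3 f g (h + r) := hK.add (A1_l g hr)
  have hq' : q ∈ A2 f (h + r) := by
    refine A2_le (A2l _ _) ?_ hq
    have := sub_mem (A2r f (h + r)) (A1_l (h + r) hr)
    rwa [add_sub_cancel_right] at this
  unfold sm at hs
  have R1 : Red w (Sp f (h + r) (g + q)) := by
    refine up IH hKr.swap23 (by simpa using hq') (by rwa [Sp_132]) ?_
    unfold sm; linarith
  refine up IH (c := h + r) ?_ (by simpa using A1_l _ hr) (by rwa [Sp_132]) ?_
  · exact (hKr.swap23.add hq').swap23
  · unfold sm; linarith

lemma sq2 {ν : ℝ} (IH : IHyp w ν) {f g h r q : PR} (hK : K3 f g h) (hs : sm w f g h ≤ ν)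
    (hr : r ∈ A2 f g) (hlt : deg w (h + r) < deg w h) (hR : Red w (Sp f g (h + r)))
    (hq : q ∈ A1 f) (hle : deg w (g + q) ≤ deg w g) : Red w (Sp f (g + q) h) := by
  have hKr : K3 f g (h + r) := hK.add hr
  have hr' : r ∈ A2 f (g + q) := by
    refine A2_le (A2l _ _) ?_ hr
    have := sub_mem (A2r f (g + q)) (A1_l (g + q) hq)
    rwa [add_sub_cancel_right] at this
  unfold sm at hs
  have R1 : Red w (Sp f (h + r) (g + q)) := by
    refine up IH hKr.swap23 (by simpa using A1_l _ hq) (by rwa [Sp_132]) ?_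
    unfold sm; linarith
  refine up IH (c := h + r) ?_ (by simpa using hr') (by rwa [Sp_132]) ?_
  · exact (hKr.swap23.add (A1_l _ hq)).swap23
  · unfold sm; linarith

structure GH (w : Fin 3 → ℝ) (ν : ℝ) (f g h r q : PR) : Prop where
  K : K3 f g h
  fg : deg w f ≠ deg w g
  fh : deg w f ≠ deg w h
  gh : deg w g ≠ deg w h
  sm : sm w f g h ≤ ν
  hr : r ∈ A2 f g
  lt : deg w (h + r) < deg w h
  R : Red w (Sp f g (h + r))
  hq : q ∈ A2 f h
  le : deg w (g + q) ≤ deg w g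

lemma GH.hf {ν : ℝ} (IH : IHyp w ν) {f g h r q : PR} (G : GH w ν f g h r q) {k : ℕ} (hk : 0 < k)
    (e : deg w h = k * deg w f) : Red w (Sp f (g + q) h) := by
  obtain ⟨c, hc, hlt⟩ := lead_pow hk (G.K.pos w) e
  have hs := G.sm
  unfold _root_.sm at hs
  refine sq1 IH G.K G.sm (A1_pow f c k) hlt ?_ G.hq G.le
  refine up IH (G.K.add G.hr) ?_ G.R ?_
  · have : h + c • f ^ k - (h + r) = c • f ^ k - r := by ring
    rw [this]
    exact sub_mem (A1_l _ (A1_pow f c k)) G.hr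
  · have := G.lt
    unfold _root_.sm; linarith

lemma GH.gf {ν : ℝ} (IH : IHyp w ν) {f g h r q : PR} (G : GH w ν f g h r q) {k : ℕ} (hk : 0 < k)
    (e : deg w g = k * deg w f) : Red w (Sp f (g + q) h) := by
  obtain ⟨c, hc, hlt⟩ := lead_pow hk (G.K.pos w) e
  have hs := G.sm
  unfold _root_.sm at hs
  have R1 := sq2 IH G.K G.sm G.hr G.lt G.R (A1_pow f c k) hlt.le
  rw [Sp_132]
  refine up IH (c := g + c • f ^ k) (G.K.swap23.add (A1_l _ (A1_pow f c k))) ?_ (by rwa [Sp_132]) ?_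
  · have : g + q - (g + c • f ^ k) = q - c • f ^ k := by ring
    rw [this]
    exact sub_mem G.hq (A1_l _ (A1_pow f c k))
  · unfold _root_.sm; linarith

lemma numPQ {p q : ℕ} (hp : 2 ≤ p) (hq : 2 ≤ q) (hc : Nat.Coprime p q) {ε : ℝ} (hε : 0 < ε)
    (h : ((p:ℝ) * q - p - q) * ε < q * ε) : (p = 2 ∧ 3 ≤ q ∧ q % 2 = 1) ∨ (p = 3 ∧ q = 2) := by
  have h1 : (p:ℝ) * q - p - q < q := lt_of_mul_lt_mul_right h hε.le
  have h2 : p * q < 2 * q + p := by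
    have : (p:ℝ) * q < 2 * q + p := by linarith
    exact_mod_cast this
  rcases Nat.lt_or_ge p 3 with h3 | h3
  · left
    have : p = 2 := by omega
    subst this
    have : q % 2 = 1 := Nat.odd_iff.mp ((Nat.coprime_two_left).mp hc)
    omega
  · right
    have hq3 : q < 3 := by
      by_contra hcon
      push Not at hcon
      obtain ⟨a, rfl⟩ := Nat.exists_eq_add_of_le h3
      obtain ⟨b, rfl⟩ := Nat.exists_eq_add_of_le hcon
      nlinarith
    have : q = 2 := by omega
    subst this
    constructor <;> omega

lemma numHalf {p q : ℕ} (hp : 2 ≤ p) (hq : 2 ≤ q) {ε D g : ℝ} (hε : 0 < ε) (hD : 0 < D) (h0 : q * ε < g ∨ q * ε ≤ g)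
    (hg : 2 * g ≤ p * ε)
    (h : ((p:ℝ) * q - p - q) * ε + D ≤ g) : False := by
  have h0' : q * ε ≤ g := by rcases h0 with h | h <;> linarith
  have hq' : (2:ℝ) ≤ q := by exact_mod_cast hq
  have hp' : (2:ℝ) ≤ p := by exact_mod_cast hp
  have : (p:ℝ) * q - p ≥ p := by nlinarith
  nlinarith

lemma nat_ge2 {k : ℕ} (hk : 0 < k) (h : k ≠ 1) : (2:ℝ) ≤ k := by
  have : 2 ≤ k := by omega
  exact_mod_cast this

lemma GH.c1q {ν : ℝ} (IH : IHyp w ν) {f g h r q : PR} (G : GH w ν f g h r q) (hgh : deg w g < deg w h)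
    {k : ℕ} (hk : 0 < k) (e : deg w f = k * deg w h) : Red w (Sp f (g + q) h) := by
  have hf := G.K.pos w
  have hg := G.K.rot.pos w
  have hh := G.K.rot.rot.pos w
  have hk2 : (2:ℝ) ≤ k := nat_ge2 hk (by
    rintro rfl; exact G.fh (by push_cast at e; linarith))
  have hhf : 2 * deg w h ≤ deg w f := by nlinarith
  have hs := G.sm
  unfold _root_.sm at hs
  have hs' : _root_.sm w g f h ≤ ν := by unfold _root_.sm; linarith
  have hs'' : _root_.sm w h g f ≤ ν := by unfold _root_.sm; linarith
  have dr := deg_of_lt G.lt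
  obtain ⟨c, hc, hlt⟩ := lead_pow hk hh e
  have hq : q ∈ A2 h f := by rw [A2_comm]; exact G.hq
  have hr : r ∈ A2 g f := by rw [A2_comm]; exact G.hr
  have hR : Red w (Sp g f (h + r)) := by rw [Sp_213]; exact G.R
  suffices R1 : Red w (Sp g (f + c • h ^ k) h) by
    have := sq1 IH (f := h) (g := g) (h := f) (r := c • h ^ k) (q := q) G.K.rot.rot.swap23 hs''
      (A1_pow _ _ _) hlt (by rwa [Sp_312] at R1) hq G.le
    rwa [Sp_321] at this
  rcases lemP4 (w := w) G.K.cr12 G.hr with hn | ⟨j, hj, e'⟩ | ⟨j, hj, e'⟩ | ⟨p', q', ε, hp', hq', hcop, hε, e1, e2, e3, -⟩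
  · have := hn.A1' (by linarith)
    exact sq1 IH (f := g) (g := f) (h := h) G.K.swap hs' this G.lt hR (A1_r _ (A1_pow h c k)) hlt.le
  · have : (1:ℝ) ≤ j := by exact_mod_cast hj
    nlinarith
  · obtain ⟨c', hc', hlt'⟩ := lead_pow hj hg e'
    have R3 := sq2 IH (f := g) (g := f) (h := h) G.K.swap hs' hr G.lt hR (A1_pow g c' j) hlt'.le
    rw [Sp_132]
    refine up IH (c := f + c' • g ^ j) ?_ ?_ (by rwa [Sp_132]) ?_
    · exact (G.K.rot.add (A1_l _ (A1_pow g c' j)))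
    · have : f + c • h ^ k - (f + c' • g ^ j) = c • h ^ k - c' • g ^ j := by ring
      rw [this]
      exact sub_mem (A1_r _ (A1_pow _ _ _)) (A1_l _ (A1_pow _ _ _))
    · unfold _root_.sm; linarith
  · exact (numHalf (g := deg w h) (D := Dl w f g) hp' hq' hε (by linarith [Dl_pos w G.K.cr12]) (Or.inl (by linarith)) (by linarith)
      (by linarith)).elim

lemma GH.c2q {ν : ℝ} (IH : IHyp w ν) {f g h r q : PR} (G : GH w ν f g h r q) (hgh : deg w h < deg w g)
    {k : ℕ} (hk : 0 < k) (e : deg w f = k * deg w g) : Red w (Sp f (g + q) h) := by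
  have hf := G.K.pos w
  have hg := G.K.rot.pos w
  have hh := G.K.rot.rot.pos w
  have hk2 : (2:ℝ) ≤ k := nat_ge2 hk (by
    rintro rfl; exact G.fg (by push_cast at e; linarith))
  have hhf : 2 * deg w g ≤ deg w f := by nlinarith
  have hs := G.sm
  unfold _root_.sm at hs
  have hs' : _root_.sm w g f h ≤ ν := by unfold _root_.sm; linarith
  have hs'' : _root_.sm w h g f ≤ ν := by unfold _root_.sm; linarith
  have dq := deg_of_le G.le
  obtain ⟨c, hc, hlt⟩ := lead_pow hk hg e
  have hq : q ∈ A2 h f := by rw [A2_comm]; exact G.hq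
  have hr : r ∈ A2 g f := by rw [A2_comm]; exact G.hr
  have hR : Red w (Sp g f (h + r)) := by rw [Sp_213]; exact G.R
  have R1 := sq2 IH (f := g) (g := f) (h := h) G.K.swap hs' hr G.lt hR (A1_pow g c k) hlt.le
  have R1' : Red w (Sp h g (f + c • g ^ k)) := by rwa [Sp_312] at R1
  rw [Sp_321]
  have hcr : cr f h ≠ 0 := G.K.swap23.cr12
  rcases lemP4 (w := w) hcr G.hq with hn | ⟨j, hj, e'⟩ | ⟨j, hj, e'⟩ | ⟨p', q', ε, hp', hq', hcop, hε, e1, e2, e3, -⟩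
  · have := hn.A1' (by linarith)
    exact sq2 IH (f := h) (g := g) (h := f) G.K.rot.rot.swap23 hs'' (A1_r _ (A1_pow g c k)) hlt R1' this G.le
  · have : (1:ℝ) ≤ j := by exact_mod_cast hj
    nlinarith
  · obtain ⟨c', hc', hlt'⟩ := lead_pow hj hh e'
    refine sq1 IH (f := h) (g := g) (h := f) G.K.rot.rot.swap23 hs'' (A1_pow h c' j) hlt' ?_ hq G.le
    refine up IH (c := f + c • g ^ k) ?_ ?_ R1' ?_
    · exact G.K.rot.rot.swap23.add (A1_r _ (A1_pow g c k))
    · have : f + c' • h ^ j - (f + c • g ^ k) = c' • h ^ j - c • g ^ k := by ring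
      rw [this]
      exact sub_mem (A1_l _ (A1_pow _ _ _)) (A1_r _ (A1_pow _ _ _))
    · unfold _root_.sm; linarith
  · exact (numHalf (g := deg w g) (D := Dl w f h) hp' hq' hε (by linarith [Dl_pos w hcr]) (Or.inl (by linarith)) (by linarith)
      (by linarith)).elim

end


/-! Part 10 -/
set_option linter.unusedSectionVars false
set_option linter.unusedVariables false

section
variable {w : Fin 3 → ℝ} [hw : GoodW w]

/-- representation of `s δ` by `2δ` and `g` with `(s-2)δ < g < sδ`. -/
lemma num1a {s : ℕ} {δ g : ℝ} (hδ : 0 < δ) (hs : 3 ≤ s) (hodd : s % 2 = 1) (h1 : (s - 2) * δ < g)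
    (h2 : g < s * δ) (i j : ℕ) (h : s * δ = i * (2 * δ) + j * g) : s = 3 ∧ 2 * g = 3 * δ := by
  have hi0 := Nat.cast_nonneg (α := ℝ) i
  have hs3 : (3:ℝ) ≤ s := by exact_mod_cast hs
  have hg : δ < g := by nlinarith
  rcases nat4 j with rfl | rfl | rfl | rfl | hj
  · have := nat_scale hδ (x := s) (y := 2 * i) (by push_cast at *; linarith)
    omega
  · rcases Nat.eq_zero_or_pos i with rfl | hi
    · push_cast at h; linarith
    · have : (1:ℝ) ≤ i := by exact_mod_cast hi
      push_cast at h; nlinarith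
  · have hs' : s = 3 := by
      by_contra hne
      have : (4:ℝ) ≤ s := by
        have : 4 ≤ s := by omega
        exact_mod_cast this
      push_cast at h; nlinarith
    subst hs'
    refine ⟨rfl, ?_⟩
    rcases Nat.eq_zero_or_pos i with rfl | hi
    · push_cast at h; linarith
    · have : (1:ℝ) ≤ i := by exact_mod_cast hi
      push_cast at h; nlinarith
  · exfalso
    push_cast at h; nlinarith
  · exfalso
    have : 4 * ((s - 2) * δ) ≤ j * g := by nlinarith
    nlinarith

lemma num1k {s : ℕ} {δ g : ℝ} (hδ : 0 < δ) (hs : 3 ≤ s) (h1 : (s - 2) * δ < g) (hne : 2 * δ ≠ g)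
    (k : ℕ) (h : 2 * δ = k * g) : False := by
  have hs3 : (3:ℝ) ≤ s := by exact_mod_cast hs
  have hg : δ < g := by nlinarith
  rcases nat4 k with rfl | rfl | rfl | rfl | hj
  · push_cast at h; linarith
  · exact hne (by push_cast at h; linarith)
  all_goals (push_cast at h; nlinarith)

lemma num1c {s p q : ℕ} {δ g ε : ℝ} (hδ : 0 < δ) (hs : 3 ≤ s) (hodd : s % 2 = 1) (h1 : (s - 2) * δ < g)
    (h2 : g < s * δ) (hε : 0 < ε) (hp : 2 ≤ p) (hq : 2 ≤ q) (hc : Nat.Coprime p q) (e1 : 2 * δ = p * ε)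
    (e2 : g = q * ε) (h : ((p:ℝ) * q - p - q) * ε < q * ε) :
    s = 3 ∧ 3 * g = 4 * δ ∧ p = 3 ∧ q = 2 ∧ 3 * ε = 2 * δ := by
  have hs3 : (3:ℝ) ≤ s := by exact_mod_cast hs
  rcases numPQ hp hq hc hε h with ⟨rfl, h3, h4⟩ | ⟨rfl, rfl⟩
  · have : ε = δ := by push_cast at e1; linarith
    subst this
    have a1 : (q:ℝ) < s := by
      rw [e2] at h2; exact lt_of_mul_lt_mul_right h2 hδ.le
    have a2 : (s:ℝ) - 2 < q := by
      rw [e2] at h1; exact lt_of_mul_lt_mul_right h1 hδ.le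
    have a1' : q < s := by exact_mod_cast a1
    have a2' : s < q + 2 := by
      have : (s:ℝ) < q + 2 := by linarith
      exact_mod_cast this
    omega
  · push_cast at e1 e2
    have hs' : s = 3 := by
      by_contra hne
      have : (4:ℝ) ≤ s := by
        have : 4 ≤ s := by omega
        exact_mod_cast this
      nlinarith
    exact ⟨hs', by linarith, rfl, rfl, by linarith⟩

lemma num1b {δ g : ℝ} (hδ : 0 < δ) (h1 : δ < g) (h2 : g < 2 * δ) (k : ℕ) (h : 3 * δ = k * g) :
    k = 2 := by
  rcases nat4 k with rfl | rfl | rfl | rfl | hj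
  · push_cast at h; linarith
  · push_cast at h; linarith
  · rfl
  · push_cast at h; linarith
  · nlinarith

lemma num1bn {δ g : ℝ} (hδ : 0 < δ) (h1 : δ < g) (h2 : g < 2 * δ) (i j : ℕ)
    (h : 2 * δ = i * (3 * δ) + j * g) : False := by
  have hi0 := Nat.cast_nonneg (α := ℝ) i
  have hj0 := Nat.cast_nonneg (α := ℝ) j
  rcases Nat.eq_zero_or_pos i with rfl | hi
  · rcases nat4 j with rfl | rfl | rfl | rfl | hj
    · push_cast at h; linarith
    · push_cast at h; linarith
    · push_cast at h; linarith
    · push_cast at h; linarith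
    · push_cast at h; nlinarith
  · have : (1:ℝ) ≤ i := by exact_mod_cast hi
    nlinarith

lemma GH.upq {ν : ℝ} (IH : IHyp w ν) {f g h r q : PR} (G : GH w ν f g h r q) {s : PR}
    (hs : s ∈ A2 f h) (hlt : deg w (g + s) < deg w g) (hR : Red w (Sp f h (g + s))) :
    Red w (Sp f (g + q) h) := by
  have hsm := G.sm
  unfold _root_.sm at hsm
  rw [Sp_132]
  refine up IH (c := g + s) (G.K.swap23.add hs) ?_ hR ?_
  · have : g + q - (g + s) = q - s := by ring
    rw [this]; exact sub_mem G.hq hs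
  · unfold _root_.sm; linarith

lemma GH.c1a {ν : ℝ} (IH : IHyp w ν) {f g h r q : PR} (G : GH w ν f g h r q) {s : ℕ} {δ : ℝ}
    (hδ : 0 < δ) (df : deg w f = 2 * δ) (dh : deg w h = s * δ) (hs : 3 ≤ s) (hodd : s % 2 = 1)
    (hgh : deg w g < deg w h) (hge : (s - 2) * δ + Dl w f h ≤ deg w g) : Red w (Sp f (g + q) h) := by
  have dr := deg_of_lt G.lt
  have hD := Dl_pos w G.K.swap23.cr12
  rcases lemP4 (w := w) G.K.cr12 G.hr with hn | ⟨j, hj, e'⟩ | ⟨j, hj, e'⟩ | ⟨p', q', ε, hp', hq', hcop, hε, e1, e2, e3, -⟩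
  · obtain ⟨i, j, e⟩ := hn.2 (by rw [dr, dh]; positivity)
    rw [dr, df, dh] at e
    obtain ⟨rfl, hg⟩ := num1a hδ hs hodd (by linarith) (by linarith) i j e
    push_cast at *
    obtain ⟨t, ht, hlt, hR⟩ := KB (w := w) (f := f) (g := h) (h := g) (q := r) (δ := δ / 2) G.K.swap23 (by linarith) (by linarith)
      (by linarith) (by linarith) G.hr G.lt G.R
    exact G.upq IH ht hlt hR
  · exact G.gf IH hj e'
  · rw [df] at e'
    exact (num1k hδ hs (by linarith) (by rw [← df]; exact G.fg) j e').elim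
  · have := D2 w G.K
    have hlt : ((p':ℝ) * q' - p' - q') * ε < q' * ε := by linarith
    obtain ⟨rfl, hg, rfl, rfl, hε'⟩ := num1c hδ hs hodd (g := deg w g) (by linarith) (by linarith) hε hp' hq' hcop (by linarith)
      (by linarith) hlt
    push_cast at *
    exact (EX2 (w := w) (f := f) (b := g) (a := h) (δ := δ / 3) G.K (by linarith) (by linarith) (by linarith)
      (by linarith) G.hr G.lt G.R).elim

lemma GH.c1b {ν : ℝ} (IH : IHyp w ν) {f g h r q : PR} (G : GH w ν f g h r q) {δ : ℝ}
    (hδ : 0 < δ) (df : deg w f = 3 * δ) (dh : deg w h = 2 * δ)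
    (hgh : deg w g < deg w h) (hge : δ + Dl w f h ≤ deg w g) : Red w (Sp f (g + q) h) := by
  have dr := deg_of_lt G.lt
  have hD := Dl_pos w G.K.swap23.cr12
  rcases lemP4 (w := w) G.K.cr12 G.hr with hn | ⟨j, hj, e'⟩ | ⟨j, hj, e'⟩ | ⟨p', q', ε, hp', hq', hcop, hε, e1, e2, e3, -⟩
  · obtain ⟨i, j, e⟩ := hn.2 (by rw [dr, dh]; positivity)
    rw [dr, df, dh] at e
    exact (num1bn hδ (by linarith) (by linarith) i j e).elim
  · exact G.gf IH hj e'
  · rw [df] at e'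
    have := num1b hδ (by linarith) (by linarith) j e'
    subst this
    push_cast at e'
    obtain ⟨c, hc, hlt⟩ := lead_pow (f := g) (g := f) (k := 2) (by norm_num) (G.K.rot.pos w) (by push_cast; linarith)
    have hsm := G.sm
    unfold _root_.sm at hsm
    have R3 := sq2 IH (f := g) (g := f) (h := h) (ν := ν) G.K.swap (by unfold _root_.sm; linarith)
      (by rw [A2_comm]; exact G.hr) G.lt (by rw [Sp_213]; exact G.R) (A1_pow g c 2) hlt.le
    obtain ⟨t, ht, hlt', hR⟩ := KB (w := w) (f := h) (g := f) (h := g) (q := c • g ^ 2) (δ := δ / 2)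
      G.K.rot.rot (by linarith) (by linarith) (by linarith) (by rw [Dl_comm]; linarith)
      (A1_r _ (A1_pow g c 2)) hlt (by rwa [Sp_132, Sp_213] at R3)
    exact G.upq IH (by rwa [A2_comm]) hlt' (by rwa [Sp_213])
  · have := D2 w G.K
    have : (0:ℝ) ≤ ((p':ℝ) * q' - p' - q') := by
      have : (2:ℝ) ≤ p' := by exact_mod_cast hp'
      have : (2:ℝ) ≤ q' := by exact_mod_cast hq'
      nlinarith
    have : 0 ≤ ((p':ℝ) * q' - p' - q') * ε := by positivity
    linarith

lemma GH.lin {ν : ℝ} (IH : IHyp w ν) {f g h r q : PR} (G : GH w ν f g h r q) (hgh : deg w h < deg w g)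
    {k : ℂ} (hq : q - k • h ∈ A1 f) : Red w (Sp f (g + q) h) := by
  have := sq2 IH G.K G.sm G.hr G.lt G.R hq (by
    have : g + (q - k • h) = (g + q) + (-k) • h := by module
    rw [this]
    exact deg_add_le' G.le ((deg_smul_le w _ _).trans hgh.le))
  rw [← Sp_line f _ h k] at this
  convert this using 2
  module

lemma GH.c2a {ν : ℝ} (IH : IHyp w ν) {f g h r q : PR} (G : GH w ν f g h r q) {s : ℕ} {δ : ℝ}
    (hδ : 0 < δ) (df : deg w f = 2 * δ) (dg : deg w g = s * δ) (hs : 3 ≤ s) (hodd : s % 2 = 1)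
    (hgh : deg w h < deg w g) (hge : (s - 2) * δ + Dl w f g ≤ deg w h) : Red w (Sp f (g + q) h) := by
  have dq := deg_of_le G.le
  have hD := Dl_pos w G.K.cr12
  have hs3 : (3:ℝ) ≤ s := by exact_mod_cast hs
  rcases lemP4 (w := w) G.K.swap23.cr12 G.hq with hn | ⟨j, hj, e'⟩ | ⟨j, hj, e'⟩ | ⟨p', q', ε, hp', hq', hcop, hε, e1, e2, e3, -⟩
  · rcases lt_or_ge (deg w q) (2 * deg w h) with h2 | h2
    · obtain ⟨k, hk⟩ := hn.split h2 (by linarith)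
      exact G.lin IH hgh hk
    · have hs' : s = 3 := by
        by_contra hne
        have : (4:ℝ) ≤ s := by
          have : 4 ≤ s := by omega
          exact_mod_cast this
        nlinarith
      subst hs'
      push_cast at *
      obtain ⟨k0, k1, k2, k3, es⟩ := hn.sq (by linarith) (by linarith) (by linarith)
      by_cases hk3 : k3 = 0
      · refine G.lin IH hgh (k := k2) ?_
        have : q - k2 • h = k0 • 1 + k1 • f := by rw [es, hk3]; module
        rw [this]
        exact add_mem (Subalgebra.smul_mem _ (one_mem _) _) (Subalgebra.smul_mem _ (A1_mem f) _)
      · have := KF (w := w) G.K df dg (by linarith) G.hr G.lt G.R hk3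
        rw [Sp_132, ← Sp_lin f h _ one_ne_zero k0 k1 k2] at this
        rw [Sp_132]
        convert this using 2
        rw [es]; module
  · exact G.hf IH hj e'
  · rw [df] at e'
    exact (num1k hδ hs (by linarith) (by rw [← df]; exact G.fh) j e').elim
  · have := D2 w G.K
    have hlt : ((p':ℝ) * q' - p' - q') * ε < q' * ε := by linarith
    obtain ⟨rfl, hg, rfl, rfl, hε'⟩ := num1c hδ hs hodd (g := deg w h) (by linarith) (by linarith) hε hp' hq' hcop (by linarith)
      (by linarith) hlt
    push_cast at *
    exact (EX1 (w := w) (f := f) (a := g) (b := h) (δ := δ / 3) G.K (by linarith) (by linarith) (by linarith)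
      (by linarith) G.hr G.lt G.R).elim

lemma GH.c2b {ν : ℝ} (IH : IHyp w ν) {f g h r q : PR} (G : GH w ν f g h r q) {δ : ℝ}
    (hδ : 0 < δ) (df : deg w f = 3 * δ) (dg : deg w g = 2 * δ)
    (hgh : deg w h < deg w g) (hge : δ + Dl w f g ≤ deg w h) : Red w (Sp f (g + q) h) := by
  have dq := deg_of_le G.le
  have hD := Dl_pos w G.K.cr12
  rcases lemP4 (w := w) G.K.swap23.cr12 G.hq with hn | ⟨j, hj, e'⟩ | ⟨j, hj, e'⟩ | ⟨p', q', ε, hp', hq', hcop, hε, e1, e2, e3, -⟩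
  · obtain ⟨k, hk⟩ := hn.split (by linarith) (by linarith)
    exact G.lin IH hgh hk
  · exact G.hf IH hj e'
  · rw [df] at e'
    have := num1b hδ (by linarith) (by linarith) j e'
    subst this
    push_cast at e'
    obtain ⟨c, hc, hlt⟩ := lead_pow (f := h) (g := f) (k := 2) (by norm_num) (G.K.rot.rot.pos w) (by push_cast; linarith)
    have hsm := G.sm
    unfold _root_.sm at hsm
    have R3 := KF (w := w) (f := g) (g := f) (h := h) (δ := δ) G.K.swap (by linarith) (by linarith) (by linarith)
      (by rw [A2_comm]; exact G.hr) G.lt (by rw [Sp_213]; exact G.R) hc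
    rw [Sp_321]
    exact sq1 IH (f := h) (g := g) (h := f) (ν := ν) G.K.rot.rot.swap23 (by unfold _root_.sm; linarith)
      (A1_pow h c 2) hlt (by rwa [Sp_312] at R3) (by rw [A2_comm]; exact G.hq) G.le
  · have := D2 w G.K
    have : (0:ℝ) ≤ ((p':ℝ) * q' - p' - q') := by
      have : (2:ℝ) ≤ p' := by exact_mod_cast hp'
      have : (2:ℝ) ≤ q' := by exact_mod_cast hq'
      nlinarith
    have : 0 ≤ ((p':ℝ) * q' - p' - q') * ε := by positivity
    linarith

theorem GH.gen {ν : ℝ} (IH : IHyp w ν) {f g h r q : PR} (G : GH w ν f g h r q) :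
    Red w (Sp f (g + q) h) := by
  have dr := deg_of_lt G.lt
  have dq := deg_of_le G.le
  rcases G.gh.lt_or_gt with hgh | hgh
  · have hD := Dl_pos w G.K.swap23.cr12
    rcases lemP4 (w := w) G.K.swap23.cr12 G.hq with hn | ⟨j, hj, e'⟩ | ⟨j, hj, e'⟩ | ⟨p', q', ε, hp', hq', hcop, hε, e1, e2, e3, -⟩
    · exact sq2 IH G.K G.sm G.hr G.lt G.R (hn.A1 (by linarith)) G.le
    · exact G.hf IH hj e'
    · exact G.c1q IH hgh hj e'
    · rcases numPQ hp' hq' hcop hε (by linarith) with ⟨rfl, h3, h4⟩ | ⟨rfl, rfl⟩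
      · push_cast at e1 e3
        refine G.c1a IH hε e1 e2 h3 h4 hgh ?_
        have : ((2:ℝ) * q' - 2 - q') = q' - 2 := by ring
        rw [this] at e3; linarith
      · push_cast at e1 e2 e3
        exact G.c1b IH hε e1 e2 hgh (by linarith)
  · have hD := Dl_pos w G.K.cr12
    rcases lemP4 (w := w) G.K.cr12 G.hr with hn | ⟨j, hj, e'⟩ | ⟨j, hj, e'⟩ | ⟨p', q', ε, hp', hq', hcop, hε, e1, e2, e3, -⟩
    · exact sq1 IH G.K G.sm (hn.A1 (by linarith)) G.lt G.R G.hq G.le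
    · exact G.gf IH hj e'
    · exact G.c2q IH hgh hj e'
    · rcases numPQ hp' hq' hcop hε (by linarith) with ⟨rfl, h3, h4⟩ | ⟨rfl, rfl⟩
      · push_cast at e1 e3
        refine G.c2a IH hε e1 e2 h3 h4 hgh ?_
        have : ((2:ℝ) * q' - 2 - q') = q' - 2 := by ring
        rw [this] at e3; linarith
      · push_cast at e1 e2 e3
        exact G.c2b IH hε e1 e2 hgh (by linarith)
end


/-! Part 11 -/
set_option linter.unusedSectionVars false
set_option linter.unusedVariables false

section
variable {w : Fin 3 → ℝ} [hw : GoodW w]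

lemma deg_pert {a b : PR} (k : ℂ) (h : deg w b < deg w a) : deg w (a + k • b) = deg w a :=
  deg_add_eq w ((deg_smul_le w _ _).trans_lt h)

/-- the exceptional configuration in the middle-position case -/
lemma AX {f g x : PR} {s : ℕ} {δ : ℝ} (hδ : 0 < δ) (hK : K3 f g x) (df : deg w f = 2 * δ)
    (dg : deg w g = s * δ) (hs : 3 ≤ s) (hodd : s % 2 = 1) (hx : deg w x < s * δ)
    (hY : s * δ + Dl w f g ≤ Dl w f x)
    (mn : ∀ r ∈ A2 f g, deg w x ≤ deg w (x + r))
    (hR : Red w (Sp f g x)) : False := by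
  have hs3 : (3:ℝ) ≤ s := by exact_mod_cast hs
  have hD := Dl_pos w hK.cr12
  have hYle := Dl_le w f x
  have lo : (s - 2) * δ < deg w x := by linarith
  have hsc : 3 * δ ≤ s * δ := by nlinarith
  have hlow : δ < deg w x := by linarith
  -- x is not a multiple of f
  have nk : ∀ k : ℕ, deg w x ≠ k * deg w f := by
    intro k e
    have hk : 0 < k := by
      rcases Nat.eq_zero_or_pos k with rfl | h
      · push_cast at e; linarith
      · exact h
    obtain ⟨c, hc, hlt⟩ := lead_pow hk (hK.pos w) e
    have := mn (c • f ^ k) (A1_l _ (A1_pow f c k))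
    linarith
  have d1 : deg w f ≠ deg w g := by intro h; linarith
  have d2 : deg w f ≠ deg w x := by intro h; exact nk 1 (by push_cast; linarith)
  have d3 : deg w g ≠ deg w x := by intro h; linarith
  have hxg : Dl w g x = (s - 2) * δ + Dl w f x := by
    have a1 := D1 w hK
    have a2 := D1 w hK.rot.rot.swap
    have a3 := D1 w hK.swap
    rw [Dl_comm w g f] at a3
    apply le_antisymm
    · have := deg_le_cases (c := deg w x + Dl w f g) a1
      by_contra hcon
      push Not at hcon
      have := this (by linarith)
      linarith
    · have := deg_le_cases (c := deg w x + Dl w f g) a3 (by linarith)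
      linarith
  have cfg := Dl_comm w g f
  have cxf := Dl_comm w x f
  have cxg := Dl_comm w x g
  rcases inv_un hK d1 d2 d3 hR with e | m | m | m | ⟨f', g', h', r', k, δ', kd, e⟩
  · exact base_irr hK d1 e (m := s) (n := 2) (by omega) (by rw [df, dg]; push_cast; ring)
  · -- replace x
    obtain ⟨α, β, r, h1, h2, h3, h4, h5⟩ := m
    have dr := deg_of_lt h4
    by_cases hz : α ≠ 0 ∨ β ≠ 0
    · have hge := Dl_plane_ge (w := w) (a := f) (b := g) (c := x) (α := α) (β := β) hz
        (by linarith) (by linarith)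
      have hcr := (hK.plane α β).cr12
      have dF : deg w (f + α • x) = (2:ℕ) * δ := by
        by_cases hα : α = 0
        · rw [hα, zero_smul, add_zero, df]; push_cast; ring
        · rw [deg_pert _ (h1 hα), df]; push_cast; ring
      have dG : deg w (g + β • x) = s * δ := by
        rw [deg_pert _ (by linarith), dg]
      rcases canc_pq hcr h3 le_rfl (by omega) (Nat.coprime_two_left.mpr (Nat.odd_iff.mpr hodd)) dF dG with h | ⟨h1, -⟩
      · obtain ⟨i, j, hij⟩ := h.2 (by linarith)
        rw [dr, dF, dG] at hij
        rcases Nat.eq_zero_or_pos j with rfl | hj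
        · exact nk i (by rw [hij, df]; push_cast; ring)
        · have hj' : (1:ℝ) ≤ j := by exact_mod_cast hj
          have hi' := Nat.cast_nonneg (α := ℝ) i
          have : s * δ ≤ j * (s * δ) := by nlinarith
          have : 0 ≤ i * ((2:ℕ) * δ) := by positivity
          linarith
      · push_cast at h1
        have : (2 * (s:ℝ) - 2 - s) = s - 2 := by ring
        rw [this] at h1
        linarith
    · push Not at hz
      obtain ⟨rfl, rfl⟩ := hz
      simp only [zero_smul, add_zero] at h3 h5
      linarith [mn r h3]
  · -- replace g
    obtain ⟨r, h3, h4, h5⟩ := m.top (by linarith) (by linarith)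
    have dr := deg_of_lt h4
    rcases lemPE (w := w) hK.swap23.cr12 h3 with hn | ⟨k, hk, e⟩ | ⟨k, hk, e⟩ | ⟨h3', h4'⟩
    · obtain ⟨i, j, hij⟩ := hn.2 (by linarith)
      rw [dr, df, dg] at hij
      obtain ⟨rfl, hx'⟩ := num1a hδ hs hodd lo hx i j hij
      push_cast at *
      obtain ⟨t, ht, hlt, -⟩ := KB (w := w) (f := f) (g := g) (h := x) (q := r) (δ := δ / 2) hK
        (by linarith) (by linarith) (by linarith) (by linarith) h3 h4 h5
      linarith [mn t ht]
    · exact nk k e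
    · rw [df] at e
      exact num1k hδ hs lo (by rw [← df]; exact d2) k e
    · linarith
  · -- replace f
    obtain ⟨α, β, r, h1, h2, h3, h4, h5⟩ := m
    have dr := deg_of_lt h4
    have hcr : cr (g + α • f) (x + β • f) ≠ 0 := (hK.rot.plane α β).cr12
    have dF : deg w (g + α • f) = s * δ := by
      rw [deg_pert _ (by linarith), dg]
    have dG : deg w (x + β • f) = deg w x := by
      by_cases hβ : β = 0
      · rw [hβ, zero_smul, add_zero]
      · rw [deg_pert _ (h2 hβ)]
    have h6 : Dl w (g + α • f) (x + β • f) = Dl w g x := by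
      apply Dl_plane <;> linarith
    have key : ∀ hn : Noncan w (g + α • f) (x + β • f) r, False := by
      intro hn
      obtain ⟨i, j, hij⟩ := hn.2 (by linarith)
      rw [dr, dF, dG, df] at hij
      rcases Nat.eq_zero_or_pos i with rfl | hi
      · exact num1k hδ hs lo (by rw [← df]; exact d2) j (by push_cast at hij; linarith)
      · have hi' : (1:ℝ) ≤ i := by exact_mod_cast hi
        have : s * δ ≤ i * (s * δ) := by nlinarith
        have : 0 ≤ j * deg w x := mul_nonneg (Nat.cast_nonneg _) (by linarith)
        linarith
    rcases lemPE (w := w) hcr h3 with hn | ⟨k, hk, e⟩ | ⟨k, hk, e⟩ | ⟨h3', h4'⟩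
    · exact key hn
    · rw [dF, dG] at e
      have hk' : (1:ℝ) ≤ k := by exact_mod_cast hk
      have : s * δ ≤ k * (s * δ) := by nlinarith
      linarith
    · rw [dF, dG] at e
      obtain ⟨rfl, hx'⟩ := num1a hδ hs hodd lo hx 0 k (by push_cast; linarith)
      push_cast at *
      rcases lemPD (w := w) hcr h3 with hn | ⟨h7, h8⟩
      · exact key hn
      · linarith
    · linarith
  · have kc := kd.conseq
    have b1 := kc.D13
    have b2 := kc.D23
    have b3 := kc.dpos
    have b4 := kc.hge
    have b5 := kc.Dpos
    rcases d2.lt_or_gt with c1 | c1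
    · obtain ⟨t1, t2, t3, -⟩ := kc.transfer (y1 := f) (y2 := x) (y3 := g)
          ⟨hK.swap23, by linarith, by linarith⟩ (by rw [Sp_132, e, Sp_312])
      linarith
    · obtain ⟨t1, t2, t3, -⟩ := kc.transfer (y1 := x) (y2 := f) (y3 := g)
          ⟨hK.rot.rot, by linarith, by linarith⟩ (by rw [Sp_231, e, Sp_312])
      linarith

lemma alphaN {ν : ℝ} (IH : IHyp w ν) {f1 f2 f3 r q : PR} {c : ℂ} (hK : K3 f1 f2 f3)
    (h23 : deg w f2 < deg w f3) (hs : sm w f1 f2 f3 ≤ ν)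
    (hr : r ∈ A1 f1) (hlt : deg w (f2 + r) < deg w f2) (hR : Red w (Sp f1 f3 (f2 + r)))
    (hq : q ∈ A2 f1 (f3 + c • f2)) : Red w (Sp f1 (f3 + c • f2) (f2 + q)) := by
  unfold sm at hs
  have hKr : K3 f1 f3 (f2 + r) := hK.swap23.add (A1_l _ hr)
  have hm : c • f2 ∈ A2 f1 (f2 + r) := by
    have := sub_mem (A2r f1 (f2 + r)) (A1_l (f2 + r) hr)
    rw [add_sub_cancel_right] at this
    exact Subalgebra.smul_mem _ this c
  have R1 : Red w (Sp f1 (f2 + r) (f3 + c • f2)) := by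
    refine up IH hKr.swap23 (by simpa using hm) (by rwa [Sp_132]) ?_
    unfold sm; linarith
  refine up IH (c := f2 + r) (hKr.swap23.add hm).swap23 ?_ (by rwa [Sp_132]) ?_
  · have : f2 + q - (f2 + r) = q - r := by ring
    rw [this]; exact sub_mem hq (A1_l _ hr)
  · unfold sm; rw [deg_pert c h23]; linarith

set_option maxHeartbeats 1000000 in
theorem alpha {ν : ℝ} (IH : IHyp w ν) {f1 f2 f3 r q : PR} {c : ℂ} (hc : c ≠ 0) (hK : K3 f1 f2 f3)
    (h12 : deg w f1 < deg w f2) (h23 : deg w f2 < deg w f3) (hs : sm w f1 f2 f3 ≤ ν)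
    (hr : r ∈ A2 f1 f3) (hlt : deg w (f2 + r) < deg w f2) (hR : Red w (Sp f1 f3 (f2 + r)))
    (hq : q ∈ A2 f1 (f3 + c • f2)) (hle : deg w (f2 + q) ≤ deg w f2) :
    Red w (Sp f1 (f3 + c • f2) (f2 + q)) := by
  obtain ⟨x, m1, R1, l1, mn⟩ := min_red (c := f2) (by simpa using hr) hR
  obtain ⟨t, rfl⟩ : ∃ t, x = f2 + t := ⟨x - f2, by ring⟩
  rw [add_sub_cancel_left] at m1
  have hlt' : deg w (f2 + t) < deg w f2 := by linarith
  have dt := deg_of_lt hlt'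
  have dq := deg_of_le hle
  have hs0 := hs
  unfold sm at hs
  have dg' : deg w (f3 + c • f2) = deg w f3 := deg_pert c h23
  have hD := Dl_pos w hK.swap23.cr12
  have p1 := hK.pos w
  rcases lemP4 (w := w) hK.swap23.cr12 m1 with hn | ⟨k, hk, e⟩ | ⟨k, hk, e⟩ | ⟨p, s, δ, hp, hs', hcop, hδ, e1, e2, e3, e4⟩
  · exact alphaN IH hK h23 hs0 (hn.A1 (by linarith)) hlt' R1 hq
  · obtain ⟨c0, hc0, hl0⟩ := lead_pow hk p1 e
    have R2 := sq2 IH (f := f1) (g := f3) (h := f2) (ν := ν) hK.swap23 (by unfold sm; linarith) m1 hlt' R1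
      (A1_pow f1 c0 k) hl0.le
    have e5 : f3 + c • f2 + (c0 • f1 ^ k - c • f2) = f3 + c0 • f1 ^ k := by ring
    have G : GH w ν f1 f2 (f3 + c • f2) (c0 • f1 ^ k - c • f2) q :=
      { K := hK.add (Subalgebra.smul_mem _ (A2r _ _) _)
        fg := h12.ne
        fh := by rw [dg']; exact (h12.trans h23).ne
        gh := by rw [dg']; exact h23.ne
        sm := by unfold sm; rw [dg']; exact hs
        hr := sub_mem (A1_l _ (A1_pow _ _ _)) (Subalgebra.smul_mem _ (A2r _ _) _)
        lt := by rw [e5, dg']; exact hl0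
        R := by rw [e5, Sp_132]; exact R2
        hq := hq
        le := hle }
    rw [Sp_132]
    exact G.gen IH
  · have : (1:ℝ) ≤ k := by exact_mod_cast hk
    nlinarith
  · rcases numPQ hp hs' hcop hδ (by linarith) with ⟨rfl, h3, h4⟩ | ⟨rfl, rfl⟩
    swap
    · push_cast at e1 e2; linarith
    have e3' : ((2:ℕ) * (s:ℝ) - (2:ℕ) - s) = s - 2 := by push_cast; ring
    rw [e3'] at e3
    rcases canc_pq (w := w) (hK.swap23.line c).cr12 hq hp hs' hcop e1 (dg'.trans e2) with hn | ⟨e5, -⟩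
    · have hq1 := hn.A1 (by linarith)
      have R2 : Red w (Sp f1 f3 (f2 + q)) := by
        refine up IH (hK.swap23.add m1) ?_ R1 ?_
        · have : f2 + q - (f2 + t) = q - t := by ring
          rw [this]; exact sub_mem (A1_l _ hq1) m1
        · unfold sm; linarith
      have hK2 : K3 f1 f3 (f2 + q) := hK.swap23.add (A1_l _ hq1)
      have hm : c • f2 ∈ A2 f1 (f2 + q) := by
        have := sub_mem (A2r f1 (f2 + q)) (A1_l (f2 + q) hq1)
        rw [add_sub_cancel_right] at this
        exact Subalgebra.smul_mem _ this c
      rcases hle.lt_or_eq with h5 | h5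
      · rw [Sp_132]
        refine up IH hK2.swap23 (by simpa using hm) (by rwa [Sp_132]) ?_
        unfold sm; linarith
      · have e6 : f2 + q + (t - q) = f2 + t := by ring
        have G : GH w ν f1 f3 (f2 + q) (t - q) (c • f2) :=
          { K := hK2
            fg := (h12.trans h23).ne
            fh := by rw [h5]; exact h12.ne
            gh := by rw [h5]; exact h23.ne'
            sm := by unfold sm; rw [h5]; linarith
            hr := sub_mem m1 (A1_l _ hq1)
            lt := by rw [e6, h5]; exact hlt'
            R := by rw [e6]; exact R1
            hq := hm
            le := dg'.le }
        exact G.gen IH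
    · rw [e3'] at e5
      exfalso
      have D12 : Dl w f1 f2 ≤ deg w f2 - (s - 2) * δ := by
        have h6 : Dl w f1 (c • f2) = Dl w f1 f2 := Dl_smul w _ _ hc
        have h7 : c • f2 = (f3 + c • f2) + (-1 : ℂ) • f3 := by module
        rw [← h6, h7]
        refine (Dl_add_le w _ _ _).trans (max_le ?_ ?_)
        · linarith
        · exact (Dl_smul_le w _ _ _).trans (by linarith)
      have hs3 : (3:ℝ) ≤ s := by exact_mod_cast h3
      push_cast at e1 e4
      have e4' := e4 (by nlinarith)
      have hY : Dl w f1 (f2 + t) = Dl w f1 t := by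
        rw [add_comm, Dl_add_eq w]; nlinarith
      refine AX (w := w) (f := f1) (g := f3) (x := f2 + t) hδ (hK.swap23.add m1) (by linarith) e2 h3 h4 (by linarith) ?_ ?_ R1
      · rw [hY]; linarith
      · intro u hu
        refine mn _ (sub_add_mem (by simpa using m1) hu) ?_
        refine up IH (hK.swap23.add m1) (by simpa using hu) R1 ?_
        unfold sm; linarith

theorem beta {ν : ℝ} (IH : IHyp w ν) {f1 f2 f3 r q : PR} {a b : ℂ} (hab : a ≠ 0 ∨ b ≠ 0) (hK : K3 f1 f2 f3)
    (h12 : deg w f1 < deg w f2) (h23 : deg w f2 < deg w f3) (hs : sm w f1 f2 f3 ≤ ν)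
    (hr : r ∈ A2 f2 f3) (hlt : deg w (f1 + r) < deg w f1) (hR : Red w (Sp f2 f3 (f1 + r)))
    (hq : q ∈ A2 (f2 + a • f1) (f3 + b • f1)) (hle : deg w (f1 + q) ≤ deg w f1) :
    Red w (Sp (f2 + a • f1) (f3 + b • f1) (f1 + q)) := by
  have dr := deg_of_lt hlt
  have dq := deg_of_le hle
  have p1 := hK.pos w
  have d2 : deg w (f2 + a • f1) = deg w f2 := deg_pert a h12
  have d3 : deg w (f3 + b • f1) = deg w f3 := deg_pert b (h12.trans h23)
  have hKp : K3 (f2 + a • f1) (f3 + b • f1) f1 := hK.rot.plane a b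
  have RV : Red w (Sp f2 f3 f1) :=
    Red.el _ _ _ r hK.rot h23.ne h12.ne' (h12.trans h23).ne' hr hlt hR
  unfold sm at hs
  have hD := Dl_pos w hKp.cr12
  rcases lemP4 (w := w) hKp.cr12 hq with hn | ⟨k, hk, e⟩ | ⟨k, hk, e⟩ | ⟨p, s, δ, hp, hs', hcop, hδ, e1, e2, e3, e4⟩
  · obtain ⟨k, hk⟩ := hn.const (by linarith) (by linarith)
    rw [← Sp_plane f2 f3 f1 a b, ← Sp_lin _ _ f1 one_ne_zero k 0 0] at RV
    convert RV using 2
    rw [hk]; module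
  · rw [d2, d3] at e
    obtain ⟨c0, hc0, hl0⟩ := lead_pow hk (by linarith) e
    have R2 := sq2 IH (f := f2) (g := f3) (h := f1) (ν := ν) hK.rot (by unfold sm; linarith) hr hlt hR
      (A1_pow f2 c0 k) hl0.le
    have e5 : f3 + b • f1 + (c0 • f2 ^ k - b • f1) = f3 + c0 • f2 ^ k := by ring
    have hm : f2 ∈ A2 (f2 + a • f1) f1 := by
      have := sub_mem (A2l (f2 + a • f1) f1) (Subalgebra.smul_mem _ (A2r (f2 + a • f1) f1) a)
      rwa [add_sub_cancel_right] at this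
    have hSp : Sp (f2 + a • f1) f1 (f3 + c0 • f2 ^ k) = Sp f2 (f3 + c0 • f2 ^ k) f1 := by
      rw [Sp_312, Sp_line, Sp_312, Sp_312]; exact Sp_132 _ _ _
    have G : GH w ν (f2 + a • f1) f1 (f3 + b • f1) (c0 • f2 ^ k - b • f1) q :=
      { K := hKp.swap23
        fg := by rw [d2]; exact h12.ne'
        fh := by rw [d2, d3]; exact h23.ne
        gh := by rw [d3]; exact (h12.trans h23).ne
        sm := by unfold sm; rw [d2, d3]; linarith
        hr := sub_mem (Subalgebra.smul_mem _ (pow_mem hm k) _) (Subalgebra.smul_mem _ (A2r _ _) _)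
        lt := by rw [e5, d3]; exact hl0
        R := by rw [e5, hSp]; exact R2
        hq := hq
        le := hle }
    rw [Sp_132]
    exact G.gen IH
  · rw [d2, d3] at e
    have : (1:ℝ) ≤ k := by exact_mod_cast hk
    nlinarith
  · exfalso
    rw [d2] at e1
    rw [d3] at e2
    have e3' : ((s:ℝ) * p - s - p) * δ < p * δ := by
      have : ((s:ℝ) * p - s - p) = p * s - p - s := by ring
      rw [this]; linarith
    rcases numPQ hs' hp hcop.symm hδ e3' with ⟨rfl, h3, h4⟩ | ⟨rfl, rfl⟩
    · have : (3:ℝ) ≤ p := by exact_mod_cast h3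
      push_cast at e2; nlinarith
    push_cast at e1 e2 e3
    have c1 : Dl w f2 f3 ≤ deg w f1 - δ := by
      have := (canc23 (h := f1) (w := w) hK.rot.cr12 e1 e2 hr (by linarith) (by linarith)).1
      linarith
    have c2 : Dl w (f2 + a • f1) (f3 + b • f1) ≤ deg w f1 - δ := by linarith
    have cp := cr_plane f2 f3 f1 a b
    have v1 : vd w (cr f2 f3) ≤ deg w f1 - δ := c1
    have v2 : vd w (cr (f2 + a • f1) (f3 + b • f1)) ≤ deg w f1 - δ := c2
    have v3 : vd w (b • cr f2 f1 + (-a) • cr f3 f1) ≤ deg w f1 - δ := by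
      have : b • cr f2 f1 + (-a) • cr f3 f1 = cr (f2 + a • f1) (f3 + b • f1) + (-1:ℂ) • cr f2 f3 := by
        rw [cp]; module
      rw [this]
      exact vd_sum_le v2 ((vd_csmul_le _ _).trans v1)
    by_cases ha : a = 0
    · subst ha
      have hb : b ≠ 0 := by simpa using hab
      have : Dl w f2 f1 ≤ deg w f1 - δ := by
        rw [neg_zero, zero_smul, add_zero, vd_csmul w hb] at v3
        exact v3
      have := D2 w hK.rot
      linarith
    · have hKs : K3 (a • f3 + (-b) • f2) f1 f2 := by
        refine K3.sp hK.rot.rot ?_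
        have := Sp_lin f1 f2 f3 ha 0 0 (-b)
        rw [Sp_231, Sp_231 f3 f1 f2, ← this]
        congr 1; module
      have ds : deg w (a • f3 + (-b) • f2) = 3 * δ := by
        rw [deg_add_eq w, deg_smul' w ha, e2]
        rw [deg_smul' w ha]; exact (deg_smul_le w _ _).trans_lt h23
      have D1' : Dl w (a • f3 + (-b) • f2) f1 ≤ deg w f1 - δ := by
        have : cr f1 (a • f3 + (-b) • f2) = b • cr f2 f1 + (-a) • cr f3 f1 := by
          rw [cr_add, cr_smul, cr_smul, cr_swap f1 f3, cr_swap f1 f2]; module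
        rw [Dl_comm, Dl, this]; exact v3
      have D2' : Dl w (a • f3 + (-b) • f2) f2 ≤ deg w f1 - δ := by
        have : cr f2 (a • f3 + (-b) • f2) = a • cr f2 f3 := by
          rw [cr_add, cr_smul, cr_smul, cr_self]; simp
        rw [Dl_comm, Dl, this]; exact (vd_csmul_le _ _).trans v1
      have := D2 w hKs
      linarith

end


/-! Part 12 -/
set_option linter.unusedSectionVars false
set_option linter.unusedVariables false

section
variable {w : Fin 3 → ℝ} [hw : GoodW w]

lemma A2_sub {f g a b r : PR} (h : r ∈ A2 a b) (k1 k2 l1 l2 : ℂ) (ha : a = k1 • f + k2 • g)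
    (hb : b = l1 • f + l2 • g) : r ∈ A2 f g := by
  refine A2_le ?_ ?_ h
  · rw [ha]
    exact add_mem (Subalgebra.smul_mem _ (A2l _ _) _) (Subalgebra.smul_mem _ (A2r _ _) _)
  · rw [hb]
    exact add_mem (Subalgebra.smul_mem _ (A2l _ _) _) (Subalgebra.smul_mem _ (A2r _ _) _)

lemma Sp_lin' (a b c : PR) (k0 k1 k2 : ℂ) : Sp a b (c + (k0 • 1 + k1 • a + k2 • b)) = Sp a b c := by
  rw [← Sp_lin a b c one_ne_zero k0 k1 k2]
  congr 1; module

lemma Noncan.lin {f g r : PR} (h : Noncan w f g r) (hf : 1 ≤ deg w f) (h1 : deg w r < 2 * deg w f)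
    (h2 : deg w r < deg w g) : ∃ k0 k1 : ℂ, r = k0 • 1 + k1 • f := by
  have : r ∈ Sp f 0 0 := by
    refine h.mem _ ?_
    intro i j hij
    have hi0 := Nat.cast_nonneg (α := ℝ) i
    have hr := deg_nonneg w r
    have hj : j = 0 := by
      by_contra hj
      have : (1:ℝ) ≤ j := by exact_mod_cast Nat.one_le_iff_ne_zero.mpr hj
      nlinarith
    subst hj
    have hi : i < 2 := by
      by_contra hi
      push Not at hi
      have : (2:ℝ) ≤ i := by exact_mod_cast hi
      push_cast at hij
      nlinarith
    interval_cases i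
    · simpa using Sp0 f 0 0
    · simpa using Sp1 f 0 0
  obtain ⟨k0, k1, k2, k3, e⟩ := mem_Sp.mp this
  exact ⟨k0, k1, by rw [e]; simp⟩

/-- neighbours of the base space not increasing the degree. -/
lemma base_nb {a b c c' : PR} (hK : K3 a b c) (hab : deg w a ≠ deg w b)
    (e : Sp a b c = Sp (X 0) (X 1) (X 2)) (hr : c' - c ∈ A2 a b) (hle : deg w c' ≤ deg w c) :
    Sp a b c' = Sp a b c := by
  have pa := hK.pos w
  have pb := hK.rot.pos w
  have hc2 : deg w c < 2 := base_lt hK.rot.rot (by rw [← e, Sp_231])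
  have hn : Noncan w a b (c' - c) := by
    rcases lemP4 (w := w) hK.cr12 hr with hn | ⟨k, hk, e1⟩ | ⟨k, hk, e1⟩ | ⟨p, q, ε, hp, hq, -, hε, e1, e2, -⟩
    · exact hn
    · exact (base_irr hK hab e (m := k) (n := 1) hk (by rw [e1]; push_cast; ring)).elim
    · exact (base_irr hK hab e (m := 1) (n := k) (by norm_num) (by rw [e1]; push_cast; ring)).elim
    · exact (base_irr hK hab e (m := q) (n := p) (by omega) (by rw [e1, e2]; ring)).elim
  have hd : deg w (c' - c) < 2 := by
    rw [sub_eq_add_neg]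
    exact deg_add_lt (by linarith) (by rw [deg_neg']; exact hc2)
  have : c' - c ∈ Sp a b 0 := by
    refine hn.mem _ ?_
    intro i j hij
    have hi0 := Nat.cast_nonneg (α := ℝ) i
    have hj0 := Nat.cast_nonneg (α := ℝ) j
    have h2 : (i:ℝ) + j < 2 := by nlinarith
    have h3 : i + j < 2 := by exact_mod_cast h2
    have : (i = 0 ∧ j = 0) ∨ (i = 1 ∧ j = 0) ∨ (i = 0 ∧ j = 1) := by omega
    rcases this with ⟨rfl, rfl⟩ | ⟨rfl, rfl⟩ | ⟨rfl, rfl⟩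
    · simpa using Sp0 a b 0
    · simpa using Sp1 a b 0
    · simpa using Sp2 a b 0
  obtain ⟨k0, k1, k2, k3, e⟩ := mem_Sp.mp this
  have e' : c' = c + (k0 • 1 + k1 • a + k2 • b) := by
    rw [smul_zero, add_zero] at e
    rw [← e]; ring
  rw [e', Sp_lin']

/-- neighbours of a space of exceptional form. -/
lemma kr_nb {f g h r0 a b c c' : PR} {k : ℂ} {δ : ℝ} (kd : KD w f g h r0 k δ) (hK : K3 a b c)
    (hab : deg w a < deg w b) (hac : deg w a ≠ deg w c) (hbc : deg w b ≠ deg w c)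
    (e : Sp a b c = Sp f (g + k • h ^ 2) h) (hr : c' - c ∈ A2 a b) (hle : deg w c' ≤ deg w c) :
    Red w (Sp a b c') := by
  have kc := kd.conseq
  have hV : Red w (Sp f (g + k • h ^ 2) h) :=
    Red.kr f g h r0 k δ kd.K kd.df kd.dg kd.dh kd.hr kd.lt kd.lt' kd.hc kd.red
  have df := kd.df
  have dg := kd.dg
  have dh := kd.dh
  have b1 := kc.D13
  have b2 := kc.D23
  have b3 := kc.dpos
  have b4 := kc.hge
  have b5 := kc.Dpos
  have b6 := kc.gle
  have b7 := kc.T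
  obtain ⟨gK, g1, g2⟩ := kc.gb
  generalize hg' : g + k • h ^ 2 = g' at *
  rw [Sp_312] at hV
  rcases kc.gb.pos hK hab hac hbc (by rw [e, Sp_312]) hr with ⟨r, m, e1, e2, e3⟩ | ⟨β, r, m, e1, e2, e3⟩ | ⟨α, β, r, m, e1, e2, e3⟩
  · have dr : deg w r ≤ deg w g' := deg_of_le (by linarith)
    have hn : Noncan w h f r := by
      rcases lemPE (w := w) gK.cr12 m with hn | ⟨j, hj, e5⟩ | ⟨j, hj, e5⟩ | ⟨h3, h4⟩
      · exact hn
      · rw [df] at e5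
        exact (num1k (s := 3) b3 le_rfl (by push_cast; linarith) (by linarith) j e5).elim
      · have : (1:ℝ) ≤ j := by exact_mod_cast hj
        nlinarith
      · linarith
    obtain ⟨k0, k1, k2, k3, es⟩ := hn.symm.sq (by linarith) (by linarith) (by linarith)
    have e6 : Sp a b c' = Sp f (g + (k + k3) • h ^ 2) h := by
      rw [e1, Sp_231, Sp_132 f (g + _) h, Sp_213 f h, Sp_213 f, Sp_132 _ f h] 
      rw [Sp_312, Sp_312, ← Sp_lin' h f (g + _) k0 k2 k1]
      congr 1
      rw [es, ← hg']; module
    rw [e6]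
    by_cases hk : k + k3 = 0
    · rw [hk, zero_smul, add_zero]
      exact Red.el f g h r0 kd.K (by linarith) (by linarith) (by linarith) kd.hr kd.lt kd.red
    · exact Red.kr f g h r0 _ δ kd.K df dg dh kd.hr kd.lt kd.lt' hk kd.red
  · have dr : deg w r ≤ deg w f := deg_of_le (by linarith)
    have hD : Dl w h (g' + β • f) = Dl w h g' := Dl_add_smul β (by linarith)
    have hn : Noncan w h (g' + β • f) r := by
      rcases lemPD (w := w) (gK.swap23.line β).cr12 m with hn | ⟨h3, h4⟩
      · exact hn
      · linarith
    have dG : deg w (g' + β • f) = deg w g' := deg_pert β g2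
    obtain ⟨k0, k1, es⟩ := hn.lin (by linarith) (by linarith) (by linarith)
    rw [e1]
    have : f + r = f + (k0 • 1 + k1 • h + (0:ℂ) • (g' + β • f)) := by rw [es]; module
    rw [this, Sp_lin', Sp_line, Sp_132]
    exact hV
  · have dr : deg w r ≤ deg w h := deg_of_le (by linarith)
    have cfh := Dl_comm w f h
    have cgh := Dl_comm w g' h
    have hD : Dl w (f + α • h) (g' + β • h) = Dl w f g' := Dl_plane α β (by linarith) (by linarith)
    have dF : deg w (f + α • h) = deg w f := deg_pert α g1
    have dG : deg w (g' + β • h) = deg w g' := deg_pert β (by linarith)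
    have hn : Noncan w (f + α • h) (g' + β • h) r := by
      rcases lemPD (w := w) (gK.rot.plane α β).cr12 m with hn | ⟨h3, h4⟩
      · exact hn
      · linarith
    obtain ⟨k0, es⟩ := hn.const (by linarith) (by linarith)
    rw [e1]
    have : h + r = h + (k0 • 1 + (0:ℂ) • (f + α • h) + (0:ℂ) • (g' + β • h)) := by rw [es]; module
    rw [this, Sp_lin', Sp_plane, Sp_312]
    exact hV

end


/-! Part 13 -/
set_option linter.unusedSectionVars false
set_option linter.unusedVariables false
section
variable {w : Fin 3 → ℝ} [hw : GoodW w]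

lemma Sp_sh (a b c : PR) (k : ℂ) : Sp (a + k • b) b c = Sp a b c := by
  rw [Sp_231, Sp_231 a b c, Sp_213 b c, Sp_213 b c a]
  have := Sp_lin' c b a 0 0 k
  simpa using this

lemma A2_sh (a b : PR) (k : ℂ) : A2 (a + k • b) b = A2 a b := by
  apply le_antisymm
  · exact A2_le (add_mem (A2l _ _) (Subalgebra.smul_mem _ (A2r _ _) _)) (A2r _ _)
  · refine A2_le ?_ (A2r _ _)
    have := sub_mem (A2l (a + k • b) b) (Subalgebra.smul_mem (A2 (a + k • b) b) (A2r (a + k • b) b) k)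
    simpa using this

/-- the nine position combinations -/
theorem nine {ν : ℝ} (IH : IHyp w ν) {x1 x2 x3 : PR} (hx : GB w x1 x2 x3) (hs : sm w x1 x2 x3 ≤ ν)
    (hU : (∃ r ∈ A2 x1 x2, deg w (x3 + r) < deg w x3 ∧ Red w (Sp x1 x2 (x3 + r))) ∨
    (∃ β : ℂ, ∃ r ∈ A2 x1 (x3 + β • x2), deg w (x2 + r) < deg w x2 ∧
      Red w (Sp x1 (x3 + β • x2) (x2 + r))) ∨
    (∃ α β : ℂ, ∃ r ∈ A2 (x2 + α • x1) (x3 + β • x1), deg w (x1 + r) < deg w x1 ∧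
      Red w (Sp (x2 + α • x1) (x3 + β • x1) (x1 + r)))) {V' : Submodule ℂ PR}
    (hV : (∃ r ∈ A2 x1 x2, V' = Sp x1 x2 (x3 + r) ∧ deg w (x3 + r) ≤ deg w x3) ∨
    (∃ β : ℂ, ∃ r ∈ A2 x1 (x3 + β • x2), V' = Sp x1 (x3 + β • x2) (x2 + r) ∧
      deg w (x2 + r) ≤ deg w x2) ∨
    (∃ α β : ℂ, ∃ r ∈ A2 (x2 + α • x1) (x3 + β • x1),
      V' = Sp (x2 + α • x1) (x3 + β • x1) (x1 + r) ∧ deg w (x1 + r) ≤ deg w x1)) : Red w V' := by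
  obtain ⟨K, h12, h23⟩ := hx
  have h13 := h12.trans h23
  have d2 : ∀ α : ℂ, deg w (x2 + α • x1) = deg w x2 := fun α => deg_pert α h12
  have d3 : ∀ α : ℂ, deg w (x3 + α • x1) = deg w x3 := fun α => deg_pert α h13
  have d3' : ∀ α : ℂ, deg w (x3 + α • x2) = deg w x3 := fun α => deg_pert α h23
  have d3'' : ∀ α β : ℂ, deg w (x3 + α • x2 + β • x1) = deg w x3 := fun α β => by
    rw [deg_pert β (by rw [d3']; exact h13), d3']
  unfold sm at hs
  rcases hU with ⟨r, hr, lr, R⟩ | ⟨β, r, hr, lr, R⟩ | ⟨α, β, r, hr, lr, R⟩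
  · rcases hV with ⟨q, hq, rfl, lq⟩ | ⟨β', q, hq, rfl, lq⟩ | ⟨α', β', q, hq, rfl, lq⟩
    · refine up IH (K.add hr) ?_ R ?_
      · rw [show x3 + q - (x3 + r) = q - r by ring]; exact sub_mem hq hr
      · unfold sm; linarith
    · have e : x3 + β' • x2 + (r - β' • x2) = x3 + r := by ring
      have G : GH w ν x1 x2 (x3 + β' • x2) (r - β' • x2) q := by
        refine ⟨?_, h12.ne, ?_, ?_, ?_, ?_, ?_, ?_, hq, lq⟩
        · exact K.add (Subalgebra.smul_mem _ (A2r _ _) _)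
        · rw [d3']; exact h13.ne
        · rw [d3']; exact h23.ne
        · unfold sm; rw [d3']; exact hs
        · exact sub_mem hr (Subalgebra.smul_mem _ (A2r _ _) _)
        · rw [e, d3']; exact lr
        · rw [e]; exact R
      have := G.gen IH
      rwa [Sp_132]
    · have e : x3 + β' • x1 + (r - β' • x1) = x3 + r := by ring
      have G : GH w ν (x2 + α' • x1) x1 (x3 + β' • x1) (r - β' • x1) q := by
        refine ⟨?_, ?_, ?_, ?_, ?_, ?_, ?_, ?_, hq, lq⟩
        · refine K3.add ?_ (Subalgebra.smul_mem _ (A2r _ _) _)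
          exact K.swap.congr (Sp_sh _ _ _ _).symm
        · rw [d2]; exact h12.ne'
        · rw [d3, d2]; exact h23.ne
        · rw [d3]; exact h13.ne
        · unfold sm; rw [d3, d2]; linarith
        · rw [A2_sh, A2_comm]
          exact sub_mem hr (Subalgebra.smul_mem _ (A2l _ _) _)
        · rw [e, d3]; exact lr
        · rw [e, Sp_sh, Sp_213]; exact R
      have := G.gen IH
      rwa [Sp_132]
  · rcases hV with ⟨q, hq, rfl, lq⟩ | ⟨β', q, hq, rfl, lq⟩ | ⟨α', β', q, hq, rfl, lq⟩
    · have e : x3 + β • x2 + (q - β • x2) = x3 + q := by ring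
      have G : GH w ν x1 (x3 + β • x2) x2 r (q - β • x2) := by
        refine ⟨?_, ?_, ?_, ?_, ?_, hr, lr, R, ?_, ?_⟩
        · exact K3.swap23 (K.add (Subalgebra.smul_mem _ (A2r _ _) _))
        · rw [d3']; exact h13.ne
        · exact h12.ne
        · rw [d3']; exact h23.ne'
        · unfold sm; rw [d3']; linarith
        · exact sub_mem hq (Subalgebra.smul_mem _ (A2r _ _) _)
        · rw [e, d3']; exact lq
      have := G.gen IH
      rw [e] at this
      rwa [Sp_132]
    · have K' : K3 x1 x2 (x3 + β • x2) := K.add (Subalgebra.smul_mem _ (A2r _ _) _)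
      by_cases hc : β' = β
      · subst hc
        refine up IH (c := x2 + r) (K3.add K'.swap23 hr) ?_ R ?_
        · rw [show x2 + q - (x2 + r) = q - r by ring]; exact sub_mem hq hr
        · unfold sm; rw [d3']; linarith
      · have e : x3 + β' • x2 = (x3 + β • x2) + (β' - β) • x2 := by rw [sub_smul]; ring
        rw [e] at hq ⊢
        refine alpha IH (sub_ne_zero.2 hc) K' h12 ?_ ?_ hr lr R hq lq
        · rw [d3']; exact h23
        · unfold sm; rw [d3']; linarith
    · have e : x2 + α' • x1 + (r - α' • x1) = x2 + r := by ring
      have e2 : (x3 + β • x2) + (β' + β * α') • x1 = (x3 + β' • x1) + β • (x2 + α' • x1) := by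
        rw [add_smul, smul_add, mul_smul]; ring
      have G : GH w ν ((x3 + β • x2) + (β' + β * α') • x1) x1 (x2 + α' • x1) (r - α' • x1) q := by
        refine ⟨?_, ?_, ?_, ?_, ?_, ?_, ?_, ?_, ?_, lq⟩
        · refine K3.add ?_ (Subalgebra.smul_mem _ (A2r _ _) _)
          refine K3.congr ?_ (Sp_sh _ _ _ _).symm
          exact (K.add (Subalgebra.smul_mem _ (A2r _ _) _)).rot.rot
        · rw [d3'']; exact h13.ne'
        · rw [d3'', d2]; exact h23.ne'
        · rw [d2]; exact h12.ne
        · unfold sm; rw [d3'', d2]; linarith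
        · rw [A2_sh, A2_comm]
          exact sub_mem hr (Subalgebra.smul_mem _ (A2l _ _) _)
        · rw [e, d2]; exact lr
        · rw [e, Sp_sh, Sp_213]; exact R
        · rw [e2, A2_sh, A2_comm]; exact hq
      have := G.gen IH
      rw [e2, Sp_132, Sp_sh, Sp_213] at this
      exact this
  · rcases hV with ⟨q, hq, rfl, lq⟩ | ⟨β', q, hq, rfl, lq⟩ | ⟨α', β', q, hq, rfl, lq⟩
    · have e : x3 + β • x1 + (q - β • x1) = x3 + q := by ring
      have G : GH w ν (x2 + α • x1) (x3 + β • x1) x1 r (q - β • x1) := by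
        refine ⟨?_, ?_, ?_, ?_, ?_, hr, lr, R, ?_, ?_⟩
        · refine K3.swap23 (K3.add ?_ (Subalgebra.smul_mem _ (A2r _ _) _))
          exact K.swap.congr (Sp_sh _ _ _ _).symm
        · rw [d3, d2]; exact h23.ne
        · rw [d2]; exact h12.ne'
        · rw [d3]; exact h13.ne'
        · unfold sm; rw [d3, d2]; linarith
        · rw [A2_sh, A2_comm]
          exact sub_mem hq (Subalgebra.smul_mem _ (A2l _ _) _)
        · rw [e, d3]; exact lq
      have := G.gen IH
      rw [e, Sp_132, Sp_sh, Sp_213] at this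
      exact this
    · have e : x2 + α • x1 + (q - α • x1) = x2 + q := by ring
      have e2 : (x3 + β' • x2) + (β + β' * α) • x1 = (x3 + β • x1) + β' • (x2 + α • x1) := by
        rw [add_smul, smul_add, mul_smul]; ring
      have G : GH w ν ((x3 + β' • x2) + (β + β' * α) • x1) (x2 + α • x1) x1 r (q - α • x1) := by
        refine ⟨?_, ?_, ?_, ?_, ?_, ?_, lr, ?_, ?_, ?_⟩
        · refine K3.swap23 (K3.add ?_ (Subalgebra.smul_mem _ (A2r _ _) _))
          refine K3.congr ?_ (Sp_sh _ _ _ _).symm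
          exact (K.add (Subalgebra.smul_mem _ (A2r _ _) _)).rot.rot
        · rw [d3'', d2]; exact h23.ne'
        · rw [d3'']; exact h13.ne'
        · rw [d2]; exact h12.ne'
        · unfold sm; rw [d3'', d2]; linarith
        · rw [e2, A2_sh, A2_comm]; exact hr
        · rw [e2, Sp_sh, Sp_213]; exact R
        · rw [A2_sh, A2_comm]
          exact sub_mem hq (Subalgebra.smul_mem _ (A2l _ _) _)
        · rw [e, d2]; exact lq
      have := G.gen IH
      rw [e, Sp_132, Sp_sh, Sp_213] at this
      exact this
    · have K' : K3 x1 (x2 + α • x1) (x3 + β • x1) := by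
        refine K3.add ?_ (Subalgebra.smul_mem _ (A2l _ _) _)
        exact (K.swap.congr (Sp_sh _ _ _ _).symm).swap
      by_cases hc : α' = α ∧ β' = β
      · obtain ⟨rfl, rfl⟩ := hc
        refine up IH (c := x1 + r) (K3.add K'.rot hr) ?_ R ?_
        · rw [show x1 + q - (x1 + r) = q - r by ring]; exact sub_mem hq hr
        · unfold sm; rw [d3, d2]; linarith
      · have e : x2 + α' • x1 = (x2 + α • x1) + (α' - α) • x1 := by rw [sub_smul]; ring
        have e' : x3 + β' • x1 = (x3 + β • x1) + (β' - β) • x1 := by rw [sub_smul]; ring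
        rw [e, e'] at hq ⊢
        refine beta IH ?_ K' ?_ ?_ ?_ hr lr R hq lq
        · by_contra h; push Not at h
          exact hc ⟨sub_eq_zero.1 h.1, sub_eq_zero.1 h.2⟩
        · rw [d2]; exact h12
        · rw [d2, d3]; exact h23
        · unfold sm; rw [d2, d3]; linarith

theorem red_adj_aux (ν : ℝ) (hν : ν ∈ wtS w) : ∀ V V', Red w V → Adj V V' → Le w V ν → Le w V' ν →
    Red w V' := by
  refine (wtS_wf w).induction (P := fun ν => ∀ V V', Red w V → Adj V V' → Le w V ν → Le w V' ν →
    Red w V') hν ?_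
  clear hν ν
  intro ν hν ih V V' hR hA hV hV'
  have IH : IHyp w ν := by
    rintro U U' hU hA ⟨a, b, c, hK, e, h⟩ ⟨a', b', c', hK', e', h'⟩
    rcases le_total (sm w a b c) (sm w a' b' c') with h1 | h1
    · exact ih _ (sm_mem a' b' c') h' U U' hU hA ⟨a, b, c, hK, e, h1⟩ ⟨a', b', c', hK', e', le_rfl⟩
    · exact ih _ (sm_mem a b c) h U U' hU hA ⟨a, b, c, hK, e, le_rfl⟩ ⟨a', b', c', hK', e', h1⟩
  obtain ⟨a, b, c, c', K, rfl, rfl, hr, hab, hac, hbc, hac', hbc'⟩ := hA.nf (w := w)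
  have K' := K.to hr
  obtain ⟨a1, b1, c1, K1, e1, h1⟩ := hV
  obtain ⟨a2, b2, c2, K2, e2, h2⟩ := hV'
  have s1 := (sm_min K hab.ne hac hbc K1 e1).trans h1
  have s2 := (sm_min K' hab.ne hac' hbc' K2 e2).trans h2
  rcases s1.lt_or_eq with s1 | s1
  · exact up IH K hr hR s1
  have hle : deg w c' ≤ deg w c := by
    unfold sm at s1 s2; linarith
  obtain ⟨x1, x2, x3, hx, ex, sx⟩ := sort3 K hab.ne hac hbc
  have hp := hx.pos K hab hac hbc ex.symm hr
  have hV : (∃ r ∈ A2 x1 x2, Sp a b c' = Sp x1 x2 (x3 + r) ∧ deg w (x3 + r) ≤ deg w x3) ∨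
    (∃ β : ℂ, ∃ r ∈ A2 x1 (x3 + β • x2), Sp a b c' = Sp x1 (x3 + β • x2) (x2 + r) ∧
      deg w (x2 + r) ≤ deg w x2) ∨
    (∃ α β : ℂ, ∃ r ∈ A2 (x2 + α • x1) (x3 + β • x1),
      Sp a b c' = Sp (x2 + α • x1) (x3 + β • x1) (x1 + r) ∧ deg w (x1 + r) ≤ deg w x1) := by
    rcases hp with ⟨r, h1, h2, h3, h4⟩ | ⟨β, r, h1, h2, h3, h4⟩ | ⟨α, β, r, h1, h2, h3, h4⟩
    · exact Or.inl ⟨r, h1, h2, by rw [h3, ← h4]; exact hle⟩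
    · exact Or.inr (Or.inl ⟨β, r, h1, h2, by rw [h3, ← h4]; exact hle⟩)
    · exact Or.inr (Or.inr ⟨α, β, r, h1, h2, by rw [h3, ← h4]; exact hle⟩)
  have hR' := hR
  rw [← ex] at hR'
  rcases inv hx hR' with h | h | h | h | ⟨f, g, h, r, k, δ, kd, e⟩
  · rw [base_nb K hab.ne (ex.symm.trans h) hr hle]; exact hR
  · exact nine IH hx (by rw [sx, s1]) (Or.inl h) hV
  · exact nine IH hx (by rw [sx, s1]) (Or.inr (Or.inl h)) hV
  · exact nine IH hx (by rw [sx, s1]) (Or.inr (Or.inr h)) hV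
  · exact kr_nb kd K hab hac hbc (ex.symm.trans e) hr hle

theorem red_adj {V V' : Submodule ℂ PR} (hR : Red w V) (hA : Adj V V') : Red w V' := by
  obtain ⟨a, b, c, c', K, e, e', hr⟩ := id hA
  have K' := K.to hr
  rcases le_total (sm w a b c) (sm w a b c') with h1 | h1
  · exact red_adj_aux _ (sm_mem a b c') V V' hR hA ⟨a, b, c, K, e, h1⟩ ⟨a, b, c', K', e', le_rfl⟩
  · exact red_adj_aux _ (sm_mem a b c) V V' hR hA ⟨a, b, c, K, e, le_rfl⟩ ⟨a, b, c', K', e', h1⟩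
end


/-! Part 14 -/
set_option linter.unusedSectionVars false
set_option linter.unusedVariables false
section
variable {w : Fin 3 → ℝ} [hw : GoodW w]

def TR (w : Fin 3 → ℝ) (T : Fin 3 → PR) : Prop := K3 (T 0) (T 1) (T 2) ∧ Red w (Sp (T 0) (T 1) (T 2))

lemma adj3 {a b c c' : PR} (K : K3 a b c) (R : Red w (Sp a b c)) (h : c' - c ∈ A2 a b) :
    K3 a b c' ∧ Red w (Sp a b c') :=
  ⟨K.to h, red_adj R ⟨a, b, c, c', K, rfl, rfl, h⟩⟩

lemma TR.el {T T' : Fin 3 → PR} (h : TR w T) (i : Fin 3) (hj : ∀ j, j ≠ i → T' j = T j)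
    (hi : T' i - T i ∈ Algebra.adjoin ℂ (T '' {i}ᶜ)) : TR w T' := by
  obtain ⟨K, R⟩ := h
  fin_cases i
  · have h1 := hj 1 (by decide)
    have h2 := hj 2 (by decide)
    have := adj3 (c' := T' 0) K.rot (by rwa [← Sp_231]) (by
      refine Algebra.adjoin_mono ?_ hi
      rintro x ⟨j, hj, rfl⟩
      fin_cases j <;> simp_all)
    refine ⟨?_, ?_⟩
    · rw [h1, h2]; exact this.1.rot.rot
    · rw [h1, h2, Sp_231]; exact this.2
  · have h1 := hj 0 (by decide)
    have h2 := hj 2 (by decide)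
    have := adj3 (c' := T' 1) K.swap23 (by rwa [← Sp_132]) (by
      refine Algebra.adjoin_mono ?_ hi
      rintro x ⟨j, hj, rfl⟩
      fin_cases j <;> simp_all)
    refine ⟨?_, ?_⟩
    · rw [h1, h2]; exact this.1.swap23
    · rw [h1, h2, Sp_132]; exact this.2
  · have h1 := hj 0 (by decide)
    have h2 := hj 1 (by decide)
    have := adj3 (c' := T' 2) K R (by
      refine Algebra.adjoin_mono ?_ hi
      rintro x ⟨j, hj, rfl⟩
      fin_cases j <;> simp_all)
    unfold TR
    rw [h1, h2]; exact this

lemma adjoin_map (F : PR ≃ₐ[ℂ] PR) {i : Fin 3} {p : PR} (hp : degreeOf i p = 0) :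
    F p ∈ Algebra.adjoin ℂ ((fun j => F (X j)) '' {i}ᶜ) := by
  have h1 : p ∈ supported ℂ ({i}ᶜ : Set (Fin 3)) := by
    rw [mem_supported]
    intro j hj
    simp only [Set.mem_compl_iff, Set.mem_singleton_iff]
    rintro rfl
    exact (mem_vars_iff_degreeOf_ne_zero.1 hj) hp
  rw [supported_eq_adjoin_X] at h1
  have h2 : F p ∈ (Algebra.adjoin ℂ (X '' ({i}ᶜ : Set (Fin 3)))).map (F : PR →ₐ[ℂ] PR) :=
    ⟨p, h1, rfl⟩
  rw [AlgHom.map_adjoin, Set.image_image] at h2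
  exact h2

lemma mem_V0 {p : PR} (h : p.totalDegree ≤ 1) : p ∈ Sp (X 0) (X 1) (X 2) := by
  rw [p.as_sum]
  refine Submodule.sum_mem _ fun s hs => ?_
  have h1 := (le_totalDegree hs).trans h
  rw [Finsupp.sum_fintype _ _ (fun _ => rfl), Fin.sum_univ_three] at h1
  have e : (monomial s (coeff s p) : PR) = coeff s p • monomial s 1 := by simp [smul_monomial]
  rw [e]
  refine Submodule.smul_mem _ _ ?_
  have h3 : s = 0 ∨ s = Finsupp.single 0 1 ∨ s = Finsupp.single 1 1 ∨ s = Finsupp.single 2 1 := by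
    have key : ∀ t : Fin 3 →₀ ℕ, (s 0 = t 0 ∧ s 1 = t 1 ∧ s 2 = t 2) → s = t := by
      rintro t ⟨a, b, c⟩
      ext j; fin_cases j <;> assumption
    have : (s 0 = 0 ∧ s 1 = 0 ∧ s 2 = 0) ∨ (s 0 = 1 ∧ s 1 = 0 ∧ s 2 = 0) ∨
      (s 0 = 0 ∧ s 1 = 1 ∧ s 2 = 0) ∨ (s 0 = 0 ∧ s 1 = 0 ∧ s 2 = 1) := by omega
    rcases this with h | h | h | h
    · left; apply key; simpa using h
    · right; left; apply key; simpa using h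
    · right; right; left; apply key; simpa using h
    · right; right; right; apply key; simpa using h
  rcases h3 with rfl | rfl | rfl | rfl
  · exact Submodule.subset_span (by simp)
  · exact Sp1 _ _ _
  · exact Sp2 _ _ _
  · exact Sp3 _ _ _

lemma Sp_map (F : PR ≃ₐ[ℂ] PR) (a b c : PR) :
    (Sp a b c).map F.toLinearMap = Sp (F a) (F b) (F c) := by
  rw [Sp, Submodule.map_span, Sp]
  congr 1
  simp [Set.image_insert_eq, Set.image_singleton]

lemma map_eq_gen {M : Type*} [AddCommGroup M] [Module ℂ M] (V : Submodule ℂ M) [FiniteDimensional ℂ V]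
    (g : M →ₗ[ℂ] M) (hg : Function.Injective g) (h : V.map g ≤ V) : V.map g = V :=
  Submodule.eq_of_le_of_finrank_eq h (Submodule.equivMapOfInjective g hg V).finrank_eq.symm

lemma aff_V0 {G : PR ≃ₐ[ℂ] PR} (hG : IsAffineAut G) :
    (Sp (X 0) (X 1) (X 2)).map G.toLinearMap = Sp (X 0) (X 1) (X 2) := by
  have hfd : FiniteDimensional ℂ (Sp (X 0) (X 1) (X 2)) := by
    unfold Sp; exact FiniteDimensional.span_of_finite ℂ (Set.toFinite _)
  have hinj : Function.Injective G.toLinearMap := by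
    have := G.injective
    intro x y h
    simp only [AlgEquiv.toLinearMap_apply] at h
    exact this h
  refine map_eq_gen (M := PR) (Sp (X 0) (X 1) (X 2)) G.toLinearMap hinj ?_
  rw [Sp_map]
  exact Sp_le (mem_V0 (hG 0)) (mem_V0 (hG 1)) (mem_V0 (hG 2))

lemma tame_TR {F : PR ≃ₐ[ℂ] PR} (hF : IsTameAut F) : TR w (fun i => F (X i)) := by
  unfold IsTameAut at hF
  refine Subgroup.closure_induction_right (G := PR ≃ₐ[ℂ] PR)
    (s := {G : PR ≃ₐ[ℂ] PR | IsAffineAut G ∨ IsElementaryAut G})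
    (p := fun (F : PR ≃ₐ[ℂ] PR) _ => TR w (fun i => F (X i))) ?_ ?_ ?_ hF
  · exact ⟨Sp_base, Red.base⟩
  · rintro F hF G (hG | ⟨i, p, hp, hi, hj⟩) ih
    · have e : Sp (F (X 0)) (F (X 1)) (F (X 2)) = Sp ((F * G) (X 0)) ((F * G) (X 1)) ((F * G) (X 2)) := by
        rw [← Sp_map, ← aff_V0 hG, Sp_map, Sp_map]; rfl
      exact ⟨K3.congr ih.1 e, by have := ih.2; simp only at this ⊢; rwa [← e]⟩
    · refine ih.el i ?_ ?_
      · intro j h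
        show F (G (X j)) = F (X j)
        rw [hj j h]
      · show F (G (X i)) - F (X i) ∈ _
        rw [hi, map_add, add_sub_cancel_left]
        exact adjoin_map F hp
  · rintro F hF G (hG | ⟨i, p, hp, hi, hj⟩) ih
    · have e : Sp (F (X 0)) (F (X 1)) (F (X 2)) =
          Sp ((F * G⁻¹) (X 0)) ((F * G⁻¹) (X 1)) ((F * G⁻¹) (X 2)) := by
        have : F = F * G⁻¹ * G := by simp
        rw [← Sp_map (F * G⁻¹), ← aff_V0 hG, Sp_map, Sp_map]
        conv_lhs => rw [this]
        rfl
      exact ⟨K3.congr ih.1 e, by have := ih.2; simp only at this ⊢; rwa [← e]⟩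
    · have e : ∀ x, F x = (F * G⁻¹) (G x) := by
        intro x
        have : F = F * G⁻¹ * G := by simp
        conv_lhs => rw [this]
        rfl
      have ej : ∀ j, j ≠ i → (F * G⁻¹) (X j) = F (X j) := by
        intro j h
        rw [e (X j), hj j h]
      refine ih.el i ej ?_
      show (F * G⁻¹) (X i) - F (X i) ∈ _
      rw [e (X i), hi, map_add, sub_add_cancel_left]
      refine neg_mem ?_
      have := adjoin_map (F * G⁻¹) hp
      convert this using 2
      apply Set.image_congr
      intro j hj
      exact (ej j hj).symm
end


/-! Part 15 -/
set_option linter.unusedSectionVars false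
set_option linter.unusedVariables false
section

lemma exists_w {η : ℝ} (h0 : 0 < η) (h1 : η ≤ 1) : ∃ w : Fin 3 → ℝ, GoodW w ∧ ∀ i, w i ≤ 1 + η := by
  have c1 : (Set.range fun t : ℤ × ℤ => (-(t.1:ℝ) / t.2)).Countable := Set.countable_range _
  obtain ⟨u, hu, hu1, hu2⟩ := (c1.dense_compl ℝ).exists_between (show (1:ℝ) < 1 + η by linarith)
  have c2 : (Set.range fun t : ℤ × ℤ × ℤ => ((-(t.1:ℝ) - t.2.1 * u) / t.2.2)).Countable :=
    Set.countable_range _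
  obtain ⟨v, hv, hv1, hv2⟩ := (c2.dense_compl ℝ).exists_between (show (1:ℝ) < 1 + η by linarith)
  refine ⟨![1, u, v], ⟨?_, ?_, ?_⟩, ?_⟩
  · intro i; fin_cases i <;> simp <;> linarith
  · intro i; fin_cases i <;> simp <;> linarith
  · intro α h
    rw [Fin.sum_univ_three] at h
    simp at h
    have e2 : α 2 = 0 := by
      by_contra hc
      apply hv
      refine ⟨(α 0, α 1, α 2), ?_⟩
      have : (α 2 : ℝ) ≠ 0 := by exact_mod_cast hc
      simp only
      field_simp
      linarith
    have e1 : α 1 = 0 := by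
      by_contra hc
      apply hu
      refine ⟨(α 0, α 1), ?_⟩
      have : (α 1 : ℝ) ≠ 0 := by exact_mod_cast hc
      rw [e2] at h
      simp only
      field_simp
      push_cast at h
      linarith
    have e0 : α 0 = 0 := by
      rw [e1, e2] at h
      push_cast at h
      have : (α 0 : ℝ) = 0 := by linarith
      exact_mod_cast this
    ext i; fin_cases i <;> assumption
  · intro i; fin_cases i <;> simp <;> linarith

def Nr (w : Fin 3 → ℝ) (p : PR) (d : ℕ) : Prop := (d:ℝ) ≤ deg w p ∧ deg w p ≤ d + 1 / 10 ∧
  ∃ m : Fin 3 →₀ ℕ, deg w p = wt w m ∧ m 0 + m 1 + m 2 = d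

lemma sum3 (s : Fin 3 →₀ ℕ) : (s.sum fun _ e => e) = s 0 + s 1 + s 2 := by
  rw [Finsupp.sum_fintype _ _ (fun _ => rfl), Fin.sum_univ_three]

lemma exists_Nr (D : ℕ) : ∃ w : Fin 3 → ℝ, GoodW w ∧ ∀ p : PR, 0 < p.totalDegree → p.totalDegree ≤ D →
    Nr w p p.totalDegree := by
  have hD : (0:ℝ) < 10 * (D + 1) := by positivity
  obtain ⟨w, hw, hη⟩ := exists_w (η := 1 / (10 * (D + 1))) (by positivity) (by
    rw [div_le_one hD]; have : (0:ℝ) ≤ D := by positivity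
    linarith)
  refine ⟨w, hw, fun p hp hD => ?_⟩
  set η : ℝ := 1 / (10 * (D + 1)) with hh
  have hη0 : 0 < η := by positivity
  have hηD : η * D ≤ 1 / 10 := by
    rw [hh, div_mul_eq_mul_div, one_mul, div_le_iff₀ (by positivity)]; linarith
  have up : ∀ m : Fin 3 →₀ ℕ, wt w m ≤ (1 + η) * ((m 0 + m 1 + m 2 : ℕ):ℝ) := by
    intro m
    rw [wt, Fin.sum_univ_three]
    push_cast
    have t : ∀ i, w i * (m i:ℝ) ≤ (1 + η) * m i := fun i =>
      mul_le_mul_of_nonneg_right (hη i) (Nat.cast_nonneg _)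
    linarith [t 0, t 1, t 2]
  have lo : ∀ m : Fin 3 →₀ ℕ, ((m 0 + m 1 + m 2 : ℕ):ℝ) ≤ wt w m := by
    intro m
    rw [wt, Fin.sum_univ_three]
    push_cast
    have t : ∀ i, (m i:ℝ) ≤ w i * m i := fun i => by
      nlinarith [hw.one_le i, (Nat.cast_nonneg (m i) : (0:ℝ) ≤ m i)]
    linarith [t 0, t 1, t 2]
  have hp0 : p ≠ 0 := by rintro rfl; simp at hp
  obtain ⟨m, hm, e⟩ := exists_deg w hp0
  obtain ⟨n, hn, e2⟩ := Finset.exists_mem_eq_sup p.support (by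
    rwa [Finset.nonempty_iff_ne_empty, ne_eq, MvPolynomial.support_eq_empty]) (fun s => s.sum fun _ e => e)
  have e2' : p.totalDegree = n 0 + n 1 + n 2 := by rw [← sum3]; exact e2
  have h1 : (p.totalDegree : ℝ) ≤ deg w p := by
    rw [e2']; exact (lo n).trans (wt_le_deg w (mem_support_iff.1 hn))
  have h2 : m 0 + m 1 + m 2 ≤ p.totalDegree := by
    rw [← sum3]; exact le_totalDegree (mem_support_iff.2 hm)
  have h2' : ((m 0 + m 1 + m 2 : ℕ):ℝ) ≤ p.totalDegree := by exact_mod_cast h2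
  have h3 := up m
  have h4 : (p.totalDegree : ℝ) ≤ D := by exact_mod_cast hD
  have h5 : η * ((m 0 + m 1 + m 2 : ℕ):ℝ) ≤ 1 / 10 :=
    (mul_le_mul_of_nonneg_left (h2'.trans h4) hη0.le).trans hηD
  refine ⟨h1, ?_, m, e.symm, ?_⟩
  · rw [← e]; linarith
  · have : (p.totalDegree : ℝ) < ((m 0 + m 1 + m 2 : ℕ):ℝ) + 1 := by
      rw [← e] at h1; linarith
    have : p.totalDegree < m 0 + m 1 + m 2 + 1 := by exact_mod_cast this
    omega

variable {w : Fin 3 → ℝ} [hw : GoodW w]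

lemma wt_nsmul (n : ℕ) (m : Fin 3 →₀ ℕ) : wt w (n • m) = n * wt w m := by
  simp only [wt, Finset.mul_sum]
  refine Finset.sum_congr rfl fun i _ => ?_
  simp; ring

lemma Nr.rel {p q s : PR} {d e f : ℕ} (hp : Nr w p d) (hq : Nr w q e) (hs : Nr w s f) {i j k : ℕ}
    (h : i * deg w p = j * deg w q + k * deg w s) : i * d = j * e + k * f := by
  obtain ⟨_, _, m, h1, rfl⟩ := hp
  obtain ⟨_, _, n, h2, rfl⟩ := hq
  obtain ⟨_, _, t, h3, rfl⟩ := hs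
  rw [h1, h2, h3, ← wt_nsmul, ← wt_nsmul, ← wt_nsmul, ← wt_add] at h
  have := wt_inj w h
  have t0 := DFunLike.congr_fun this 0
  have t1 := DFunLike.congr_fun this 1
  have t2 := DFunLike.congr_fun this 2
  simp at t0 t1 t2
  linarith
end


/-! Part 16 -/
set_option linter.unusedSectionVars false
set_option linter.unusedVariables false
section
variable {w : Fin 3 → ℝ} [hw : GoodW w]

lemma frob {d2 d3 : ℕ} (h0 : ¬ 3 ∣ d2) (h1 : 2 * d2 ≤ d3 + 2) (h2 : d2 ≤ d3) :
    ∃ x y : ℕ, d3 = 3 * x + y * d2 := by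
  have h : d3 % 3 = 0 ∨ (d3 % 3 = d2 % 3) ∨ (d3 % 3 = (2 * d2) % 3) := by
    have : d2 % 3 = 1 ∨ d2 % 3 = 2 := by omega
    rcases this with h | h <;> omega
  rcases h with h | h | h
  · exact ⟨d3 / 3, 0, by omega⟩
  · exact ⟨(d3 - d2) / 3, 1, by omega⟩
  · exact ⟨(d3 - 2 * d2) / 3, 2, by omega⟩

lemma cop3 {p q d : ℕ} (hp : 2 ≤ p) (hc : Nat.Coprime p q) (h : p * d = 3 * q) : p = 3 ∧ q = d := by
  have h1 : p ∣ 3 := hc.dvd_of_dvd_mul_right (Dvd.intro _ h)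
  have h2 : p = 3 := by
    have := Nat.le_of_dvd (by norm_num) h1
    interval_cases p <;> omega
  subst h2; omega

theorem karas {a b c : PR} {d2 d3 : ℕ} (h3 : 3 < d2) (h23 : d2 < d3) (n1 : ¬ 3 ∣ d2)
    (n2 : ∀ x y : ℕ, d3 ≠ 3 * x + y * d2) (hK : K3 a b c) (R : Red w (Sp a b c))
    (Na : Nr w a 3) (Nb : Nr w b d2) (Nc : Nr w c d3) : False := by
  have a1 := Na.1
  have a2 := Na.2.1
  have b1 := Nb.1
  have b2 := Nb.2.1
  have c1 := Nc.1
  have c2 := Nc.2.1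
  push_cast at a1 a2
  have h3' : (4:ℝ) ≤ d2 := by exact_mod_cast h3
  have h23' : (d2:ℝ) + 1 ≤ d3 := by exact_mod_cast h23
  have n3 : ¬ 3 ∣ d3 := by
    rintro ⟨k, rfl⟩
    exact n2 k 0 (by ring)
  have n4 : ¬ (2 * d2 ≤ d3 + 2) := by
    intro h
    obtain ⟨x, y, e⟩ := frob n1 h h23.le
    exact n2 x y e
  have hab : deg w a < deg w b := by linarith
  have hbc : deg w b < deg w c := by linarith
  have hac := hab.trans hbc
  have hx : GB w a b c := ⟨hK, hab, hbc⟩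
  rcases inv hx R with h | ⟨r, hr, lr, -⟩ | ⟨β, r, hr, lr, -⟩ | ⟨α, β, r, hr, lr, -⟩ |
    ⟨f, g, h, r, k, δ, kd, e⟩
  · obtain ⟨i, hi⟩ := deg_base (w := w) (v := a) (h ▸ Sp1 a b c) (by linarith)
    linarith [hw.lt_two i]
  · -- top
    have dr := deg_of_lt lr
    have hc := hK.cr12
    have hD := Dl_pos w hc
    rcases lemP4 (w := w) hc hr with h | ⟨k, hk, e⟩ | ⟨k, hk, e⟩ | ⟨p, q, ε, hp, hq, hpq, hε, e1, e2, h, -⟩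
    · obtain ⟨i, j, e⟩ := h.2 (by linarith)
      rw [dr] at e
      have := Nc.rel (i := 1) Na Nb (by push_cast; rw [one_mul]; exact e)
      exact n2 i j (by linarith)
    · have := Nb.rel (i := 1) (k := 0) Na Na (j := k) (by push_cast; linarith)
      exact n1 ⟨k, by linarith⟩
    · have : (1:ℝ) ≤ k := by exact_mod_cast hk
      nlinarith
    · have := Nb.rel (i := p) (k := 0) Na Na (j := q) (by push_cast; rw [e1, e2]; ring)
      obtain ⟨rfl, rfl⟩ := cop3 hp hpq (show p * d2 = 3 * q by linarith)
      apply n4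
      rw [dr] at h
      push_cast at h e1
      have he : 1 ≤ ε := by linarith
      have : (2 * q : ℝ) - 2 ≤ d3 + 1 / 10 := by nlinarith
      have : (2 * q : ℝ) < d3 + 3 := by linarith
      have : 2 * q < d3 + 3 := by exact_mod_cast this
      omega
  · -- middle
    have dr := deg_of_lt lr
    have K' : K3 a (c + β • b) b := K3.swap23 (hK.add (Subalgebra.smul_mem _ (A2r _ _) _))
    have hc := K'.cr12
    have hD := Dl_pos w hc
    have dc : deg w (c + β • b) = deg w c := deg_pert β hbc
    rcases lemP4 (w := w) hc hr with h | ⟨k, hk, e⟩ | ⟨k, hk, e⟩ | ⟨p, q, ε, hp, hq, hpq, hε, e1, e2, h, -⟩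
    · obtain ⟨i, j, e⟩ := h.2 (by linarith)
      rw [dr, dc] at e
      have := Nb.rel (i := 1) Na Nc (by push_cast; rw [one_mul]; exact e)
      rcases Nat.eq_zero_or_pos j with rfl | hj
      · exact n1 ⟨i, by linarith⟩
      · nlinarith
    · rw [dc] at e
      have := Nc.rel (i := 1) (k := 0) Na Na (j := k) (by push_cast; linarith)
      exact n3 ⟨k, by linarith⟩
    · rw [dc] at e
      have : (1:ℝ) ≤ k := by exact_mod_cast hk
      nlinarith
    · rw [dc] at e2
      have := Nc.rel (i := p) (k := 0) Na Na (j := q) (by push_cast; rw [e1, e2]; ring)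
      obtain ⟨rfl, rfl⟩ := cop3 hp hpq (show p * d3 = 3 * q by linarith)
      rw [dr] at h
      push_cast at h e1
      have he : 1 ≤ ε := by linarith
      nlinarith
  · -- bottom
    have dr := deg_of_lt lr
    have K' : K3 (b + α • a) (c + β • a) a := by
      refine K3.swap23 (K3.add ?_ (Subalgebra.smul_mem _ (A2r _ _) _))
      exact hK.swap.congr (Sp_sh _ _ _ _).symm
    have hc := K'.cr12
    have hD := Dl_pos w hc
    have db : deg w (b + α • a) = deg w b := deg_pert α hab
    have dc : deg w (c + β • a) = deg w c := deg_pert β hac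
    rcases lemP4 (w := w) hc hr with h | ⟨k, hk, e⟩ | ⟨k, hk, e⟩ | ⟨p, q, ε, hp, hq, hpq, hε, e1, e2, h, -⟩
    · obtain ⟨i, j, e⟩ := h.2 (by linarith)
      rw [dr, db, dc] at e
      have := Na.rel (i := 1) Nb Nc (by push_cast; rw [one_mul]; exact e)
      rcases Nat.eq_zero_or_pos j with rfl | hj
      · rcases Nat.eq_zero_or_pos i with rfl | hi
        · omega
        · nlinarith
      · nlinarith
    · rw [db, dc] at e
      have := Nc.rel (i := 1) (k := 0) Nb Nb (j := k) (by push_cast; linarith)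
      exact n2 0 k (by linarith)
    · rw [db, dc] at e
      have : (1:ℝ) ≤ k := by exact_mod_cast hk
      nlinarith
    · rw [db] at e1
      rw [dc] at e2
      rw [dr] at h
      have hlt : p < q := by
        have : (p:ℝ) * ε < q * ε := by linarith
        exact_mod_cast lt_of_mul_lt_mul_right this hε.le
      have hlt' : (p:ℝ) + 1 ≤ q := by exact_mod_cast hlt
      rcases Nat.lt_or_ge 2 p with hp3 | hp2
      · have hp3' : (3:ℝ) ≤ p := by exact_mod_cast hp3
        have : (q:ℝ) ≤ p * q - p - q := by nlinarith
        have : (q:ℝ) * ε ≤ (p * q - p - q) * ε := mul_le_mul_of_nonneg_right this hε.le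
        linarith
      · have : p = 2 := by omega
        subst this
        push_cast at e1 h
        have he : 2 ≤ ε := by linarith
        have hq3 : q = 3 := by
          by_contra hne
          have : 4 ≤ q := by omega
          have : (4:ℝ) ≤ q := by exact_mod_cast this
          nlinarith
        subst hq3
        have := Nc.rel (i := 2) (k := 0) Nb Nb (j := 3) (by push_cast; rw [e1, e2]; push_cast; ring)
        push_cast at h
        have : (d2:ℝ) < 5 := by linarith
        have : d2 < 5 := by exact_mod_cast this
        exact n3 ⟨2, by omega⟩
  · have kc := kd.conseq
    obtain ⟨e1, e2, e3⟩ := hx.deg_eq kc.gb (by rw [e, Sp_312])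
    have u1 := kc.hge
    have u2 := kc.Dpos
    have u3 := kd.dh
    have u4 := kc.gle
    have u5 := kc.T
    have u6 := kc.D23
    have u7 := Dl_le w f (g + k • h ^ 2)
    have u8 := kd.df
    have : (d2:ℝ) < 5 := by linarith
    have : d2 < 5 := by exact_mod_cast this
    have : (d3:ℝ) < 7 := by linarith
    have : d3 < 7 := by exact_mod_cast this
    have : (5:ℝ) < d3 := by linarith
    have : 5 < d3 := by exact_mod_cast this
    exact n3 ⟨2, by omega⟩

theorem tame_imp {d2 d3 : ℕ} (h2 : 3 ≤ d2) (h23 : d2 ≤ d3) {F : PR ≃ₐ[ℂ] PR} (hF : IsTameAut F)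
    (hm : polyMdeg F = ![3, d2, d3]) : 3 ∣ d2 ∨ ∃ a b : ℕ, d3 = 3 * a + b * d2 := by
  by_contra hcon
  push Not at hcon
  obtain ⟨n1, n2⟩ := hcon
  have t0 : (F (X 0)).totalDegree = 3 := congrFun hm 0
  have t1 : (F (X 1)).totalDegree = d2 := congrFun hm 1
  have t2 : (F (X 2)).totalDegree = d3 := congrFun hm 2
  obtain ⟨w, hw, H⟩ := exists_Nr d3
  have T := tame_TR (w := w) hF
  have N0 := H (F (X 0)) (by omega) (by omega)
  have N1 := H (F (X 1)) (by omega) (by omega)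
  have N2 := H (F (X 2)) (by omega) (by omega)
  rw [t0] at N0
  rw [t1] at N1
  rw [t2] at N2
  refine karas ?_ ?_ n1 n2 T.1 T.2 N0 N1 N2
  · refine lt_of_le_of_ne h2 ?_
    rintro rfl
    exact n1 ⟨1, rfl⟩
  · refine lt_of_le_of_ne h23 ?_
    rintro rfl
    exact n2 0 1 (by ring)
end


/-! Part 17 -/
set_option linter.unusedSectionVars false
set_option linter.unusedVariables false
section

lemma fix_p {i : Fin 3} {p : PR} (hp : degreeOf i p = 0) (φ : PR →ₐ[ℂ] PR)
    (h : ∀ j, j ≠ i → φ (X j) = X j) : φ p = p := by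
  have := hom_congr_vars (f₁ := (φ : PR →+* PR)) (f₂ := RingHom.id PR) (p₁ := p) (p₂ := p) (by
    ext x; simp [← MvPolynomial.algebraMap_eq]) (by
    intro j hj _
    refine h j ?_
    rintro rfl
    exact (mem_vars_iff_degreeOf_ne_zero.1 hj) hp) rfl
  exact this

noncomputable def sh (i : Fin 3) (p : PR) : PR →ₐ[ℂ] PR := aeval (Function.update X i (X i + p))

lemma sh_i (i : Fin 3) (p : PR) : sh i p (X i) = X i + p := by simp [sh]
lemma sh_j {i j : Fin 3} (p : PR) (h : j ≠ i) : sh i p (X j) = X j := by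
  simp [sh, Function.update_of_ne h]

lemma sh_comp {i : Fin 3} {p q : PR} (hp : degreeOf i p = 0) (h : p + q = 0) :
    (sh i q).comp (sh i p) = AlgHom.id ℂ PR := by
  apply MvPolynomial.algHom_ext
  intro j
  rw [AlgHom.comp_apply, AlgHom.id_apply]
  by_cases hj : j = i
  · subst hj
    rw [sh_i, map_add, sh_i, fix_p hp _ (fun k hk => sh_j q hk), add_assoc, add_comm q, h, add_zero]
  · rw [sh_j _ hj, sh_j _ hj]

lemma exists_el (i : Fin 3) (p : PR) (hp : degreeOf i p = 0) : ∃ F : PR ≃ₐ[ℂ] PR, IsTameAut F ∧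
    F (X i) = X i + p ∧ ∀ j, j ≠ i → F (X j) = X j := by
  have hp' : degreeOf i (-p) = 0 := by rw [degreeOf_neg]; exact hp
  refine ⟨AlgEquiv.ofAlgHom (sh i p) (sh i (-p)) (sh_comp hp' (by ring)) (sh_comp hp (by ring)), ?_,
    sh_i i p, fun j hj => sh_j p hj⟩
  exact Subgroup.subset_closure (Or.inr ⟨i, p, hp, sh_i i p, fun j hj => sh_j p hj⟩)

lemma td_mul {p q : PR} (hp : p ≠ 0) (hq : q ≠ 0) :
    (p * q).totalDegree = p.totalDegree + q.totalDegree := totalDegree_mul_of_isDomain hp hq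

lemma td_pow {p : PR} (hp : p ≠ 0) (n : ℕ) : (p ^ n).totalDegree = n * p.totalDegree := by
  induction n with
  | zero => simp
  | succ n ih => rw [pow_succ, td_mul (pow_ne_zero _ hp) hp, ih]; ring

lemma td_add (i : Fin 3) {p : PR} {d : ℕ} (hp : p.totalDegree = d) (hd : 1 < d) :
    (X i + p).totalDegree = d := by
  rw [totalDegree_add_eq_right_of_totalDegree_lt, hp]
  rw [hp, totalDegree_X]; exact hd

lemma ne_td {p : PR} (h : 0 < p.totalDegree) : p ≠ 0 := by
  rintro rfl; simp at h

theorem imp_tame {d2 d3 : ℕ} (h2 : 3 ≤ d2) (h23 : d2 ≤ d3)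
    (h : 3 ∣ d2 ∨ ∃ a b : ℕ, d3 = 3 * a + b * d2) :
    ∃ F : PR ≃ₐ[ℂ] PR, IsTameAut F ∧ polyMdeg F = ![3, d2, d3] := by
  have key : ∀ F : PR ≃ₐ[ℂ] PR, (F (X 0)).totalDegree = 3 → (F (X 1)).totalDegree = d2 →
      (F (X 2)).totalDegree = d3 → polyMdeg F = ![3, d2, d3] := by
    intro F h0 h1 h2
    ext i; fin_cases i <;> assumption
  rcases h with ⟨k, hk⟩ | ⟨a, b, hab⟩
  · obtain ⟨A, hA, A0, Aj⟩ := exists_el 0 (X 1 ^ 3) (degreeOf_X_pow_of_ne _ (by decide))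
    obtain ⟨B, hB, B2, Bj⟩ := exists_el 2 (X 1 ^ d3) (degreeOf_X_pow_of_ne _ (by decide))
    obtain ⟨G, hG, G1, Gj⟩ := exists_el 1 (X 0 ^ k) (degreeOf_X_pow_of_ne _ (by decide))
    have t0 : (X 0 + X 1 ^ 3 : PR).totalDegree = 3 := td_add 0 (by rw [totalDegree_X_pow]) (by norm_num)
    refine ⟨A * B * G, mul_mem (mul_mem hA hB) hG, key _ ?_ ?_ ?_⟩
    · show (A (B (G (X 0)))).totalDegree = 3
      rw [Gj 0 (by decide), Bj 0 (by decide), A0, t0]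
    · show (A (B (G (X 1)))).totalDegree = d2
      rw [G1, map_add, map_pow, Bj 0 (by decide), Bj 1 (by decide), map_add, map_pow, A0, Aj 1 (by decide)]
      refine td_add 1 ?_ (by omega)
      rw [td_pow (ne_td (by omega)), t0]; omega
    · show (A (B (G (X 2)))).totalDegree = d3
      rw [Gj 2 (by decide), B2, map_add, map_pow, Aj 1 (by decide), Aj 2 (by decide)]
      exact td_add 2 (by rw [totalDegree_X_pow]) (by omega)
  · obtain ⟨A, hA, A0, Aj⟩ := exists_el 0 (X 2 ^ 3) (degreeOf_X_pow_of_ne _ (by decide))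
    obtain ⟨B, hB, B1, Bj⟩ := exists_el 1 (X 2 ^ d2) (degreeOf_X_pow_of_ne _ (by decide))
    obtain ⟨G, hG, G2, Gj⟩ := exists_el 2 (X 0 ^ a * X 1 ^ b) (by
      have := degreeOf_mul_le (2 : Fin 3) (X 0 ^ a : PR) (X 1 ^ b)
      rw [degreeOf_X_pow_of_ne _ (by decide), degreeOf_X_pow_of_ne _ (by decide)] at this
      omega)
    have t0 : (X 0 + X 2 ^ 3 : PR).totalDegree = 3 := td_add 0 (by rw [totalDegree_X_pow]) (by norm_num)
    have t1 : (X 1 + X 2 ^ d2 : PR).totalDegree = d2 := td_add 1 (by rw [totalDegree_X_pow]) (by omega)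
    refine ⟨A * B * G, mul_mem (mul_mem hA hB) hG, key _ ?_ ?_ ?_⟩
    · show (A (B (G (X 0)))).totalDegree = 3
      rw [Gj 0 (by decide), Bj 0 (by decide), A0, t0]
    · show (A (B (G (X 1)))).totalDegree = d2
      rw [Gj 1 (by decide), B1, map_add, map_pow, Aj 1 (by decide), Aj 2 (by decide), t1]
    · show (A (B (G (X 2)))).totalDegree = d3
      rw [G2, map_add, map_mul, map_pow, map_pow, B1, Bj 0 (by decide), Bj 2 (by decide), map_add,
        map_mul, map_pow, map_pow, map_add, map_pow, A0, Aj 1 (by decide), Aj 2 (by decide)]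
      have n0 : (X 0 + X 2 ^ 3 : PR) ≠ 0 := ne_td (by omega)
      have n1 : (X 1 + X 2 ^ d2 : PR) ≠ 0 := ne_td (by omega)
      refine td_add 2 ?_ (by omega)
      rw [td_mul (pow_ne_zero _ n0) (pow_ne_zero _ n1), td_pow n0, td_pow n1, t0, t1]
      omega
end

/-- **(Karaś)** For `3 ≤ d2 ≤ d3`, the sequence `(3, d2, d3)` is the multidegree of some tame
automorphism of `ℂ³` if and only if `3 ∣ d2` or `d3 ∈ 3ℕ + d2ℕ`. -/
theorem mdeg_three_d2_d3_tame_iff (d2 d3 : ℕ) (h2 : 3 ≤ d2) (h23 : d2 ≤ d3) :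
    (∃ F : MvPolynomial (Fin 3) ℂ ≃ₐ[ℂ] MvPolynomial (Fin 3) ℂ,
        IsTameAut F ∧ polyMdeg F = ![3, d2, d3]) ↔
      (3 ∣ d2 ∨ ∃ a b : ℕ, d3 = 3 * a + b * d2) := by
  exact ⟨fun ⟨_, hF, hm⟩ => tame_imp h2 h23 hF hm, fun h => imp_tame h2 h23 h⟩
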